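/- Let P be a prime centrally symmetric simplicial 4-polytope in ℝ^4 with g_2(P) = 2. Then P is a 4-dimensional cross-polytope: there exists a basis b_1, b_2, b_3, b_4 of ℝ^4 such that V(P) = {±b_1, ±b_2, ±b_3, ±b_4}. -/

import Mathlib

open Finset
open scoped Classical

noncomputable section

/-- A finite graph: a finite vertex set together with a finite set of edges,
where each edge is (intended to be) a 2-element subset of the vertex set. -/
structure FinGraph (ι : Type) where
  verts : Finset ι
  edges : Finset (Finset ι)

/-- Every edge is a 2-element subset of the vertex set. -/
def FinGraph.Good {ι : Type} (G : FinGraph ι) : Prop :=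
  ∀ e ∈ G.edges, e ⊆ G.verts ∧ e.card = 2

/-- The standard inner (dot) product on `ℝ^d`. -/
def dotR {d : ℕ} (x y : Fin d → ℝ) : ℝ := ∑ i, x i * y i

/-- An infinitesimal motion of the framework `(G, p)`. -/
def IsMotion {ι : Type} {d : ℕ} (G : FinGraph ι) (p m : ι → Fin d → ℝ) : Prop :=
  ∀ e ∈ G.edges, ∀ u ∈ e, ∀ v ∈ e, dotR (p u - p v) (m u - m v) = 0

/-- The framework `(G, p)` is infinitesimally rigid in `ℝ^d`: every infinitesimal
motion is the restriction of a motion `x ↦ A x + b` of `ℝ^d` with `A` skew-symmetric. -/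
def IsInfRigid {ι : Type} (d : ℕ) (G : FinGraph ι) (p : ι → Fin d → ℝ) : Prop :=
  ∀ m : ι → Fin d → ℝ, IsMotion G p m →
    ∃ (A : Matrix (Fin d) (Fin d) ℝ) (b : Fin d → ℝ),
      A.transpose = -A ∧ ∀ v ∈ G.verts, m v = A.mulVec (p v) + b

/-- A stress on the framework `(G, p)`. -/
def IsStress {ι : Type} {d : ℕ} (G : FinGraph ι) (p : ι → Fin d → ℝ)
    (ω : Finset ι → ℝ) : Prop :=
  ∀ v ∈ G.verts,
    (∑ e ∈ G.edges.filter (fun e => v ∈ e), ∑ u ∈ e.erase v, ω e • (p v - p u)) = 0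

/-- A centrally symmetric framework with free involution `ν` satisfying `p (ν v) = -(p v)`. -/
def IsCSFramework {ι : Type} {d : ℕ} (G : FinGraph ι) (p : ι → Fin d → ℝ) (ν : ι → ι) : Prop :=
  (∀ v ∈ G.verts, ν (ν v) = v) ∧
  (∀ v ∈ G.verts, ν v ∈ G.verts) ∧
  (∀ v ∈ G.verts, ν v ≠ v) ∧
  (∀ e ∈ G.edges, e.image ν ∈ G.edges) ∧
  (∀ e ∈ G.edges, e.image ν ≠ e) ∧
  (∀ v ∈ G.verts, p (ν v) = -(p v))

/-- The convex body spanned by a finite point set. -/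
def polyBody {d : ℕ} (V : Finset (Fin d → ℝ)) : Set (Fin d → ℝ) :=
  convexHull ℝ (V : Set (Fin d → ℝ))

/-- `(f, c)` is a supporting functional for `conv V` exposing the face `F`. -/
def IsSupport {d : ℕ} (V : Finset (Fin d → ℝ)) (f : (Fin d → ℝ) →ₗ[ℝ] ℝ) (c : ℝ)
    (F : Set (Fin d → ℝ)) : Prop :=
  (∀ y ∈ polyBody V, f y ≤ c) ∧ F = {y ∈ polyBody V | f y = c}

/-- A proper face of the polytope `conv V`. -/
def IsProperFace {d : ℕ} (V : Finset (Fin d → ℝ)) (F : Set (Fin d → ℝ)) : Prop :=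
  (∃ f c, IsSupport V f c F) ∧ F ≠ polyBody V

/-- A simplicial `d`-polytope in `ℝ^d`, recorded by its vertex set `V`: the polytope is
`conv V`, it is `d`-dimensional, every element of `V` is a vertex, and every proper face
is a simplex (the convex hull of its affinely independent vertex set). -/
structure SPolytope (d : ℕ) where
  V : Finset (Fin d → ℝ)
  span_top : affineSpan ℝ (V : Set (Fin d → ℝ)) = ⊤
  extreme : ∀ v ∈ V, v ∉ convexHull ℝ ((V.erase v : Finset (Fin d → ℝ)) : Set (Fin d → ℝ))
  simplicial : ∀ F : Set (Fin d → ℝ), IsProperFace V F →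
    AffineIndependent ℝ
      (fun x : {y : Fin d → ℝ // y ∈ (V : Set (Fin d → ℝ)) ∩ F} => (x : Fin d → ℝ)) ∧
    F = convexHull ℝ ((V : Set (Fin d → ℝ)) ∩ F)

/-- `s` is a face of the boundary complex `∂P`. -/
def BFace {d : ℕ} (P : SPolytope d) (s : Finset (Fin d → ℝ)) : Prop :=
  s ⊆ P.V ∧ ∃ F : Set (Fin d → ℝ), IsProperFace P.V F ∧ (s : Set (Fin d → ℝ)) ⊆ F

/-- The number of vertices of `∂P`. -/
def f0 {d : ℕ} (P : SPolytope d) : ℕ := P.V.card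

/-- The edges of `∂P`. -/
def edgeFinset {d : ℕ} (P : SPolytope d) : Finset (Finset (Fin d → ℝ)) :=
  P.V.powerset.filter fun e => e.card = 2 ∧ BFace P e

/-- The number of edges of `∂P`. -/
def f1 {d : ℕ} (P : SPolytope d) : ℕ := (edgeFinset P).card

/-- `g₂(P) = f₁ - d f₀ + C(d+1, 2)`. -/
def g2 {d : ℕ} (P : SPolytope d) : ℤ :=
  (f1 P : ℤ) - (d : ℤ) * (f0 P : ℤ) + ((d + 1).choose 2 : ℤ)

/-- `P` is centrally symmetric. -/
def IsCS {d : ℕ} (P : SPolytope d) : Prop := ∀ v ∈ P.V, -v ∈ P.V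

/-- A missing face of `∂P`. -/
def IsMissingFace {d : ℕ} (P : SPolytope d) (σ : Finset (Fin d → ℝ)) : Prop :=
  σ ⊆ P.V ∧ ¬ BFace P σ ∧ ∀ τ ⊂ σ, BFace P τ

/-- `P` is prime: `∂P` has no missing facet, i.e. no missing face of cardinality `d`. -/
def IsPrimePoly {d : ℕ} (P : SPolytope d) : Prop :=
  ¬ ∃ σ : Finset (Fin d → ℝ), IsMissingFace P σ ∧ σ.card = d

/-- The graph (1-skeleton) of `∂P` as a framework graph. -/
def fullGraph {d : ℕ} (P : SPolytope d) : FinGraph (Fin d → ℝ) :=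
  ⟨P.V, edgeFinset P⟩

/-- The graph (1-skeleton) of the star of the face `τ` in `∂P`. -/
def starGraph {d : ℕ} (P : SPolytope d) (τ : Finset (Fin d → ℝ)) : FinGraph (Fin d → ℝ) :=
  ⟨P.V.filter fun v => BFace P (insert v τ),
   P.V.powerset.filter fun e => e.card = 2 ∧ BFace P (e ∪ τ)⟩

/-- Adjacency in the graph of `∂P`. -/
def Adj {d : ℕ} (P : SPolytope d) (u v : Fin d → ℝ) : Prop :=
  u ≠ v ∧ BFace P {u, v}

/-- `σ` is a face of the link of the face `τ` in `∂P`. -/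
def LinkFace {d : ℕ} (P : SPolytope d) (τ σ : Finset (Fin d → ℝ)) : Prop :=
  Disjoint σ τ ∧ BFace P (σ ∪ τ)

/-- `P` is a `d`-dimensional cross-polytope: its vertex set is `{±b₁, …, ±b_d}`
for some basis `b₁, …, b_d` of `ℝ^d`. -/
def IsCrossPolytope {d : ℕ} (P : SPolytope d) : Prop :=
  ∃ b : Fin d → (Fin d → ℝ), LinearIndependent ℝ b ∧
    (P.V : Set (Fin d → ℝ)) = Set.range b ∪ Set.range (fun i => -(b i))

/-- A facet of `P`: a proper face with `d` vertices. -/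
def IsFacet {d : ℕ} (P : SPolytope d) (F : Set (Fin d → ℝ)) : Prop :=
  IsProperFace P.V F ∧ ((P.V : Set (Fin d → ℝ)) ∩ F).ncard = d

/-- `x` lies beyond exactly one facet of `P`: it is strictly separated from `P` by the
affine hull of one facet `F`, and not separated from `P` by the affine hull of any
other facet. -/
def BeyondExactlyOne {d : ℕ} (P : SPolytope d) (x : Fin d → ℝ) : Prop :=
  ∃ F : Set (Fin d → ℝ), IsFacet P F ∧
    (∀ f c, IsSupport P.V f c F → c < f x) ∧
    (∀ F' : Set (Fin d → ℝ), IsFacet P F' → F' ≠ F →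
      ∀ f c, IsSupport P.V f c F' → f x < c)

/-- `P` is obtained from a `d`-dimensional cross-polytope by symmetric stacking: there is
a sequence of cs simplicial `d`-polytopes starting at a cross-polytope and ending at `P`,
each obtained from the previous one as `conv (P_k ∪ {v, -v})` for a point `v` lying
beyond exactly one facet of `P_k`. -/
def SymmetricStackingFrom {d : ℕ} (P : SPolytope d) : Prop :=
  ∃ (m : ℕ) (Q : Fin (m + 1) → SPolytope d),
    (∀ k, IsCS (Q k)) ∧
    IsCrossPolytope (Q 0) ∧
    Q (Fin.last m) = P ∧
    ∀ k : Fin m, ∃ v : Fin d → ℝ,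
      BeyondExactlyOne (Q (Fin.castSucc k)) v ∧
      polyBody (Q (Fin.succ k)).V =
        convexHull ℝ (polyBody (Q (Fin.castSucc k)).V ∪ {v, -v})

/-- `P` is a stacked `d`-polytope: obtained from a `d`-simplex by repeatedly adding a
point beyond exactly one facet. -/
def IsStacked {d : ℕ} (P : SPolytope d) : Prop :=
  ∃ (m : ℕ) (R : Fin (m + 1) → SPolytope d),
    (R 0).V.card = d + 1 ∧
    R (Fin.last m) = P ∧
    ∀ k : Fin m, ∃ v : Fin d → ℝ,
      BeyondExactlyOne (R (Fin.castSucc k)) v ∧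
      polyBody (R (Fin.succ k)).V =
        convexHull ℝ (polyBody (R (Fin.castSucc k)).V ∪ {v})

/-- Every `d` vertices of `P`, no two of which are antipodal, are affinely independent. -/
def GenPos {d : ℕ} (P : SPolytope d) : Prop :=
  ∀ S : Finset (Fin d → ℝ), S ⊆ P.V → S.card = d →
    (∀ x ∈ S, ∀ y ∈ S, x ≠ -y) →
    AffineIndependent ℝ (fun s : {x : Fin d → ℝ // x ∈ S} => (s : Fin d → ℝ))

/-- The graph of the cone `v₀ * S` over a simplicial complex `S` (a set of finsets):
the vertices of `S` together with `v₀`, and the edges of `S` together with all edges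
from `v₀` to vertices of `S`. -/
def coneGraph {d : ℕ} (P : SPolytope d) (v0 : Fin d → ℝ)
    (S : Set (Finset (Fin d → ℝ))) : FinGraph (Fin d → ℝ) :=
  ⟨insert v0 (P.V.filter fun u => ({u} : Finset (Fin d → ℝ)) ∈ S),
   (P.V.powerset.filter fun e => e.card = 2 ∧ e ∈ S) ∪
     (P.V.filter fun u => ({u} : Finset (Fin d → ℝ)) ∈ S).image
       fun u => ({v0, u} : Finset (Fin d → ℝ))⟩

abbrev Pt := Fin 4 → ℝ
abbrev WW := (Fin 4 → ℝ) × ℝ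
/-- homogenisation -/
def hat (u : Pt) : WW := (u, 1)

def Exf (P : SPolytope 4) (s : Finset Pt) : Prop :=
  s ⊆ P.V ∧ s ≠ P.V ∧ ∃ L : WW →ₗ[ℝ] ℝ, (∀ u ∈ s, L (hat u) = 0) ∧
    ∀ u ∈ P.V, u ∉ s → 0 < L (hat u)

lemma L_hat (L : WW →ₗ[ℝ] ℝ) (u : Pt) : L (hat u) = L (u, 0) + L (0, 1) := by
  rw [← map_add]; simp [hat]

lemma hat_li_of_affine {ι : Type} (p : ι → Pt) (h : AffineIndependent ℝ p) :
    LinearIndependent ℝ (fun i => hat (p i)) := by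
  rw [affineIndependent_iff] at h
  rw [linearIndependent_iff']
  intro s g hg i hi
  have h1 := congrArg Prod.fst hg
  have h2 := congrArg Prod.snd hg
  rw [Prod.fst_sum] at h1
  rw [Prod.snd_sum] at h2
  simp [hat] at h1 h2
  exact h s g h2 h1 i hi

lemma exists_eps {α : Type} (s : Finset α) (a b : α → ℝ) (ha : ∀ x ∈ s, 0 < a x) :
    ∃ ε : ℝ, 0 < ε ∧ ∀ x ∈ s, 0 < a x + ε * b x := by
  induction s using Finset.induction_on with
  | empty => exact ⟨1, one_pos, by simp⟩
  | insert x s hx ih =>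
    obtain ⟨ε, h0, h1⟩ := ih (fun y hy => ha y (by simp [hy]))
    have hax := ha x (by simp)
    refine ⟨min ε (a x / (2 * (|b x| + 1))), by positivity, ?_⟩
    intro y hy
    set δ := min ε (a x / (2 * (|b x| + 1))) with hδ
    have hδ0 : 0 < δ := by positivity
    rcases Finset.mem_insert.1 hy with rfl | hy
    · have : δ ≤ a y / (2 * (|b y| + 1)) := min_le_right _ _
      rw [le_div_iff₀ (by positivity)] at this
      have h3 := neg_abs_le (b y)
      nlinarith [abs_nonneg (b y)]
    · have h2 := h1 y hy
      have hle : δ ≤ ε := min_le_left _ _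
      have h4 := ha y (by simp [hy])
      rcases le_total 0 (b y) with h | h
      · nlinarith
      · nlinarith

lemma exists_dual {ι : Type} (p : ι → WW) (h : LinearIndependent ℝ p) (g : ι → ℝ) :
    ∃ L : WW →ₗ[ℝ] ℝ, ∀ i, L (p i) = g i := by
  let b := Module.Basis.span h
  obtain ⟨L, hL⟩ := LinearMap.exists_extend (b.constr ℝ g)
  refine ⟨L, fun i => ?_⟩
  have : L (p i) = (L ∘ₗ (Submodule.span ℝ (Set.range p)).subtype) (b i) := by
    simp [b, Module.Basis.span_apply]
  rw [this, hL, Module.Basis.constr_basis]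

lemma poly_le {V : Finset Pt} (f : Pt →ₗ[ℝ] ℝ) (c : ℝ) (h : ∀ u ∈ V, f u ≤ c) :
    ∀ y ∈ polyBody V, f y ≤ c := by
  have : polyBody V ⊆ {y | f y ≤ c} :=
    convexHull_min (fun u hu => h u hu) (convex_halfSpace_le f.isLinear c)
  exact this

/-- a nonnegative functional, positive somewhere, exposes a face -/
lemma bface_of_weak (P : SPolytope 4) (L : WW →ₗ[ℝ] ℝ) (h0 : ∀ u ∈ P.V, 0 ≤ L (hat u))
    (h1 : ∃ u ∈ P.V, L (hat u) ≠ 0) (s : Finset Pt) (hs : s ⊆ P.V)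
    (hz : ∀ u ∈ s, L (hat u) = 0) : BFace P s := by
  refine ⟨hs, {y ∈ polyBody P.V | (-(L ∘ₗ LinearMap.inl ℝ Pt ℝ)) y = L (0,1)}, ⟨⟨-(L ∘ₗ LinearMap.inl ℝ Pt ℝ), L (0,1), poly_le _ _ ?_, rfl⟩, ?_⟩, ?_⟩
  · intro u hu
    have := h0 u hu
    rw [L_hat] at this
    simp; linarith
  · intro h
    obtain ⟨u, hu, hne⟩ := h1
    have : u ∈ polyBody P.V := subset_convexHull _ _ hu
    rw [← h] at this
    have h2 := this.2
    apply hne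
    rw [L_hat]
    simp at h2; linarith
  · intro u hu
    refine ⟨subset_convexHull _ _ (hs hu), ?_⟩
    have := hz u hu
    rw [L_hat] at this
    simp; linarith

lemma Exf.bface {P : SPolytope 4} {s : Finset Pt} (h : Exf P s) : BFace P s := by
  obtain ⟨hs, hne, L, h0, h1⟩ := h
  obtain ⟨u, hu, hus⟩ := Finset.exists_of_ssubset (lt_of_le_of_ne hs hne)
  refine bface_of_weak P L ?_ ⟨u, hu, (h1 u hu hus).ne'⟩ s hs h0
  intro w hw
  by_cases hws : w ∈ s
  · rw [h0 w hws]
  · exact (h1 w hw hws).le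

lemma BFace.li {P : SPolytope 4} {s : Finset Pt} (h : BFace P s) :
    LinearIndependent ℝ (fun x : s => hat x.1) := by
  obtain ⟨hs, F, hF, hsF⟩ := h
  have h1 := (P.simplicial F hF).1
  have h2 := hat_li_of_affine _ h1
  let e : s → {y : Pt // y ∈ (P.V : Set Pt) ∩ F} := fun x => ⟨x.1, hs x.2, hsF x.2⟩
  have he : Function.Injective e := by
    intro x y hxy
    have := congrArg Subtype.val hxy
    exact Subtype.ext this
  exact h2.comp e he

lemma BFace.mono {P : SPolytope 4} {s t : Finset Pt} (h : BFace P s) (hts : t ⊆ s) :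
    BFace P t := by
  obtain ⟨hs, F, hF, hsF⟩ := h
  exact ⟨hts.trans hs, F, hF, fun x hx => hsF (hts hx)⟩

lemma BFace.exf {P : SPolytope 4} {s : Finset Pt} (h : BFace P s) : Exf P s := by
  obtain ⟨hs, F, hF, hsF⟩ := h
  have hF' := hF
  obtain ⟨⟨f, c, hle, hFe⟩, hFne⟩ := hF
  have hlin : BFace P (P.V.filter (fun u => u ∈ F)) :=
    ⟨Finset.filter_subset _ _, F, hF', fun x hx => by simpa using (Finset.mem_filter.1 hx).2⟩
  obtain ⟨g, hg⟩ := exists_dual _ hlin.li (fun x => if x.1 ∈ s then 0 else 1)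
  let L0 : WW →ₗ[ℝ] ℝ := c • LinearMap.snd ℝ Pt ℝ - f ∘ₗ LinearMap.fst ℝ Pt ℝ
  have hL0 : ∀ u, L0 (hat u) = c - f u := by intro u; simp [L0, hat]
  have hmem : ∀ u ∈ P.V, u ∈ F ↔ f u = c := by
    intro u hu
    rw [hFe]
    constructor
    · exact fun h => h.2
    · exact fun h => ⟨subset_convexHull _ _ hu, h⟩
  obtain ⟨ε, hε, hpos⟩ := exists_eps (P.V.filter (fun u => u ∉ F)) (fun u => L0 (hat u))
    (fun u => g (hat u)) (by
      intro x hx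
      rw [Finset.mem_filter] at hx
      rw [hL0]
      have h1 := hle x (subset_convexHull _ _ hx.1)
      have h2 := (hmem x hx.1).not.1 hx.2
      have := lt_of_le_of_ne h1 h2
      linarith)
  refine ⟨hs, ?_, L0 + ε • g, ?_, ?_⟩
  · intro hsV
    apply hFne
    apply Set.Subset.antisymm
    · rw [hFe]; exact fun x hx => hx.1
    · rw [(P.simplicial F hF').2]
      apply convexHull_mono
      intro x hx
      refine ⟨hx, hsF ?_⟩
      rw [hsV]; exact hx
  · intro u hu
    have huF : u ∈ F := hsF hu
    have := hg ⟨u, by simp [hs hu, huF]⟩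
    simp [hu] at this
    simp [this, hL0, (hmem u (hs hu)).1 huF]
  · intro u hu hus
    by_cases huF : u ∈ F
    · have := hg ⟨u, by simp [hu, huF]⟩
      simp [hus] at this
      simp [this, hL0, (hmem u hu).1 huF, hε]
    · have := hpos u (by simp [hu, huF])
      simpa using this

lemma bface_iff (P : SPolytope 4) (s : Finset Pt) : BFace P s ↔ Exf P s :=
  ⟨BFace.exf, Exf.bface⟩

lemma L_zero (P : SPolytope 4) (L : WW →ₗ[ℝ] ℝ) (h : ∀ u ∈ P.V, L (hat u) = 0) : L = 0 := by
  let A : AffineSubspace ℝ Pt := AffineSubspace.mk' (0 : Pt) ⊥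
  have key : ∀ x : Pt, L (hat x) = 0 := by
    intro x
    have hx : x ∈ affineSpan ℝ (P.V : Set Pt) := by rw [P.span_top]; trivial
    refine affineSpan_induction (p := fun x => L (hat x) = 0) hx (fun u hu => h u hu) ?_
    intro c u v w hu hv hw
    rw [L_hat] at *
    have : ((c • (u -ᵥ v) +ᵥ w : Pt), (0:ℝ)) = c • ((u, 0) - (v, 0)) + (w, (0:ℝ)) := by
      ext <;> simp
    rw [this, map_add, map_smul, map_sub, smul_eq_mul]
    have : L (u, 0) = L (v, 0) := by linarith
    rw [this]; linarith
  ext x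
  · have h1 := key (Pi.single x 1)
    have h2 := key 0
    rw [L_hat] at h1 h2
    have : L ((0 : Pt), 0) = 0 := map_zero L
    simp; linarith
  · have h2 := key 0
    rw [L_hat] at h2
    have : L ((0 : Pt), 0) = 0 := map_zero L
    simp; linarith

lemma span_hat (P : SPolytope 4) : Submodule.span ℝ (hat '' (P.V : Set Pt)) = ⊤ := by
  by_contra hne
  obtain ⟨f, hf, hf2⟩ := Submodule.exists_le_ker_of_lt_top _ (lt_top_iff_ne_top.2 hne)
  apply hf
  apply L_zero P
  intro u hu
  exact hf2 (Submodule.subset_span ⟨u, hu, rfl⟩)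

lemma BFace.card_le {P : SPolytope 4} {s : Finset Pt} (h : BFace P s) : s.card ≤ 4 := by
  obtain ⟨hs, hne, L, h0, h1⟩ := h.exf
  by_contra hc
  push Not at hc
  have hli := h.li
  have hL : L = 0 := by
    have hspan : Submodule.span ℝ (Set.range fun x : s => hat x.1) = ⊤ := by
      apply LinearIndependent.span_eq_top_of_card_eq_finrank' hli
      have := hli.fintype_card_le_finrank
      have hf : Module.finrank ℝ WW = 5 := by simp
      rw [hf] at *
      simp at *; omega
    have : (⊤ : Submodule ℝ WW) ≤ LinearMap.ker L := by
      rw [← hspan, Submodule.span_le]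
      rintro _ ⟨x, rfl⟩
      exact h0 x.1 x.2
    exact LinearMap.ker_eq_top.1 (top_le_iff.1 this)
  obtain ⟨u, hu, hus⟩ := Finset.exists_of_ssubset (lt_of_le_of_ne hs hne)
  have := h1 u hu hus
  simp [hL] at this

lemma V_card (P : SPolytope 4) : 5 ≤ P.V.card := by
  have h := span_hat P
  have h2 := finrank_span_finset_le_card (R := ℝ) (P.V.image hat)
  rw [Finset.coe_image] at h2
  have h3 := Finset.card_image_le (s := P.V) (f := hat)
  have hf : Module.finrank ℝ (⊤ : Submodule ℝ WW) = 5 := by simp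
  rw [Set.finrank, h] at h2
  omega

lemma hull_weights {ι : Type} {k : ℕ} (T : Finset ι) (q : ι → Fin k → ℝ) (x : Fin k → ℝ)
    (hx : x ∈ convexHull ℝ (q '' (T : Set ι))) :
    ∃ w : ι → ℝ, (∀ t ∈ T, 0 ≤ w t) ∧ ∑ t ∈ T, w t = 1 ∧ ∑ t ∈ T, w t • q t = x := by
  have : convexHull ℝ (q '' (T : Set ι)) ⊆ {x | ∃ w : ι → ℝ, (∀ t ∈ T, 0 ≤ w t) ∧ ∑ t ∈ T, w t = 1 ∧ ∑ t ∈ T, w t • q t = x} := by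
    apply convexHull_min
    · rintro _ ⟨t, ht, rfl⟩
      have ht' : t ∈ T := ht
      refine ⟨fun i => if i = t then 1 else 0, ?_, ?_, ?_⟩
      · intro i _; dsimp only; split_ifs <;> norm_num
      · simp [ht']
      · simp [ht']
    · rintro x ⟨w, h1, h2, h3⟩ y ⟨w', h1', h2', h3'⟩ a b ha hb hab
      refine ⟨fun i => a * w i + b * w' i, ?_, ?_, ?_⟩
      · intro i hi
        have := h1 i hi
        have := h1' i hi
        positivity
      · rw [Finset.sum_add_distrib, ← Finset.mul_sum, ← Finset.mul_sum, h2, h2']; linarith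
      · simp only [add_smul, mul_smul]
        rw [Finset.sum_add_distrib, ← Finset.smul_sum, ← Finset.smul_sum, h3, h3']
  exact this hx

lemma minimal_hull {ι : Type} {k : ℕ} (T : Finset ι) (q : ι → Fin k → ℝ) :
    ∃ T' ⊆ T, (∀ u ∈ T, q u ∈ convexHull ℝ (q '' (T' : Set ι))) ∧
      ∀ s ∈ T', ∃ g : (Fin k → ℝ) →ₗ[ℝ] ℝ, ∀ u ∈ T, g (q s) ≤ g (q u) ∧
        (g (q u) = g (q s) → q u = q s) := by
  have hex : ∃ n, ∃ T' ⊆ T, T'.card = n ∧ (∀ u ∈ T, q u ∈ convexHull ℝ (q '' (T' : Set ι))) :=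
    ⟨_, T, le_rfl, rfl, fun u hu => subset_convexHull _ _ ⟨u, hu, rfl⟩⟩
  obtain ⟨T', hT', hcard, hall⟩ := Nat.find_spec hex
  have hmin := fun m => Nat.find_min (m := m) hex
  refine ⟨T', hT', hall, ?_⟩
  intro s hs
  have hns : q s ∉ convexHull ℝ (q '' ((T'.erase s : Finset ι) : Set ι)) := by
    intro hmem
    apply hmin (T'.erase s).card
    · rw [← hcard]; exact Finset.card_erase_lt_of_mem hs
    · refine ⟨_, (Finset.erase_subset _ _).trans hT', rfl, ?_⟩
      intro u hu
      refine convexHull_min ?_ (convex_convexHull ℝ _) (hall u hu)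
      rintro _ ⟨t, ht, rfl⟩
      by_cases hts : t = s
      · rw [hts]; exact hmem
      · exact subset_convexHull _ _ ⟨t, by simpa [hts] using ht, rfl⟩
  obtain ⟨g, r, hg1, hg2⟩ := geometric_hahn_banach_point_closed (convex_convexHull ℝ _)
    (Set.Finite.isClosed_convexHull _ ((Finset.finite_toSet (T'.erase s)).image q)) hns
  have hgt : ∀ t ∈ T', t ≠ s → g (q s) < g (q t) := by
    intro t ht hts
    have := hg2 (q t) (subset_convexHull _ _ ⟨t, by simp [hts, ht], rfl⟩)
    linarith
  refine ⟨g.toLinearMap, ?_⟩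
  intro u hu
  obtain ⟨w, h1, h2, h3⟩ := hull_weights T' q (q u) (hall u hu)
  have hgu : g (q u) - g (q s) = ∑ t ∈ T', w t * (g (q t) - g (q s)) := by
    simp only [mul_sub]
    rw [Finset.sum_sub_distrib, ← Finset.sum_mul, h2, ← h3]
    simp
  have hnn : ∀ t ∈ T', 0 ≤ w t * (g (q t) - g (q s)) := by
    intro t ht
    by_cases hts : t = s
    · simp [hts]
    · have := hgt t ht hts
      exact mul_nonneg (h1 t ht) (by linarith)
  constructor
  · have := Finset.sum_nonneg hnn
    simp only [ContinuousLinearMap.coe_coe]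
    linarith
  · intro heq
    simp only [ContinuousLinearMap.coe_coe] at heq
    have hz : ∑ t ∈ T', w t * (g (q t) - g (q s)) = 0 := by rw [← hgu]; linarith
    rw [Finset.sum_eq_zero_iff_of_nonneg hnn] at hz
    have hw : ∀ t ∈ T', t ≠ s → w t = 0 := by
      intro t ht hts
      have := hgt t ht hts
      rcases mul_eq_zero.1 (hz t ht) with h | h
      · exact h
      · linarith
    rw [Finset.sum_eq_single_of_mem s hs hw] at h2
    rw [Finset.sum_eq_single_of_mem s hs (fun t ht hts => by rw [hw t ht hts, zero_smul])] at h3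
    rw [← h3, h2, one_smul]

lemma exists_proj (K : Submodule ℝ WW) : ∃ (k : ℕ) (π : WW →ₗ[ℝ] (Fin k → ℝ)),
    LinearMap.ker π = K := by
  refine ⟨_, (Module.finBasis ℝ (WW ⧸ K)).equivFun.toLinearMap ∘ₗ K.mkQ, ?_⟩
  rw [LinearEquiv.ker_comp, Submodule.ker_mkQ]

lemma cone_lemma (P : SPolytope 4) (τ : Finset Pt) (hτ : BFace P τ) (hc : τ.card ≤ 3)
    (u : Pt) (hu : u ∈ P.V) :
    ∃ α μ : Pt → ℝ, (∀ s, 0 ≤ μ s) ∧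
      (∀ s, μ s ≠ 0 → s ∈ P.V ∧ s ∉ τ ∧ BFace P (insert s τ)) ∧
      hat u = ∑ t ∈ τ, α t • hat t + ∑ s ∈ P.V, μ s • hat s := by
  by_cases huτ : u ∈ τ
  · refine ⟨fun i => if i = u then 1 else 0, 0, by simp, by simp, by simp [huτ]⟩
  obtain ⟨hsub, hne, φ, hφ0, hφ1⟩ := hτ.exf
  obtain ⟨k, π, hπ⟩ := exists_proj (Submodule.span ℝ (hat '' (τ : Set Pt)))
  have hφK : ∀ x, π x = 0 → φ x = 0 := by
    intro x hx
    have hx' : x ∈ LinearMap.ker π := hx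
    rw [hπ] at hx'
    have : Submodule.span ℝ (hat '' (τ : Set Pt)) ≤ LinearMap.ker φ := by
      rw [Submodule.span_le]
      rintro _ ⟨t, ht, rfl⟩
      exact hφ0 t ht
    exact this hx'
  have hπτ : ∀ t ∈ τ, π (hat t) = 0 := by
    intro t ht
    have : hat t ∈ LinearMap.ker π := by rw [hπ]; exact Submodule.subset_span ⟨t, ht, rfl⟩
    exact this
  have hpos : ∀ v ∈ P.V \ τ, 0 < φ (hat v) := fun v hv => by
    rw [Finset.mem_sdiff] at hv; exact hφ1 v hv.1 hv.2
  obtain ⟨q, hqe⟩ : ∃ q : Pt → Fin k → ℝ, ∀ v ∈ P.V \ τ, π (hat v) = φ (hat v) • q v :=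
    ⟨fun v => (φ (hat v))⁻¹ • π (hat v), fun v hv => by
      dsimp only; rw [smul_inv_smul₀ (hpos v hv).ne']⟩
  obtain ⟨T, hT, hall, hexp⟩ := minimal_hull (P.V \ τ) q
  have hface : ∀ s ∈ T, BFace P (insert s τ) := by
    intro s hs
    have hsV := hT hs
    obtain ⟨g, hg⟩ := hexp s hs
    let ψ : WW →ₗ[ℝ] ℝ := g ∘ₗ π - (g (q s)) • φ
    have hψ : ∀ v ∈ P.V \ τ, ψ (hat v) = φ (hat v) * (g (q v) - g (q s)) := by
      intro v hv
      simp only [ψ, LinearMap.sub_apply, LinearMap.comp_apply, LinearMap.smul_apply]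
      rw [hqe v hv, map_smul]; simp only [smul_eq_mul]; ring
    have hψτ : ∀ t ∈ τ, ψ (hat t) = 0 := by
      intro t ht
      simp [ψ, hπτ t ht, hφ0 t ht]
    apply bface_of_weak P ψ
    · intro v hv
      by_cases hvτ : v ∈ τ
      · rw [hψτ v hvτ]
      · have hv' : v ∈ P.V \ τ := by simp [hv, hvτ]
        rw [hψ v hv']
        exact mul_nonneg (hpos v hv').le (by linarith [(hg v hv').1])
    · by_contra hcon
      push Not at hcon
      -- all parallel
      have hpar : ∀ v ∈ P.V, hat v ∈ Submodule.span ℝ (hat '' ((insert s τ : Finset Pt) : Set Pt)) := by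
        intro v hv
        by_cases hvτ : v ∈ τ
        · exact Submodule.subset_span ⟨v, by simp [hvτ], rfl⟩
        · have hv' : v ∈ P.V \ τ := by simp [hv, hvτ]
          have h1 := hcon v hv
          rw [hψ v hv'] at h1
          have h2 : g (q v) = g (q s) := by
            rcases mul_eq_zero.1 h1 with h | h
            · exact absurd h (hpos v hv').ne'
            · linarith
          have h3 := (hg v hv').2 h2
          have h4 : hat v - (φ (hat v) * (φ (hat s))⁻¹) • hat s ∈ LinearMap.ker π := by
            rw [LinearMap.mem_ker, map_sub, map_smul, hqe v hv', hqe s hsV, h3, smul_smul,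
              mul_assoc, inv_mul_cancel₀ (hpos s hsV).ne', mul_one, sub_self]
          rw [hπ] at h4
          have h5 := Submodule.span_mono (R := ℝ) (Set.image_mono (f := hat) (by
            intro x hx; simp at hx ⊢; exact Or.inr hx :
              (τ : Set Pt) ⊆ ((insert s τ : Finset Pt) : Set Pt))) h4
          have h6 : hat s ∈ Submodule.span ℝ (hat '' ((insert s τ : Finset Pt) : Set Pt)) :=
            Submodule.subset_span ⟨s, by simp, rfl⟩
          have := Submodule.add_mem _ h5 (Submodule.smul_mem _ (φ (hat v) * (φ (hat s))⁻¹) h6)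
          simpa using this
      have htop : Submodule.span ℝ (hat '' ((insert s τ : Finset Pt) : Set Pt)) = ⊤ := by
        rw [eq_top_iff, ← span_hat P, Submodule.span_le]
        rintro _ ⟨v, hv, rfl⟩
        exact hpar v hv
      have h2 := finrank_span_finset_le_card (R := ℝ) ((insert s τ).image hat)
      rw [Finset.coe_image, Set.finrank, htop] at h2
      have h3 := Finset.card_image_le (s := insert s τ) (f := hat)
      have hf : Module.finrank ℝ (⊤ : Submodule ℝ WW) = 5 := by simp
      have := Finset.card_insert_le s τ
      omega
    · intro v hv
      rcases Finset.mem_insert.1 hv with rfl | hv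
      · exact (Finset.mem_sdiff.1 hsV).1
      · exact hsub hv
    · intro v hv
      rcases Finset.mem_insert.1 hv with rfl | hv
      · rw [hψ v hsV]; ring
      · exact hψτ v hv
  have hu' : u ∈ P.V \ τ := by simp [hu, huτ]
  obtain ⟨w, h1, h2, h3⟩ := hull_weights T q (q u) (hall u hu')
  let μ : Pt → ℝ := fun s => if s ∈ T then φ (hat u) * w s * (φ (hat s))⁻¹ else 0
  have hμ : hat u - ∑ s ∈ P.V, μ s • hat s ∈ LinearMap.ker π := by
    rw [LinearMap.mem_ker, map_sub, map_sum, hqe u hu', ← h3, Finset.smul_sum]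
    rw [← Finset.sum_subset (hT.trans Finset.sdiff_subset)]
    · rw [sub_eq_zero]
      apply Finset.sum_congr rfl
      intro s hs
      rw [map_smul, hqe s (hT hs)]
      simp only [μ, hs, if_true]
      rw [smul_smul, smul_smul, mul_assoc, inv_mul_cancel₀ (hpos s (hT hs)).ne', mul_one]
    · intro s _ hs
      simp [μ, hs]
  rw [hπ, Submodule.mem_span_image_finset_iff_exists_fun'] at hμ
  obtain ⟨α, hα⟩ := hμ
  refine ⟨α, μ, ?_, ?_, ?_⟩
  · intro s
    simp only [μ]
    split_ifs with hs
    · have := h1 s hs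
      have := hpos u hu'
      have := hpos s (hT hs)
      positivity
    · exact le_rfl
  · intro s hs
    have hsT : s ∈ T := by
      by_contra h
      simp [μ, h] at hs
    have := Finset.mem_sdiff.1 (hT hsT)
    exact ⟨this.1, this.2, hface s hsT⟩
  · rw [hα]; abel

lemma hat_inj : Function.Injective hat := fun x y h => congrArg Prod.fst h

/-- adjacency in the link of `τ` -/
def LAdj (P : SPolytope 4) (τ : Finset Pt) (a b : Pt) : Prop :=
  a ∉ τ ∧ b ∉ τ ∧ a ≠ b ∧ BFace P (insert a (insert b τ))

lemma link_conn (P : SPolytope 4) (τ : Finset Pt) (hc : τ.card ≤ 2) (s s' : Pt)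
    (hs : BFace P (insert s τ)) (hs' : BFace P (insert s' τ)) (h1 : s ∉ τ) (h1' : s' ∉ τ) :
    Relation.ReflTransGen (LAdj P τ) s s' := by
  obtain ⟨hsub, hne, φ, hφ0, hφ1⟩ := (hs.mono (Finset.subset_insert s τ)).exf
  obtain ⟨hsub', hne', g, hg0, hg1⟩ := hs'.exf
  have hs'V : s' ∈ P.V := hsub' (by simp)
  obtain ⟨ρ, hρ⟩ : ∃ ρ : Pt → ℝ, ∀ a ∈ P.V, a ∉ τ → g (hat a) = ρ a * φ (hat a) := by
    refine ⟨fun a => g (hat a) / φ (hat a), fun a ha haτ => ?_⟩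
    have := hφ1 a ha haτ
    field_simp
  have main : ∀ n : ℕ, ∀ a, (P.V.filter (fun x => ρ x < ρ a)).card = n → a ∉ τ →
      BFace P (insert a τ) → Relation.ReflTransGen (LAdj P τ) a s' := by
    intro n
    induction n using Nat.strong_induction_on with
    | _ n ih =>
    intro a hn haτ ha
    by_cases has : a = s'
    · rw [has]
    have haV : a ∈ P.V := ha.1 (by simp)
    have hga : 0 < g (hat a) := hg1 a haV (by simp [has, haτ])
    have hφa := hφ1 a haV haτ
    have hρa : 0 < ρ a := by
      have := hρ a haV haτ
      by_contra hcon
      push Not at hcon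
      nlinarith
    obtain ⟨α, μ, hμ0, hμ1, hμ⟩ := cone_lemma P (insert a τ) ha
      (by have := Finset.card_insert_le a τ; omega) s' hs'V
    let G : WW →ₗ[ℝ] ℝ := g - ρ a • φ
    have hGτ : ∀ t ∈ insert a τ, G (hat t) = 0 := by
      intro t ht
      rcases Finset.mem_insert.1 ht with rfl | ht
      · simp [G, hρ t haV haτ]
      · simp [G, hφ0 t ht, hg0 t (by simp [ht])]
    have hGs : G (hat s') < 0 := by
      simp [G, hg0 s' (by simp)]
      exact mul_pos hρa (hφ1 s' hs'V h1')
    rw [hμ, map_add, map_sum, map_sum, Finset.sum_eq_zero (s := insert a τ), zero_add] at hGs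
    · obtain ⟨r, hr, hrneg⟩ := Finset.exists_lt_of_sum_lt (f := fun s => G (μ s • hat s))
        (g := fun _ => (0:ℝ)) (s := P.V) (by simpa using hGs)
      simp only [map_smul, smul_eq_mul] at hrneg
      have hμr : μ r ≠ 0 := by
        intro h; simp [h] at hrneg
      have hGr : G (hat r) < 0 := by
        by_contra hcon
        push Not at hcon
        exact absurd (mul_nonneg (hμ0 r) hcon) (by linarith)
      obtain ⟨_, hrτ, hrf⟩ := hμ1 r hμr
      simp only [Finset.mem_insert, not_or] at hrτ
      have hρr : ρ r < ρ a := by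
        have h3 := hρ r hr hrτ.2
        have h4 := hφ1 r hr hrτ.2
        simp [G] at hGr
        by_contra hcon
        push Not at hcon
        nlinarith
      refine Relation.ReflTransGen.head (b := r) ⟨haτ, hrτ.2, fun h => hrτ.1 h.symm, ?_⟩ ?_
      · rw [Finset.insert_comm]; exact hrf
      · refine ih _ ?_ r rfl hrτ.2 (hrf.mono ?_)
        · rw [← hn]
          apply Finset.card_lt_card
          rw [Finset.ssubset_iff_of_subset]
          · exact ⟨r, by simp [hr, hρr], by simp⟩
          · intro x hx
            simp at hx ⊢
            exact ⟨hx.1, hx.2.trans hρr⟩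
        · intro x hx
          simp at hx ⊢
          tauto
    · intro t ht
      rw [map_smul, hGτ t ht, smul_zero]
  exact main _ s rfl h1 hs

lemma wall_ge (P : SPolytope 4) (τ : Finset Pt) (hτ : BFace P τ) (hc : τ.card = 3) :
    ∃ j1 j2, j1 ≠ j2 ∧ j1 ∉ τ ∧ j2 ∉ τ ∧ BFace P (insert j1 τ) ∧ BFace P (insert j2 τ) := by
  let J := P.V.filter (fun j => j ∉ τ ∧ BFace P (insert j τ))
  have htop : Submodule.span ℝ (hat '' ((τ ∪ J : Finset Pt) : Set Pt)) = ⊤ := by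
    rw [eq_top_iff, ← span_hat P, Submodule.span_le]
    rintro _ ⟨v, hv, rfl⟩
    obtain ⟨α, μ, hμ0, hμ1, hμ⟩ := cone_lemma P τ hτ hc.le v hv
    rw [hμ]
    apply Submodule.add_mem
    · apply Submodule.sum_mem
      intro t ht
      exact Submodule.smul_mem _ _ (Submodule.subset_span ⟨t, by simp [ht], rfl⟩)
    · apply Submodule.sum_mem
      intro t ht
      by_cases h0 : μ t = 0
      · simp [h0]
      · have := hμ1 t h0
        exact Submodule.smul_mem _ _ (Submodule.subset_span ⟨t, by simp [J, this], rfl⟩)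
  have h2 := finrank_span_finset_le_card (R := ℝ) ((τ ∪ J).image hat)
  rw [Finset.coe_image, Set.finrank, htop] at h2
  have h3 := Finset.card_image_le (s := τ ∪ J) (f := hat)
  have hf : Module.finrank ℝ (⊤ : Submodule ℝ WW) = 5 := by simp
  have := Finset.card_union_le τ J
  have hJ : 1 < J.card := by omega
  obtain ⟨j1, j2, h1, h2, hne⟩ := Finset.one_lt_card_iff.1 hJ
  simp [J] at h1 h2
  exact ⟨j1, j2, hne, h1.2.1, h2.2.1, h1.2.2, h2.2.2⟩

lemma wall_le (P : SPolytope 4) (τ : Finset Pt) (hc : τ.card = 3) (j1 j2 j3 : Pt)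
    (h1 : j1 ∉ τ) (h2 : j2 ∉ τ) (h3 : j3 ∉ τ) (f1 : BFace P (insert j1 τ))
    (f2 : BFace P (insert j2 τ)) (f3 : BFace P (insert j3 τ))
    (h12 : j1 ≠ j2) (h13 : j1 ≠ j3) (h23 : j2 ≠ j3) : False := by
  obtain ⟨s1, _, ψ1, z1, p1⟩ := f1.exf
  obtain ⟨s2, _, ψ2, z2, p2⟩ := f2.exf
  obtain ⟨s3, _, ψ3, z3, p3⟩ := f3.exf
  have v1 : j1 ∈ P.V := s1 (by simp)
  have v2 : j2 ∈ P.V := s2 (by simp)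
  have v3 : j3 ∈ P.V := s3 (by simp)
  have hcard : ((insert j1 (insert j2 (insert j3 τ))).image hat).card = 6 := by
    rw [Finset.card_image_of_injective _ hat_inj]
    rw [Finset.card_insert_of_notMem (by simp [*]), Finset.card_insert_of_notMem (by simp [*]),
      Finset.card_insert_of_notMem h3, hc]
  obtain ⟨f, hf, hfx⟩ := Module.exists_nontrivial_relation_of_finrank_lt_card (R := ℝ) (M := WW)
    (t := (insert j1 (insert j2 (insert j3 τ))).image hat) (by rw [hcard]; simp)
  rw [Finset.sum_image (fun x _ y _ h => hat_inj h)] at hf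
  rw [Finset.sum_insert (by simp [*]), Finset.sum_insert (by simp [*]),
      Finset.sum_insert h3] at hf
  have app : ∀ ψ : WW →ₗ[ℝ] ℝ, (∀ t ∈ τ, ψ (hat t) = 0) →
      f (hat j1) * ψ (hat j1) + (f (hat j2) * ψ (hat j2) + f (hat j3) * ψ (hat j3)) = 0 := by
    intro ψ h
    have := congrArg ψ hf
    simp only [map_add, map_smul, map_sum, smul_eq_mul, map_zero] at this
    rw [Finset.sum_eq_zero (s := τ) (fun t ht => by rw [h t ht, mul_zero])] at this
    linarith
  have e1 := app ψ1 (fun t ht => z1 t (by simp [ht]))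
  have e2 := app ψ2 (fun t ht => z2 t (by simp [ht]))
  have e3 := app ψ3 (fun t ht => z3 t (by simp [ht]))
  rw [z1 j1 (by simp)] at e1
  rw [z2 j2 (by simp)] at e2
  rw [z3 j3 (by simp)] at e3
  have a12 := p1 j2 v2 (by simp [h12.symm, h2])
  have a13 := p1 j3 v3 (by simp [h13.symm, h3])
  have a21 := p2 j1 v1 (by simp [h12, h1])
  have a23 := p2 j3 v3 (by simp [h23.symm, h3])
  have a31 := p3 j1 v1 (by simp [h13, h1])
  have a32 := p3 j2 v2 (by simp [h23, h2])
  generalize hx1 : f (hat j1) = x at *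
  generalize hy1 : f (hat j2) = y at *
  generalize hz : f (hat j3) = z at *
  have key : ∀ a b c d : ℝ, 0 < a → 0 < b → c * a + d * b = 0 → (0 < c → d < 0) ∧ (c < 0 → 0 < d) ∧ (c = 0 → d = 0) := by
    intro a b c d ha hb h
    refine ⟨fun hc => ?_, fun hc => ?_, fun hc => ?_⟩
    · by_contra hh; push Not at hh; nlinarith [mul_pos hc ha, mul_nonneg hh hb.le]
    · by_contra hh; push Not at hh; nlinarith [mul_pos_of_neg_of_neg hc (neg_lt_zero.2 ha), mul_nonneg (neg_nonneg.2 hh) hb.le]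
    · rw [hc, zero_mul, zero_add] at h
      exact (mul_eq_zero.1 h).resolve_right hb.ne'
  have k1 := key _ _ _ _ a12 a13 (by linarith : y * ψ1 (hat j2) + z * ψ1 (hat j3) = 0)
  have k2 := key _ _ _ _ a21 a23 (by linarith : x * ψ2 (hat j1) + z * ψ2 (hat j3) = 0)
  have k3 := key _ _ _ _ a31 a32 (by linarith : x * ψ3 (hat j1) + y * ψ3 (hat j2) = 0)
  have hx : x = 0 := by
    rcases lt_trichotomy x 0 with h | h | h
    · have := k2.2.1 h; have := k3.2.1 h; have := k1.1 this; linarith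
    · exact h
    · have := k2.1 h; have := k3.1 h; have := k1.2.1 this; linarith
  have hy := k3.2.2 hx
  have hz0 := k2.2.2 hx
  rw [hx, hy, hz0] at hf
  simp only [zero_smul, zero_add] at hf
  have hli := (f1.mono (Finset.subset_insert j1 τ)).li
  rw [linearIndependent_iff'] at hli
  have hall : ∀ t ∈ τ, f (hat t) = 0 := by
    intro t ht
    refine hli Finset.univ (fun t => f (hat t.1)) ?_ ⟨t, ht⟩ (by simp)
    rw [← hf, ← Finset.sum_coe_sort τ]
  obtain ⟨w, hw, hwn⟩ := hfx
  apply hwn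
  rw [Finset.mem_image] at hw
  obtain ⟨t, ht, rfl⟩ := hw
  simp only [Finset.mem_insert] at ht
  rcases ht with rfl | rfl | rfl | ht
  · rw [hx1, hx]
  · rw [hy1, hy]
  · rw [hz, hz0]
  · exact hall t ht

/-- determinant of four vectors -/
def DD (x y z w : Pt) : ℝ :=
  (x 0 * y 1 - x 1 * y 0) * (z 2 * w 3 - z 3 * w 2) - (x 0 * y 2 - x 2 * y 0) * (z 1 * w 3 - z 3 * w 1)
  + (x 0 * y 3 - x 3 * y 0) * (z 1 * w 2 - z 2 * w 1) + (x 1 * y 2 - x 2 * y 1) * (z 0 * w 3 - z 3 * w 0)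
  - (x 1 * y 3 - x 3 * y 1) * (z 0 * w 2 - z 2 * w 0) + (x 2 * y 3 - x 3 * y 2) * (z 0 * w 1 - z 1 * w 0)

lemma DD_det (x y z w : Pt) : (Matrix.of ![x, y, z, w]).det = DD x y z w := by
  simp [Matrix.det_succ_row_zero, Fin.sum_univ_succ, Fin.succAbove, DD]
  ring

lemma DD_12 (x y z w : Pt) : DD y x z w = - DD x y z w := by unfold DD; ring
lemma DD_23 (x y z w : Pt) : DD x z y w = - DD x y z w := by unfold DD; ring
lemma DD_34 (x y z w : Pt) : DD x y w z = - DD x y z w := by unfold DD; ring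
lemma DD_self12 (x z w : Pt) : DD x x z w = 0 := by unfold DD; ring
lemma DD_self23 (x y w : Pt) : DD x y y w = 0 := by unfold DD; ring
lemma DD_self34 (x y z : Pt) : DD x y z z = 0 := by unfold DD; ring
lemma DD_self14 (x y z : Pt) : DD x y z x = 0 := by unfold DD; ring
lemma DD_self24 (x y z : Pt) : DD x y z y = 0 := by unfold DD; ring
lemma DD_self13 (x y z : Pt) : DD x y x z = 0 := by unfold DD; ring

/-- linear in the last slot -/
def DL4 (x y z : Pt) : Pt →ₗ[ℝ] ℝ where
  toFun w := DD x y z w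
  map_add' w w' := by simp only [DD, Pi.add_apply]; ring
  map_smul' c w := by simp only [DD, Pi.smul_apply, smul_eq_mul, RingHom.id_apply]; ring

def DL3 (x y w : Pt) : Pt →ₗ[ℝ] ℝ where
  toFun z := DD x y z w
  map_add' w w' := by simp only [DD, Pi.add_apply]; ring
  map_smul' c w := by simp only [DD, Pi.smul_apply, smul_eq_mul, RingHom.id_apply]; ring

def DL2 (x z w : Pt) : Pt →ₗ[ℝ] ℝ where
  toFun y := DD x y z w
  map_add' w w' := by simp only [DD, Pi.add_apply]; ring
  map_smul' c w := by simp only [DD, Pi.smul_apply, smul_eq_mul, RingHom.id_apply]; ring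

lemma cramer4 (x y p q z : Pt) : DD x y p q • z =
    DD z y p q • x + DD x z p q • y + DD x y z q • p + DD x y p z • q := by
  ext i
  fin_cases i <;> simp [DD] <;> ring

lemma cramer4' (x y p q z : Pt) (h : DD x y p q ≠ 0) : z =
    (DD z y p q / DD x y p q) • x + (DD x z p q / DD x y p q) • y +
    (DD x y z q / DD x y p q) • p + (DD x y p z / DD x y p q) • q := by
  have := congrArg (fun t => (DD x y p q)⁻¹ • t) (cramer4 x y p q z)
  simp only [smul_add, smul_smul, inv_mul_cancel₀ h, one_smul] at this
  rw [this]
  simp only [div_eq_inv_mul]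
  congr 1
  all_goals simp only [← this]

/-- skew maps -/
def sk (c : Fin 6 → ℝ) (x : Pt) : Pt :=
  ![c 0 * x 1 + c 1 * x 2 + c 2 * x 3, -(c 0 * x 0) + c 3 * x 2 + c 4 * x 3,
    -(c 1 * x 0) - c 3 * x 1 + c 5 * x 3, -(c 2 * x 0) - c 4 * x 1 - c 5 * x 2]

def skL : (Fin 6 → ℝ) →ₗ[ℝ] Pt →ₗ[ℝ] Pt :=
  LinearMap.mk₂ ℝ sk
    (by intro c d x; ext i; fin_cases i <;> simp [sk] <;> ring)
    (by intro a c x; ext i; fin_cases i <;> simp [sk] <;> ring)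
    (by intro c x y; ext i; fin_cases i <;> simp [sk] <;> ring)
    (by intro a c x; ext i; fin_cases i <;> simp [sk] <;> ring)

lemma skL_apply (c : Fin 6 → ℝ) (x : Pt) : skL c x = sk c x := rfl
lemma sk_add (c : Fin 6 → ℝ) (x y : Pt) : sk c (x + y) = sk c x + sk c y := (skL c).map_add x y
lemma sk_sub (c : Fin 6 → ℝ) (x y : Pt) : sk c (x - y) = sk c x - sk c y := (skL c).map_sub x y
lemma sk_neg (c : Fin 6 → ℝ) (x : Pt) : sk c (-x) = - sk c x := (skL c).map_neg x
lemma sk_smul (c : Fin 6 → ℝ) (a : ℝ) (x : Pt) : sk c (a • x) = a • sk c x := (skL c).map_smul a x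
lemma sk_zero (c : Fin 6 → ℝ) : sk c 0 = 0 := (skL c).map_zero
lemma sk_csub (c d : Fin 6 → ℝ) (x : Pt) : sk (c - d) x = sk c x - sk d x := by
  rw [← skL_apply, map_sub]; rfl
lemma sk_sum {ι : Type} (c : Fin 6 → ℝ) (s : Finset ι) (f : ι → Pt) :
    sk c (∑ i ∈ s, f i) = ∑ i ∈ s, sk c (f i) := map_sum (skL c) f s

lemma sk_skew (c : Fin 6 → ℝ) (x y : Pt) : sk c x ⬝ᵥ y = -(x ⬝ᵥ sk c y) := by
  simp [sk, dotProduct, Fin.sum_univ_succ]; ring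
lemma sk_skew' (c : Fin 6 → ℝ) (x y : Pt) : sk c x ⬝ᵥ y = -(sk c y ⬝ᵥ x) := by
  rw [sk_skew, dotProduct_comm]
lemma sk_self (c : Fin 6 → ℝ) (x : Pt) : sk c x ⬝ᵥ x = 0 := by
  have := sk_skew' c x x; linarith

lemma exists_sk_of_skew (A : Matrix (Fin 4) (Fin 4) ℝ) (hA : A.transpose = -A) :
    ∃ c, ∀ x, sk c x = A.mulVec x := by
  have h : ∀ i j, A i j = - A j i := fun i j => by
    have := congrFun (congrFun hA j) i
    simpa using this
  refine ⟨![A 0 1, A 0 2, A 0 3, A 1 2, A 1 3, A 2 3], fun x => ?_⟩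
  have h00 := h 0 0
  have h11 := h 1 1
  have h22 := h 2 2
  have h33 := h 3 3
  have e0 : A 0 0 = 0 := by linarith
  have e1 : A 1 1 = 0 := by linarith
  have e2 : A 2 2 = 0 := by linarith
  have e3 : A 3 3 = 0 := by linarith
  ext i
  fin_cases i <;> simp [sk, Matrix.mulVec, dotProduct, Fin.sum_univ_four, e0, e1, e2, e3, h 1 0, h 2 0, h 3 0, h 2 1, h 3 1, h 3 2] <;> ring

lemma exists_sk (x y z q n1 n2 n3 : Pt) (hD : DD x y z q ≠ 0)
    (h11 : n1 ⬝ᵥ x = 0) (h22 : n2 ⬝ᵥ y = 0) (h33 : n3 ⬝ᵥ z = 0)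
    (h12 : n1 ⬝ᵥ y + n2 ⬝ᵥ x = 0) (h13 : n1 ⬝ᵥ z + n3 ⬝ᵥ x = 0) (h23 : n2 ⬝ᵥ z + n3 ⬝ᵥ y = 0) :
    ∃ c, sk c x = n1 ∧ sk c y = n2 ∧ sk c z = n3 := by
  let M : Matrix (Fin 4) (Fin 4) ℝ := Matrix.of ![x, y, z, q]
  have hM : IsUnit M.det := by
    rw [DD_det]; exact hD.isUnit
  let β : Matrix (Fin 4) (Fin 4) ℝ := !![0, n1 ⬝ᵥ y, n1 ⬝ᵥ z, n1 ⬝ᵥ q;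
    -(n1 ⬝ᵥ y), 0, n2 ⬝ᵥ z, n2 ⬝ᵥ q; -(n1 ⬝ᵥ z), -(n2 ⬝ᵥ z), 0, n3 ⬝ᵥ q;
    -(n1 ⬝ᵥ q), -(n2 ⬝ᵥ q), -(n3 ⬝ᵥ q), 0]
  have hβ : β.transpose = -β := by
    ext i j; fin_cases i <;> fin_cases j <;> simp [β]
  let A := M⁻¹ * β.transpose * (M⁻¹).transpose
  have hA : A.transpose = -A := by
    change (M⁻¹ * β.transpose * (M⁻¹).transpose).transpose = -(M⁻¹ * β.transpose * (M⁻¹).transpose)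
    rw [Matrix.transpose_mul, Matrix.transpose_mul, Matrix.transpose_transpose,
      Matrix.transpose_transpose, hβ]
    simp [Matrix.mul_assoc]
  obtain ⟨c, hc⟩ := exists_sk_of_skew A hA
  have hMA : M * A * M.transpose = β.transpose := by
    have h1 : (M⁻¹).transpose * M.transpose = 1 := by
      rw [← Matrix.transpose_mul, Matrix.mul_nonsing_inv _ hM, Matrix.transpose_one]
    calc M * A * M.transpose = (M * M⁻¹) * β.transpose * ((M⁻¹).transpose * M.transpose) := by
          simp only [A, Matrix.mul_assoc]
      _ = _ := by rw [h1, Matrix.mul_nonsing_inv _ hM, Matrix.one_mul, Matrix.mul_one]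
  have hent : ∀ i j, M i ⬝ᵥ A.mulVec (M j) = β j i := by
    intro i j
    have := congrFun (congrFun hMA i) j
    rw [Matrix.transpose_apply] at this
    rw [← this, Matrix.mul_assoc, Matrix.mul_apply]
    rfl
  have huniq : ∀ p r : Pt, x ⬝ᵥ p = x ⬝ᵥ r → y ⬝ᵥ p = y ⬝ᵥ r → z ⬝ᵥ p = z ⬝ᵥ r →
      q ⬝ᵥ p = q ⬝ᵥ r → p = r := by
    intro p r h0 h1 h2 h3
    have : M.mulVec p = M.mulVec r := by
      ext i
      fin_cases i
      · exact h0
      · exact h1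
      · exact h2
      · exact h3
    exact Matrix.mulVec_injective_of_isUnit ((Matrix.isUnit_iff_isUnit_det _).2 hM) this
  refine ⟨c, ?_, ?_, ?_⟩
  · rw [hc]
    apply huniq
    · have e : x ⬝ᵥ A.mulVec x = 0 := hent 0 0
      rw [e, dotProduct_comm x n1]; linarith
    · have e : y ⬝ᵥ A.mulVec x = n1 ⬝ᵥ y := hent 1 0
      rw [e, dotProduct_comm y n1]
    · have e : z ⬝ᵥ A.mulVec x = n1 ⬝ᵥ z := hent 2 0
      rw [e, dotProduct_comm z n1]
    · have e : q ⬝ᵥ A.mulVec x = n1 ⬝ᵥ q := hent 3 0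
      rw [e, dotProduct_comm q n1]
  · rw [hc]
    apply huniq
    · have e : x ⬝ᵥ A.mulVec y = -(n1 ⬝ᵥ y) := hent 0 1
      rw [e, dotProduct_comm x n2]; linarith
    · have e : y ⬝ᵥ A.mulVec y = 0 := hent 1 1
      rw [e, dotProduct_comm y n2]; linarith
    · have e : z ⬝ᵥ A.mulVec y = n2 ⬝ᵥ z := hent 2 1
      rw [e, dotProduct_comm z n2]
    · have e : q ⬝ᵥ A.mulVec y = n2 ⬝ᵥ q := hent 3 1
      rw [e, dotProduct_comm q n2]
  · rw [hc]
    apply huniq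
    · have e : x ⬝ᵥ A.mulVec z = -(n1 ⬝ᵥ z) := hent 0 2
      rw [e, dotProduct_comm x n3]; linarith
    · have e : y ⬝ᵥ A.mulVec z = -(n2 ⬝ᵥ z) := hent 1 2
      rw [e, dotProduct_comm y n3]; linarith
    · have e : z ⬝ᵥ A.mulVec z = 0 := hent 2 2
      rw [e, dotProduct_comm z n3]; linarith
    · have e : q ⬝ᵥ A.mulVec z = n3 ⬝ᵥ q := hent 3 2
      rw [e, dotProduct_comm q n3]

/-- skew map killing two vectors -/
lemma sk_kill2 (x y p q : Pt) (hD : DD x y p q ≠ 0) (c : Fin 6 → ℝ) (hx : sk c x = 0)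
    (hy : sk c y = 0) : ∀ z w, sk c z ⬝ᵥ w = (sk c p ⬝ᵥ q / DD x y p q) * DD x y z w := by
  intro z w
  have e1 : ∀ z w, sk c z ⬝ᵥ w = - (sk c w ⬝ᵥ z) := sk_skew' c
  have hpp : sk c p ⬝ᵥ p = 0 := sk_self c p
  have hqq : sk c q ⬝ᵥ q = 0 := sk_self c q
  have hqp : sk c q ⬝ᵥ p = -(sk c p ⬝ᵥ q) := sk_skew' c q p
  have hzx : ∀ z, sk c z ⬝ᵥ x = 0 := fun z => by rw [e1, hx]; simp
  have hzy : ∀ z, sk c z ⬝ᵥ y = 0 := fun z => by rw [e1, hy]; simp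
  have hz := cramer4' x y p q z hD
  have hw := cramer4' x y p q w hD
  generalize DD z y p q / DD x y p q = z1 at hz
  generalize DD x z p q / DD x y p q = z2 at hz
  generalize DD x y z q / DD x y p q = z3 at hz
  generalize DD x y p z / DD x y p q = z4 at hz
  generalize DD w y p q / DD x y p q = w1 at hw
  generalize DD x w p q / DD x y p q = w2 at hw
  generalize DD x y w q / DD x y p q = w3 at hw
  generalize DD x y p w / DD x y p q = w4 at hw
  have hL : sk c z ⬝ᵥ w = (z3 * w4 - z4 * w3) * (sk c p ⬝ᵥ q) := by
    rw [hz, hw]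
    simp only [sk_add, sk_smul, hx, hy, add_dotProduct, dotProduct_add, smul_dotProduct,
      dotProduct_smul, smul_eq_mul, hzx, hzy, hpp, hqq, hqp, zero_dotProduct]
    simp
    ring
  have hR : DD x y z w = (z3 * w4 - z4 * w3) * DD x y p q := by
    rw [hz, hw]
    simp only [DD, Pi.add_apply, Pi.smul_apply, smul_eq_mul]
    ring
  rw [hL, hR]
  field_simp

structure VStar (N : Finset Pt) (a : Pt → Pt) (Fac : Pt → Pt → Pt → Prop) (a0 : Pt) : Prop where
  mem : ∀ {i k j}, Fac i k j → i ∈ N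
  s12 : ∀ {i k j}, Fac i k j → Fac k i j
  s23 : ∀ {i k j}, Fac i k j → Fac i j k
  ne : ∀ {i k j}, Fac i k j → i ≠ k
  sgn0 : ∀ {i k j}, Fac i k j → DD (a i) (a k) (a j) a0 ≠ 0
  sgn : ∀ {i k j}, Fac i k j → ∀ u ∈ N, u ≠ i → u ≠ k → u ≠ j →
    0 < DD (a i) (a k) (a j) a0 * DD (a i) (a k) (a j) (a u)
  wall : ∀ {i k j}, Fac i k j → ∃ j', j' ≠ j ∧ Fac i k j' ∧ ∀ j'', Fac i k j'' → j'' = j ∨ j'' = j'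
  expo : ∀ {i k j}, Fac i k j → ∃ l : Pt →ₗ[ℝ] ℝ, l (a i) = 0 ∧ l (a k) = 0 ∧
    ∀ u ∈ N, u ≠ i → u ≠ k → 0 < l (a u)
  pos : ∃ h : Pt →ₗ[ℝ] ℝ, ∀ u ∈ N, 0 < h (a u)
  cone : ∀ {i k j}, Fac i k j → ∀ u ∈ N, ∃ (α : ℝ) (μ : Pt → ℝ), (∀ s, 0 ≤ μ s) ∧
    (∀ s, μ s ≠ 0 → ∃ j, Fac i s j) ∧ a u = α • a i + ∑ s ∈ N, μ s • a s
  conn1 : ∀ {i k j k' j'}, Fac i k j → Fac i k' j' → Relation.ReflTransGen (fun x y => Fac i x y) k k'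
  conn2 : ∀ {i k j i' k' j'}, Fac i k j → Fac i' k' j' →
    Relation.ReflTransGen (fun x y => ∃ z, Fac x y z) i i'

namespace VStar
variable {N : Finset Pt} {a : Pt → Pt} {Fac : Pt → Pt → Pt → Prop} {a0 : Pt}

def sg (a : Pt → Pt) (a0 : Pt) (i k j : Pt) : ℝ := Real.sign (DD (a i) (a k) (a j) a0)

lemma sg12 (i k j : Pt) : sg a a0 k i j = - sg a a0 i k j := by
  unfold sg; rw [DD_12, Real.sign_neg]
lemma sg23 (i k j : Pt) : sg a a0 i j k = - sg a a0 i k j := by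
  unfold sg; rw [DD_23, Real.sign_neg]

lemma ne13 (S : VStar N a Fac a0) {i k j} (h : Fac i k j) : i ≠ j := S.ne (S.s23 h)
lemma ne23 (S : VStar N a Fac a0) {i k j} (h : Fac i k j) : k ≠ j := S.ne (S.s23 (S.s12 h))
lemma mem2 (S : VStar N a Fac a0) {i k j} (h : Fac i k j) : k ∈ N := S.mem (S.s12 h)
lemma mem3 (S : VStar N a Fac a0) {i k j} (h : Fac i k j) : j ∈ N := S.mem (S.s12 (S.s23 h))

lemma sign_eq (x y : ℝ) (h : 0 < x * y) : Real.sign x = Real.sign y := by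
  rcases lt_trichotomy x 0 with hx | hx | hx
  · have : y < 0 := by by_contra hc; push Not at hc; nlinarith
    rw [Real.sign_of_neg hx, Real.sign_of_neg this]
  · simp [hx] at h
  · have : 0 < y := by by_contra hc; push Not at hc; nlinarith
    rw [Real.sign_of_pos hx, Real.sign_of_pos this]

lemma sign_mul_self' (x : ℝ) : Real.sign x * x = |x| := by
  rcases lt_trichotomy x 0 with hx | hx | hx
  · rw [Real.sign_of_neg hx, abs_of_neg hx]; ring
  · simp [hx]
  · rw [Real.sign_of_pos hx, abs_of_pos hx]; ring

lemma sg_eq (S : VStar N a Fac a0) {i k j u} (h : Fac i k j) (hu : u ∈ N) (h1 : u ≠ i) (h2 : u ≠ k)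
    (h3 : u ≠ j) : sg a a0 i k j = Real.sign (DD (a i) (a k) (a j) (a u)) :=
  sign_eq _ _ (S.sgn h u hu h1 h2 h3)

lemma DD_ne (S : VStar N a Fac a0) {i k j u} (h : Fac i k j) (hu : u ∈ N) (h1 : u ≠ i) (h2 : u ≠ k)
    (h3 : u ≠ j) : DD (a i) (a k) (a j) (a u) ≠ 0 := by
  have := S.sgn h u hu h1 h2 h3
  intro h0; simp [h0] at this

lemma sg_mul (S : VStar N a Fac a0) {i k j u} (h : Fac i k j) (hu : u ∈ N) :
    sg a a0 i k j * DD (a i) (a k) (a j) (a u) = |DD (a i) (a k) (a j) (a u)| := by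
  by_cases h1 : u = i
  · rw [h1, DD_self14]; simp
  by_cases h2 : u = k
  · rw [h2, DD_self24]; simp
  by_cases h3 : u = j
  · rw [h3, DD_self34]; simp
  rw [S.sg_eq h hu h1 h2 h3, sign_mul_self']

def J (N : Finset Pt) (Fac : Pt → Pt → Pt → Prop) (i k : Pt) : Finset Pt := N.filter (fun j => Fac i k j)

lemma mem_J (S : VStar N a Fac a0) {i k j} : j ∈ J N Fac i k ↔ Fac i k j := by
  simp only [J, Finset.mem_filter]
  exact ⟨fun h => h.2, fun h => ⟨S.mem3 h, h⟩⟩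

lemma J_pair (S : VStar N a Fac a0) {i k j} (h : Fac i k j) : ∃ j', j ≠ j' ∧ Fac i k j' ∧
    J N Fac i k = {j, j'} := by
  obtain ⟨j', h1, h2, h3⟩ := S.wall h
  refine ⟨j', h1.symm, h2, ?_⟩
  ext x
  rw [S.mem_J, Finset.mem_insert, Finset.mem_singleton]
  constructor
  · exact h3 x
  · rintro (rfl | rfl)
    · exact h
    · exact h2

lemma sg_opp (S : VStar N a Fac a0) {i k j j'} (h : Fac i k j) (h' : Fac i k j') (hne : j ≠ j') :
    sg a a0 i k j' = - sg a a0 i k j := by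
  rw [S.sg_eq h (S.mem3 h') (S.ne13 h').symm (S.ne23 h').symm hne.symm,
    S.sg_eq h' (S.mem3 h) (S.ne13 h).symm (S.ne23 h).symm hne, DD_34, Real.sign_neg]

lemma sg_sum (S : VStar N a Fac a0) (i k : Pt) : ∑ j ∈ J N Fac i k, sg a a0 i k j = 0 := by
  by_cases hex : ∃ j, Fac i k j
  · obtain ⟨j, h⟩ := hex
    obtain ⟨j', hne, h', hJ⟩ := S.J_pair h
    rw [hJ, Finset.sum_pair hne, S.sg_opp h h' hne]; ring
  · rw [Finset.sum_eq_zero]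
    intro j hj
    exact absurd ⟨j, S.mem_J.1 hj⟩ hex

/-- data of rotations -/
structure Rot (a : Pt → Pt) (Fac : Pt → Pt → Pt → Prop) (n : Pt → Pt)
    (Om : Pt → Pt → Pt → (Fin 6 → ℝ)) : Prop where
  e : ∀ {i k j}, Fac i k j → sk (Om i k j) (a i) = n i
  s12 : ∀ i k j, Om k i j = Om i k j
  s23 : ∀ i k j, Om i j k = Om i k j

def IsT (N : Finset Pt) (a : Pt → Pt) (Fac : Pt → Pt → Pt → Prop) (a0 : Pt)
    (Om : Pt → Pt → Pt → (Fin 6 → ℝ)) (T : Pt → Pt → ℝ) : Prop :=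
  (∀ i k z w, ∑ j ∈ J N Fac i k, sg a a0 i k j * (sk (Om i k j) z ⬝ᵥ w) = T i k * DD (a i) (a k) z w) ∧
  ∀ i k, (¬ ∃ j, Fac i k j) → T i k = 0

lemma Rot.e2 (S : VStar N a Fac a0) {n Om} (R : Rot a Fac n Om) {i k j} (h : Fac i k j) :
    sk (Om i k j) (a k) = n k := by
  rw [← R.s12]; exact R.e (S.s12 h)
lemma Rot.e3 (S : VStar N a Fac a0) {n Om} (R : Rot a Fac n Om) {i k j} (h : Fac i k j) :
    sk (Om i k j) (a j) = n j := by
  rw [← R.s23]; exact R.e2 S (S.s23 h)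

lemma Rot.edge (S : VStar N a Fac a0) {n Om} (R : Rot a Fac n Om) {i k j} (h : Fac i k j) :
    n i ⬝ᵥ a k = - (n k ⬝ᵥ a i) := by
  rw [← R.e h, ← R.e2 S h, sk_skew']

lemma exists_T (S : VStar N a Fac a0) {n Om} (R : Rot a Fac n Om) : ∃ T, IsT N a Fac a0 Om T := by
  have : ∀ i k, ∃ t : ℝ, (∀ z w, ∑ j ∈ J N Fac i k, sg a a0 i k j * (sk (Om i k j) z ⬝ᵥ w) = t * DD (a i) (a k) z w)
      ∧ ((¬ ∃ j, Fac i k j) → t = 0) := by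
    intro i k
    by_cases hex : ∃ j, Fac i k j
    · obtain ⟨j, h⟩ := hex
      obtain ⟨j', hne, h', hJ⟩ := S.J_pair h
      have hD := S.DD_ne h (S.mem3 h') (S.ne13 h').symm (S.ne23 h').symm hne.symm
      have hk := sk_kill2 _ _ _ _ hD (Om i k j - Om i k j')
        (by rw [sk_csub, R.e h, R.e h', sub_self]) (by rw [sk_csub, R.e2 S h, R.e2 S h', sub_self])
      obtain ⟨κ, hκ⟩ : ∃ κ : ℝ, ∀ z w, sk (Om i k j - Om i k j') z ⬝ᵥ w = κ * DD (a i) (a k) z w := ⟨_, hk⟩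
      refine ⟨sg a a0 i k j * κ, fun z w => ?_, fun hn => absurd ⟨j, h⟩ hn⟩
      · rw [mul_assoc, ← hκ z w, hJ, Finset.sum_pair hne, S.sg_opp h h' hne, sk_csub, sub_dotProduct]
        ring
    · refine ⟨0, fun z w => ?_, fun _ => rfl⟩
      rw [Finset.sum_eq_zero]
      · ring
      · intro j hj
        exact absurd ⟨j, S.mem_J.1 hj⟩ hex
  choose T hT using this
  exact ⟨T, fun i k => (hT i k).1, fun i k => (hT i k).2⟩

lemma T_symm (S : VStar N a Fac a0) {n Om T} (R : Rot a Fac n Om) (hT : IsT N a Fac a0 Om T) (i k : Pt) :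
    T k i = T i k := by
  by_cases hex : ∃ j, Fac i k j
  · obtain ⟨j, h⟩ := hex
    have h1 := hT.1 i k (a j) a0
    have h2 := hT.1 k i (a j) a0
    have hJ : J N Fac k i = J N Fac i k := by
      ext x; rw [S.mem_J, S.mem_J]; exact ⟨S.s12, S.s12⟩
    have : ∑ j' ∈ J N Fac k i, sg a a0 k i j' * (sk (Om k i j') (a j) ⬝ᵥ a0) =
        - ∑ j' ∈ J N Fac i k, sg a a0 i k j' * (sk (Om i k j') (a j) ⬝ᵥ a0) := by
      rw [hJ, ← Finset.sum_neg_distrib]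
      apply Finset.sum_congr rfl
      intro x _
      rw [sg12, R.s12]; ring
    rw [this, h1, DD_12 (a i) (a k)] at h2
    have h0 := S.sgn0 h
    have : (T k i - T i k) * DD (a i) (a k) (a j) a0 = 0 := by linarith
    rcases mul_eq_zero.1 this with h | h
    · linarith
    · exact absurd h h0
  · rw [hT.2 i k hex, hT.2 k i (fun ⟨j, h⟩ => hex ⟨j, S.s12 h⟩)]

lemma antisymm_sum (S : VStar N a Fac a0) (i : Pt) (f : Pt → Pt → ℝ)
    (hf : ∀ k j, Fac i k j → f k j = - f j k) :
    ∑ k ∈ N, ∑ j ∈ J N Fac i k, f k j = 0 := by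
  have h1 : ∑ k ∈ N, ∑ j ∈ J N Fac i k, f k j = ∑ k ∈ N, ∑ j ∈ J N Fac i k, f j k := by
    refine Finset.sum_comm' ?_
    intro x y
    rw [S.mem_J, S.mem_J]
    constructor
    · rintro ⟨_, h⟩; exact ⟨S.s23 h, S.mem3 h⟩
    · rintro ⟨h, _⟩; exact ⟨S.mem3 h, S.s23 h⟩
  have h2 : ∑ k ∈ N, ∑ j ∈ J N Fac i k, f k j = - ∑ k ∈ N, ∑ j ∈ J N Fac i k, f j k := by
    rw [← Finset.sum_neg_distrib]
    apply Finset.sum_congr rfl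
    intro k _
    rw [← Finset.sum_neg_distrib]
    apply Finset.sum_congr rfl
    intro j hj
    exact hf k j (S.mem_J.1 hj)
  linarith

lemma T_equil (S : VStar N a Fac a0) {n Om T} (R : Rot a Fac n Om) (hT : IsT N a Fac a0 Om T) (i : Pt) :
    ∃ c : ℝ, ∑ k ∈ N, T i k • a k = c • a i := by
  by_cases hex : ∃ k j, Fac i k j
  · obtain ⟨k0, j0, h0⟩ := hex
    set y := ∑ k ∈ N, T i k • a k with hy
    have hz : ∀ z w, DD (a i) y z w = 0 := by
      intro z w
      have e : DD (a i) y z w = ∑ k ∈ N, T i k * DD (a i) (a k) z w := by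
        change DL2 (a i) z w y = _
        rw [hy, map_sum]
        apply Finset.sum_congr rfl
        intro k _
        rw [map_smul]; rfl
      rw [e]
      have : ∀ k ∈ N, T i k * DD (a i) (a k) z w = ∑ j ∈ J N Fac i k, sg a a0 i k j * (sk (Om i k j) z ⬝ᵥ w) :=
        fun k _ => (hT.1 i k z w).symm
      rw [Finset.sum_congr rfl this]
      apply S.antisymm_sum i (fun k j => sg a a0 i k j * (sk (Om i k j) z ⬝ᵥ w))
      intro k j _
      rw [sg23, R.s23]; ring
    have hD := S.sgn0 h0
    have hc := cramer4' (a i) (a k0) (a j0) a0 y hD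
    have e2 : DD (a i) y (a j0) a0 = 0 := hz _ _
    have e3 : DD (a i) (a k0) y a0 = 0 := by rw [DD_23, hz, neg_zero]
    have e4 : DD (a i) (a k0) (a j0) y = 0 := by rw [DD_34, DD_23, hz]; simp
    rw [e2, e3, e4] at hc
    exact ⟨DD y (a k0) (a j0) a0 / DD (a i) (a k0) (a j0) a0, hc.trans (by simp)⟩
  · refine ⟨0, ?_⟩
    rw [zero_smul]
    apply Finset.sum_eq_zero
    intro k _
    rw [hT.2 i k (fun ⟨j, h⟩ => hex ⟨k, j, h⟩), zero_smul]

end VStar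

namespace VStar
variable {N : Finset Pt} {a : Pt → Pt} {Fac : Pt → Pt → Pt → Prop} {a0 : Pt}

lemma symm_sum (S : VStar N a Fac a0) (i : Pt) (w : Pt → Pt → ℝ) (φ : Pt → ℝ)
    (hw : ∀ k j, Fac i k j → w k j = w j k) :
    ∑ k ∈ N, ∑ j ∈ J N Fac i k, w k j * (φ j - φ k) * φ k =
      - (1/2) * ∑ k ∈ N, ∑ j ∈ J N Fac i k, w k j * (φ j - φ k) ^ 2 := by
  have h := S.antisymm_sum i (fun k j => w k j * (φ j - φ k) * (φ k + φ j)) (by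
    intro k j h
    rw [hw k j h]; ring)
  have e : ∑ k ∈ N, ∑ j ∈ J N Fac i k, w k j * (φ j - φ k) * φ k =
      (1/2) * ∑ k ∈ N, ∑ j ∈ J N Fac i k, w k j * (φ j - φ k) * (φ k + φ j)
      - (1/2) * ∑ k ∈ N, ∑ j ∈ J N Fac i k, w k j * (φ j - φ k) ^ 2 := by
    rw [Finset.mul_sum, Finset.mul_sum, ← Finset.sum_sub_distrib]
    apply Finset.sum_congr rfl
    intro k _
    rw [Finset.mul_sum, Finset.mul_sum, ← Finset.sum_sub_distrib]
    apply Finset.sum_congr rfl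
    intro j _
    ring
  rw [e, h]; ring

lemma local_norm (S : VStar N a Fac a0) {n Om T} (R : Rot a Fac n Om) (hT : IsT N a Fac a0 Om T)
    {i k0 j1 : Pt} (h0 : Fac i k0 j1) (hB : ∀ x, sk (Om i k0 j1) x = 0) :
    ∑ k ∈ N, T i k * (n k ⬝ᵥ a k0) ≤ 0 ∧
    (∑ k ∈ N, T i k * (n k ⬝ᵥ a k0) = 0 → ∀ k ∈ N, k ≠ k0 → T i k = 0) := by
  have hni : n i = 0 := by rw [← R.e h0, hB]
  have hnk0 : n k0 = 0 := by rw [← R.e2 S h0, hB]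
  have hk0 : k0 ∈ N := S.mem2 h0
  obtain ⟨l, hli, hlk0, hlpos⟩ := S.expo h0
  obtain ⟨F, hF⟩ : ∃ F : Pt → ℝ, ∀ k, F k = n k ⬝ᵥ a k0 := ⟨_, fun _ => rfl⟩
  have hFi : F i = 0 := by rw [hF, hni, zero_dotProduct]
  have hFk0 : F k0 = 0 := by rw [hF, hnk0, zero_dotProduct]
  have hFadj : ∀ j, Fac i k0 j → F j = 0 := by
    intro j hj
    have := R.edge S (S.s12 (S.s23 (S.s12 (S.s23 hj))) )
    have h2 := R.edge S (S.s23 (S.s12 hj))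
    rw [hnk0, zero_dotProduct] at h2
    rw [hF]; linarith
  obtain ⟨φ, hφ⟩ : ∃ φ : Pt → ℝ, ∀ k ∈ N, F k = φ k * l (a k) := by
    refine ⟨fun k => F k / l (a k), fun k hk => ?_⟩
    by_cases h1 : k = i
    · simp [h1, hFi]
    by_cases h2 : k = k0
    · simp [h2, hFk0]
    have := hlpos k hk h1 h2
    field_simp
  have hl0 : ∀ k ∈ N, 0 ≤ l (a k) := by
    intro k hk
    by_cases h1 : k = i
    · rw [h1, hli]
    by_cases h2 : k = k0
    · rw [h2, hlk0]
    exact (hlpos k hk h1 h2).le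
  -- per facet formula
  have hlam : ∀ k j, Fac i k j → k ≠ k0 → ∀ z, sg a a0 i k j * (sk (Om i k j) z ⬝ᵥ a k0) =
      sg a a0 i k j * (φ k * l z) +
      (F j - φ k * l (a j)) / |DD (a i) (a k) (a j) (a k0)| * DD (a i) (a k) z (a k0) := by
    intro k j hf hk z
    have hlk := hlpos k (S.mem2 hf) (S.ne hf).symm hk
    by_cases hj : j = k0
    · subst hj
      have hFk := hFadj k (S.s23 hf)
      have : φ k = 0 := by
        rw [hφ k (S.mem2 hf)] at hFk
        exact (mul_eq_zero.1 hFk).resolve_right hlk.ne'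
      rw [this, sk_skew', R.e3 S hf, hnk0, hFk0]; simp
    · have hD := S.DD_ne hf hk0 (S.ne h0).symm (fun h => hk h.symm) (fun h => hj h.symm)
      have hz := cramer4' _ _ _ _ z hD
      have hsg := S.sg_mul hf hk0
      set Dv := DD (a i) (a k) (a j) (a k0) with hDv
      set z1 := DD z (a k) (a j) (a k0) / Dv
      set z2 := DD (a i) z (a j) (a k0) / Dv
      set z4 := DD (a i) (a k) (a j) z / Dv
      have hz3 : DD (a i) (a k) z (a k0) = (DD (a i) (a k) z (a k0) / Dv) * Dv := by field_simp
      set z3 := DD (a i) (a k) z (a k0) / Dv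
      rw [hz3]
      have e1 : sk (Om i k j) z ⬝ᵥ a k0 = z2 * F k + z3 * F j := by
        rw [hz]
        simp only [sk_add, sk_smul, add_dotProduct, smul_dotProduct, R.e hf, R.e2 S hf, R.e3 S hf,
          sk_self, hni, zero_dotProduct, smul_eq_mul, hF]
        ring
      have e2 : l z = z2 * l (a k) + z3 * l (a j) := by
        conv_lhs => rw [hz]
        simp only [map_add, map_smul, hli, hlk0, smul_eq_mul]
        ring
      rw [e1, e2, hφ k (S.mem2 hf), ← hsg]
      have hs0 : sg a a0 i k j ≠ 0 := by
        intro h; rw [h, zero_mul] at hsg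
        exact hD (abs_eq_zero.1 hsg.symm)
      have hs1 : sg a a0 i k j * sg a a0 i k j = 1 := by
        unfold sg
        rcases Real.sign_apply_eq_of_ne_zero _ (S.sgn0 hf) with h | h <;> rw [h] <;> norm_num
      field_simp
      linear_combination (z3 * F j - φ k * z3 * l (a j)) * hs1
  have htf : ∀ k, k ≠ k0 → T i k =
      ∑ j ∈ J N Fac i k, (F j - φ k * l (a j)) / |DD (a i) (a k) (a j) (a k0)| := by
    intro k hk
    by_cases hex : ∃ j, Fac i k j
    · obtain ⟨j, h⟩ := hex
      obtain ⟨j', hne, h', hJ⟩ := S.J_pair h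
      obtain ⟨jj, hjj, hjk0⟩ : ∃ jj, Fac i k jj ∧ jj ≠ k0 := by
        by_cases hj : j = k0
        · exact ⟨j', h', fun hh => hne (hj.trans hh.symm)⟩
        · exact ⟨j, h, hj⟩
      have hD := S.DD_ne hjj hk0 (S.ne h0).symm (fun h => hk h.symm) (fun h => hjk0 h.symm)
      have e := hT.1 i k (a jj) (a k0)
      rw [Finset.sum_congr rfl (fun j hj => hlam k j (S.mem_J.1 hj) hk (a jj)),
        Finset.sum_add_distrib, ← Finset.sum_mul, S.sg_sum, zero_mul, zero_add, ← Finset.sum_mul] at e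
      exact (mul_right_cancel₀ hD e).symm
    · rw [hT.2 i k hex, Finset.sum_eq_zero]
      intro j hj
      exact absurd ⟨j, S.mem_J.1 hj⟩ hex
  let w : Pt → Pt → ℝ := fun k j => l (a k) * l (a j) / |DD (a i) (a k) (a j) (a k0)|
  have hmain : ∑ k ∈ N, T i k * (n k ⬝ᵥ a k0) =
      ∑ k ∈ N, ∑ j ∈ J N Fac i k, w k j * (φ j - φ k) * φ k := by
    apply Finset.sum_congr rfl
    intro k hk
    rw [← hF]
    by_cases hkk : k = k0
    · subst hkk
      rw [hFk0, mul_zero, Finset.sum_eq_zero]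
      intro j _
      simp [w, hlk0]
    · rw [htf k hkk, Finset.sum_mul]
      apply Finset.sum_congr rfl
      intro j hj
      rw [hφ k hk, hφ j (S.mem3 (S.mem_J.1 hj))]
      simp only [w]; ring
  have hwnn : ∀ k ∈ N, ∀ j ∈ J N Fac i k, 0 ≤ w k j * (φ j - φ k) ^ 2 := by
    intro k hk j hj
    have := hl0 k hk
    have := hl0 j (S.mem3 (S.mem_J.1 hj))
    simp only [w]; positivity
  have hsym := S.symm_sum i w φ (by
    intro k j _
    simp only [w]
    rw [DD_23, abs_neg]; ring)
  rw [hmain, hsym]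
  have hnn := Finset.sum_nonneg (fun k hk => Finset.sum_nonneg (hwnn k hk))
  refine ⟨by linarith, fun hz k hk hkk => ?_⟩
  have hz' : ∑ k ∈ N, ∑ j ∈ J N Fac i k, w k j * (φ j - φ k) ^ 2 = 0 := by linarith
  rw [Finset.sum_eq_zero_iff_of_nonneg (fun k hk => Finset.sum_nonneg (hwnn k hk))] at hz'
  have hz2 := hz' k hk
  rw [Finset.sum_eq_zero_iff_of_nonneg (hwnn k hk)] at hz2
  rw [htf k hkk]
  apply Finset.sum_eq_zero
  intro j hj
  have hf := S.mem_J.1 hj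
  by_cases hjk : j = k0
  · rw [hjk, DD_self34]; simp
  · have h1 := hz2 j hj
    have hD := S.DD_ne hf hk0 (S.ne h0).symm (fun h => hkk h.symm) (fun h => hjk h.symm)
    have p1 := hlpos k hk (S.ne hf).symm hkk
    have p2 := hlpos j (S.mem3 hf) (S.ne13 hf).symm hjk
    have hw : 0 < w k j := by simp only [w]; positivity
    have : φ j = φ k := by
      have := (mul_eq_zero.1 h1).resolve_left hw.ne'
      have := pow_eq_zero_iff (two_ne_zero) |>.1 this
      linarith
    rw [hφ j (S.mem3 hf), this, sub_self, zero_div]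

end VStar

namespace VStar
variable {N : Finset Pt} {a : Pt → Pt} {Fac : Pt → Pt → Pt → Prop} {a0 : Pt}

lemma exists_Rot (S : VStar N a Fac a0) (n : Pt → Pt)
    (h1 : ∀ i k j, Fac i k j → n i ⬝ᵥ a i = 0) (h2 : ∀ i k j, Fac i k j → n i ⬝ᵥ a k + n k ⬝ᵥ a i = 0) :
    ∃ Om, Rot a Fac n Om := by
  have : ∀ s : Finset Pt, ∃ c : Fin 6 → ℝ, (∃ c : Fin 6 → ℝ, ∀ x ∈ s, sk c (a x) = n x) → ∀ x ∈ s, sk c (a x) = n x := by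
    intro s
    by_cases h : ∃ c : Fin 6 → ℝ, ∀ x ∈ s, sk c (a x) = n x
    · exact ⟨h.choose, fun _ => h.choose_spec⟩
    · exact ⟨0, fun h' => absurd h' h⟩
  choose g hg using this
  refine ⟨fun i k j => g {i, k, j}, ?_, ?_, ?_⟩
  · intro i k j h
    apply hg
    · obtain ⟨c, e1, e2, e3⟩ := exists_sk (a i) (a k) (a j) a0 (n i) (n k) (n j) (S.sgn0 h) (h1 _ _ _ h)
        (h1 _ _ _ (S.s12 h)) (h1 _ _ _ (S.s12 (S.s23 h))) (h2 _ _ _ h) (h2 _ _ _ (S.s23 h))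
        (h2 _ _ _ (S.s23 (S.s12 h)))
      refine ⟨c, ?_⟩
      intro x hx
      simp only [Finset.mem_insert, Finset.mem_singleton] at hx
      rcases hx with rfl | rfl | rfl <;> assumption
    · simp
  · intro i k j
    show g _ = g _
    rw [Finset.insert_comm]
  · intro i k j
    show g _ = g _
    rw [Finset.pair_comm]

lemma T_zero (S : VStar N a Fac a0) {n Om T} (R : Rot a Fac n Om) (hT : IsT N a Fac a0 Om T) :
    ∀ i k, T i k = 0 := by
  choose c hc using fun i => S.T_equil R hT i
  obtain ⟨h, hpos⟩ := S.pos
  let M : Pt → Pt := fun i => ∑ k ∈ N, T i k • n k - c i • n i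
  have key : ∀ i k0 j1, Fac i k0 j1 → M i ⬝ᵥ a k0 ≤ 0 ∧ (M i ⬝ᵥ a k0 = 0 → ∀ k ∈ N, k ≠ k0 → T i k = 0) := by
    intro i k0 j1 h0
    let B := Om i k0 j1
    have R' : Rot a Fac (fun x => n x - sk B (a x)) (fun i k j => Om i k j - B) := by
      refine ⟨?_, ?_, ?_⟩
      · intro i k j h
        rw [sk_csub, R.e h]
      · intro i k j; simp only [R.s12 i k j]
      · intro i k j; simp only [R.s23 i k j]
    have hT' : IsT N a Fac a0 (fun i k j => Om i k j - B) T := by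
      refine ⟨?_, hT.2⟩
      intro i k z w
      rw [← hT.1 i k z w]
      simp only [sk_csub, sub_dotProduct, mul_sub, Finset.sum_sub_distrib]
      rw [← Finset.sum_mul, S.sg_sum]; ring
    have := S.local_norm R' hT' h0 (by intro x; rw [sk_csub]; exact sub_self _)
    have e : ∑ k ∈ N, T i k * ((n k - sk B (a k)) ⬝ᵥ a k0) = M i ⬝ᵥ a k0 := by
      have e1 : ∑ k ∈ N, T i k * ((n k - sk B (a k)) ⬝ᵥ a k0) =
        (∑ k ∈ N, T i k • n k) ⬝ᵥ a k0 - (sk B (∑ k ∈ N, T i k • a k)) ⬝ᵥ a k0 := by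
        rw [sk_sum, sum_dotProduct, sum_dotProduct, ← Finset.sum_sub_distrib]
        apply Finset.sum_congr rfl
        intro k _
        rw [sk_smul, smul_dotProduct, smul_dotProduct, sub_dotProduct]
        simp only [smul_eq_mul]; ring
      rw [e1, hc, sk_smul, R.e h0]
      simp only [M, sub_dotProduct]
    rw [e] at this
    exact this
  have hself : ∀ i k j, Fac i k j → M i ⬝ᵥ a i = 0 := by
    intro i k0 j0 h0
    have hi : n i ⬝ᵥ a i = 0 := by rw [← R.e h0, sk_self]
    have e1 : (∑ k ∈ N, T i k • n k) ⬝ᵥ a i = - (n i ⬝ᵥ (∑ k ∈ N, T i k • a k)) := by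
      rw [sum_dotProduct, dotProduct_sum, ← Finset.sum_neg_distrib]
      apply Finset.sum_congr rfl
      intro k _
      by_cases hex : ∃ j, Fac i k j
      · obtain ⟨j, hj⟩ := hex
        have := R.edge S hj
        rw [smul_dotProduct, dotProduct_smul, this]; simp
      · rw [hT.2 i k hex]; simp
    simp only [M, sub_dotProduct, e1, hc, dotProduct_smul, smul_dotProduct, hi]; simp
  have hle : ∀ i ∈ N, ∀ u ∈ N, M i ⬝ᵥ a u ≤ 0 := by
    intro i hi u hu
    by_cases hex : ∃ k j, Fac i k j
    · obtain ⟨k, j, h0⟩ := hex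
      obtain ⟨α, μ, hμ, hμ2, e⟩ := S.cone h0 u hu
      rw [e, dotProduct_add, dotProduct_smul, hself i k j h0, dotProduct_sum]
      simp only [smul_zero, zero_add]
      apply Finset.sum_nonpos
      intro s _
      rw [dotProduct_smul, smul_eq_mul]
      by_cases hs : μ s = 0
      · simp [hs]
      · obtain ⟨j, hj⟩ := hμ2 s hs
        exact mul_nonpos_of_nonneg_of_nonpos (hμ s) (key i s j hj).1
    · have hz : ∀ k, T i k = 0 := fun k => hT.2 i k (fun ⟨j, hj⟩ => hex ⟨k, j, hj⟩)
      have hci := hc i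
      simp only [hz, zero_smul, Finset.sum_const_zero] at hci
      have : c i = 0 := by
        have := congrArg h hci
        rw [map_zero, map_smul, smul_eq_mul] at this
        exact (mul_eq_zero.1 this.symm).resolve_right (hpos i hi).ne'
      simp [M, hz, this]
  have hsum : ∑ i ∈ N, h (a i) • M i = 0 := by
    simp only [M, smul_sub, Finset.sum_sub_distrib]
    rw [sub_eq_zero]
    have : ∑ i ∈ N, h (a i) • ∑ k ∈ N, T i k • n k = ∑ k ∈ N, (∑ i ∈ N, T k i * h (a i)) • n k := by
      simp only [Finset.smul_sum, Finset.sum_smul]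
      rw [Finset.sum_comm]
      apply Finset.sum_congr rfl; intro k _
      apply Finset.sum_congr rfl; intro i _
      rw [smul_smul, S.T_symm R hT i k, mul_comm]
    rw [this]
    apply Finset.sum_congr rfl; intro k _
    have := congrArg h (hc k)
    rw [map_sum, map_smul] at this
    simp only [map_smul, smul_eq_mul] at this
    rw [this, smul_smul, mul_comm]
  have hzero : ∀ i ∈ N, ∀ u ∈ N, M i ⬝ᵥ a u = 0 := by
    intro i hi u hu
    have := congrArg (fun x => x ⬝ᵥ a u) hsum
    simp only [sum_dotProduct, smul_dotProduct, zero_dotProduct, smul_eq_mul] at this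
    rw [Finset.sum_eq_zero_iff_of_nonpos] at this
    · exact (mul_eq_zero.1 (this i hi)).resolve_left (hpos i hi).ne'
    · intro j hj
      exact mul_nonpos_of_nonneg_of_nonpos (hpos j hj).le (hle j hj u hu)
  intro i k
  by_cases hex : ∃ j, Fac i k j
  · obtain ⟨j, hj⟩ := hex
    exact (key i j k (S.s23 hj)).2 (hzero i (S.mem hj) j (S.mem3 hj)) k (S.mem2 hj) (S.ne23 hj)
  · exact hT.2 i k hex

theorem star_rigid (S : VStar N a Fac a0) (n : Pt → Pt)
    (h1 : ∀ i k j, Fac i k j → n i ⬝ᵥ a i = 0) (h2 : ∀ i k j, Fac i k j → n i ⬝ᵥ a k + n k ⬝ᵥ a i = 0) :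
    ∃ c, ∀ i k j, Fac i k j → n i = sk c (a i) := by
  obtain ⟨Om, R⟩ := S.exists_Rot n h1 h2
  obtain ⟨T, hT⟩ := S.exists_T R
  have hT0 := S.T_zero R hT
  have hwall : ∀ i k j j', Fac i k j → Fac i k j' → ∀ z, sk (Om i k j) z = sk (Om i k j') z := by
    intro i k j j' hj hj' z
    by_cases hjj : j = j'
    · rw [hjj]
    obtain ⟨j2, hne, h', hJ⟩ := S.J_pair hj
    have : j' = j2 := by
      have := S.mem_J.2 hj'
      rw [hJ] at this
      simp only [Finset.mem_insert, Finset.mem_singleton] at this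
      rcases this with h | h
      · exact absurd h.symm hjj
      · exact h
    subst this
    have e : ∀ w, (sk (Om i k j) z - sk (Om i k j') z) ⬝ᵥ w = 0 := by
      intro w
      have := hT.1 i k z w
      rw [hT0, hJ, Finset.sum_pair hne, S.sg_opp hj h' hne] at this
      have hs : sg a a0 i k j ≠ 0 := by
        unfold sg
        rw [Ne, Real.sign_eq_zero_iff]; exact S.sgn0 hj
      have : sg a a0 i k j * ((sk (Om i k j) z - sk (Om i k j') z) ⬝ᵥ w) = 0 := by
        rw [sub_dotProduct]; linarith
      exact (mul_eq_zero.1 this).resolve_left hs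
    have := e (sk (Om i k j) z - sk (Om i k j') z)
    rw [dotProduct_self_eq_zero] at this
    exact sub_eq_zero.1 this
  have hv : ∀ i k j k' j', Fac i k j → Fac i k' j' → ∀ z, sk (Om i k j) z = sk (Om i k' j') z := by
    intro i k j k' j' hj hj'
    have hp := S.conn1 hj hj'
    have : ∀ j'', Fac i k' j'' → ∀ z, sk (Om i k j) z = sk (Om i k' j'') z := by
      clear hj'
      induction hp with
      | refl => exact fun j'' h z => hwall _ _ _ _ hj h z
      | @tail x y _ hxy ih =>
        intro j'' h z
        rw [ih y hxy z, ← R.s23, hwall i y x j'' (S.s23 hxy) h z]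
    exact this j' hj'
  by_cases hex : ∃ i k j, Fac i k j
  · obtain ⟨i, k, j, h0⟩ := hex
    refine ⟨Om i k j, ?_⟩
    intro i' k' j' h'
    have hp := S.conn2 h0 h'
    have : ∀ k'' j'', Fac i' k'' j'' → ∀ z, sk (Om i k j) z = sk (Om i' k'' j'') z := by
      clear h'
      induction hp with
      | refl => exact fun k'' j'' h z => hv _ _ _ _ _ h0 h z
      | @tail x y _ hxy ih =>
        intro k'' j'' h z
        obtain ⟨w, hw⟩ := hxy
        rw [ih y w hw z, ← R.s12, hv y x w k'' j'' (S.s12 hw) h z]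
    rw [this k' j' h', R.e h']
  · exact ⟨0, fun i k j h => absurd ⟨i, k, j, h⟩ hex⟩

end VStar

lemma face_extend (P : SPolytope 4) (τ : Finset Pt) (hτ : BFace P τ) (hc : τ.card ≤ 3) :
    ∃ s, s ∉ τ ∧ BFace P (insert s τ) := by
  by_contra hcon
  push Not at hcon
  obtain ⟨hs, hne, L, h0, h1⟩ := hτ.exf
  obtain ⟨u, hu, hus⟩ := Finset.exists_of_ssubset (lt_of_le_of_ne hs hne)
  obtain ⟨α, μ, hμ, hμ2, e⟩ := cone_lemma P τ hτ hc u hu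
  have : ∀ s ∈ P.V, μ s • hat s = 0 := by
    intro s _
    by_cases h : μ s = 0
    · simp [h]
    · exact absurd (hμ2 s h).2.2 (hcon s (hμ2 s h).2.1)
  rw [Finset.sum_congr rfl this, Finset.sum_const_zero, add_zero] at e
  have h2 := h1 u hu hus
  rw [e, map_sum, Finset.sum_eq_zero] at h2
  · exact lt_irrefl _ h2
  · intro t ht
    rw [map_smul, h0 t ht, smul_zero]

lemma vertex_face (P : SPolytope 4) (v : Pt) (hv : v ∈ P.V) : BFace P {v} := by
  apply Exf.bface
  refine ⟨by simpa using hv, ?_, ?_⟩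
  · intro h
    have := V_card P
    rw [← h] at this
    simp at this
  · have hcl : IsClosed (convexHull ℝ ((P.V.erase v : Finset Pt) : Set Pt)) :=
      (Set.Finite.isCompact_convexHull ℝ (Finset.finite_toSet _)).isClosed
    obtain ⟨f, r, h1, h2⟩ := geometric_hahn_banach_point_closed (convex_convexHull ℝ _) hcl (P.extreme v hv)
    refine ⟨f.toLinearMap ∘ₗ LinearMap.fst ℝ Pt ℝ - (f v) • LinearMap.snd ℝ Pt ℝ, ?_, ?_⟩
    · intro u hu
      rw [mem_singleton] at hu
      subst hu
      simp [hat]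
    · intro u hu huv
      rw [mem_singleton] at huv
      have := h2 u (subset_convexHull ℝ _ (by simp [huv, hu]))
      simp [hat]
      linarith

def FacV (P : SPolytope 4) (v i k j : Pt) : Prop :=
  i ≠ k ∧ i ≠ j ∧ k ≠ j ∧ i ≠ v ∧ k ≠ v ∧ j ≠ v ∧ BFace P {v, i, k, j}

lemma L_diff (L : WW →ₗ[ℝ] ℝ) (u v : Pt) : L (u - v, 0) = L (hat u) - L (hat v) := by
  rw [← map_sub]; simp [hat]

lemma facV_det (P : SPolytope 4) (v i k j : Pt) (h : FacV P v i k j) :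
    ∃ (l : Pt →ₗ[ℝ] ℝ) (κ : ℝ), κ ≠ 0 ∧ (∀ x, DD (i - v) (k - v) (j - v) x = κ * l x) ∧
      (∀ u ∈ P.V, u ≠ v → u ≠ i → u ≠ k → u ≠ j → 0 < l (u - v)) ∧
      l (i - v) = 0 ∧ l (k - v) = 0 ∧ l (j - v) = 0 ∧ ∃ u ∈ P.V, u ≠ v ∧ 0 < l (u - v) := by
  obtain ⟨hik, hij, hkj, hi, hk, hj, hF⟩ := h
  obtain ⟨hs, hne, L, h0, h1⟩ := hF.exf
  let l : Pt →ₗ[ℝ] ℝ := L ∘ₗ LinearMap.inl ℝ Pt ℝ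
  have hl : ∀ u, l (u - v) = L (hat u) := by
    intro u
    have := L_diff L u v
    rw [h0 v (by simp), sub_zero] at this
    exact this
  obtain ⟨u, hu, hus⟩ := Finset.exists_of_ssubset (lt_of_le_of_ne hs hne)
  have hlu : 0 < l (u - v) := by rw [hl]; exact h1 u hu hus
  have e1 : l (i - v) = 0 := by rw [hl]; exact h0 i (by simp)
  have e2 : l (k - v) = 0 := by rw [hl]; exact h0 k (by simp)
  have e3 : l (j - v) = 0 := by rw [hl]; exact h0 j (by simp)
  have hdual : ∀ g : Pt → ℝ, g v = 0 → ∃ M : Pt →ₗ[ℝ] ℝ, M (i - v) = g i ∧ M (k - v) = g k ∧ M (j - v) = g j := by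
    intro g hg
    obtain ⟨M, hM⟩ := exists_dual _ hF.li (fun x => g x.1)
    have hv := hM ⟨v, by simp⟩
    refine ⟨M ∘ₗ LinearMap.inl ℝ Pt ℝ, ?_, ?_, ?_⟩
    · have := hM ⟨i, by simp⟩
      simp only at this hv
      show M (i - v, 0) = _
      rw [L_diff, this, hv, hg, sub_zero]
    · have := hM ⟨k, by simp⟩
      simp only at this hv
      show M (k - v, 0) = _
      rw [L_diff, this, hv, hg, sub_zero]
    · have := hM ⟨j, by simp⟩
      simp only at this hv
      show M (j - v, 0) = _
      rw [L_diff, this, hv, hg, sub_zero]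
  have hD : DD (i - v) (k - v) (j - v) (u - v) ≠ 0 := by
    intro hz
    rw [← DD_det, ← Matrix.exists_vecMul_eq_zero_iff] at hz
    obtain ⟨c, hc, hc0⟩ := hz
    have hc1 : c 0 • (i - v) + c 1 • (k - v) + c 2 • (j - v) + c 3 • (u - v) = 0 := by
      rw [← hc0]
      ext t
      simp [Matrix.vecMul, dotProduct, Fin.sum_univ_succ]
      ring
    have c3 : c 3 = 0 := by
      have := congrArg l hc1
      simp only [map_add, map_smul, e1, e2, e3, smul_eq_mul, mul_zero, zero_add, map_zero] at this
      exact (mul_eq_zero.1 this).resolve_right hlu.ne'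
    rw [c3, zero_smul, add_zero] at hc1
    have c0 : c 0 = 0 := by
      obtain ⟨M, m1, m2, m3⟩ := hdual (fun x => if x = i then 1 else 0) (by simp [hi.symm])
      have := congrArg M hc1
      simpa [m1, m2, m3, hik.symm, hij.symm] using this
    have c1 : c 1 = 0 := by
      obtain ⟨M, m1, m2, m3⟩ := hdual (fun x => if x = k then 1 else 0) (by simp [hk.symm])
      have := congrArg M hc1
      simpa [m1, m2, m3, hik, hkj.symm] using this
    have c2 : c 2 = 0 := by
      obtain ⟨M, m1, m2, m3⟩ := hdual (fun x => if x = j then 1 else 0) (by simp [hj.symm])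
      have := congrArg M hc1
      simpa [m1, m2, m3, hij, hkj] using this
    apply hc
    ext t
    fin_cases t
    · exact c0
    · exact c1
    · exact c2
    · exact c3
  refine ⟨l, DD (i - v) (k - v) (j - v) (u - v) / l (u - v), div_ne_zero hD hlu.ne', ?_, ?_, e1, e2, e3, u, hu, ?_, hlu⟩
  · intro x
    have hx := congrArg l (cramer4' _ _ _ _ x hD)
    simp only [map_add, map_smul, e1, e2, e3, smul_eq_mul, mul_zero, zero_add] at hx
    rw [hx]
    field_simp
  · intro w hw w1 w2 w3 w4
    rw [hl]
    apply h1 w hw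
    simp [w1, w2, w3, w4]
  · rintro rfl
    apply hus; simp

lemma vstar (P : SPolytope 4) (v : Pt) (hv : v ∈ P.V) :
    VStar (P.V.erase v) (fun u => u - v) (FacV P v) (∑ u ∈ P.V.erase v, (u - v)) := by
  have hsub : ∀ {i k j}, FacV P v i k j → i ∈ P.V := fun h => h.2.2.2.2.2.2.exf.1 (by simp)
  have hs12 : ∀ {i k j}, FacV P v i k j → FacV P v k i j := by
    rintro i k j ⟨h1, h2, h3, h4, h5, h6, h⟩
    exact ⟨h1.symm, h3, h2, h5, h4, h6, h.mono (by intro x; simp only [mem_insert, mem_singleton]; tauto)⟩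
  have hs23 : ∀ {i k j}, FacV P v i k j → FacV P v i j k := by
    rintro i k j ⟨h1, h2, h3, h4, h5, h6, h⟩
    exact ⟨h2, h1, h3.symm, h4, h6, h5, h.mono (by intro x; simp only [mem_insert, mem_singleton]; tauto)⟩
  have mk : ∀ {i k j}, i ≠ v → k ≠ v → i ≠ k → j ∉ ({v, i, k} : Finset Pt) → BFace P (insert j {v, i, k}) →
      FacV P v i k j := by
    intro i k j h1 h2 h3 h4 h5
    simp only [mem_insert, mem_singleton, not_or] at h4
    exact ⟨h3, fun h => h4.2.1 h.symm, fun h => h4.2.2 h.symm, h1, h2, h4.1,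
      h5.mono (by intro x; simp only [mem_insert, mem_singleton]; tauto)⟩
  have c3 : ∀ {i k : Pt}, i ≠ v → k ≠ v → i ≠ k → ({v, i, k} : Finset Pt).card = 3 := by
    intro i k h1 h2 h3
    rw [card_eq_three]; exact ⟨v, i, k, h1.symm, h2.symm, h3, rfl⟩
  have ext3 : ∀ {i k}, i ≠ v → k ≠ v → i ≠ k → BFace P {v, i, k} → ∃ j, FacV P v i k j := by
    intro i k h1 h2 h3 h
    obtain ⟨j, hj, hf⟩ := face_extend P _ h (c3 h1 h2 h3).le
    exact ⟨j, mk h1 h2 h3 hj hf⟩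
  have hDs : ∀ {i k j}, FacV P v i k j → ∃ (l : Pt →ₗ[ℝ] ℝ) (κ σ : ℝ), κ ≠ 0 ∧ 0 < σ ∧
      (∀ x, DD (i - v) (k - v) (j - v) x = κ * l x) ∧
      (∀ u ∈ P.V, u ≠ v → u ≠ i → u ≠ k → u ≠ j → 0 < l (u - v)) ∧
      DD (i - v) (k - v) (j - v) (∑ u ∈ P.V.erase v, (u - v)) = κ * σ := by
    intro i k j h
    obtain ⟨l, κ, hκ, e, hp, e1, e2, e3, u, hu, huv, hlu⟩ := facV_det P v i k j h
    refine ⟨l, κ, l (∑ u ∈ P.V.erase v, (u - v)), hκ, ?_, e, hp, e _⟩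
    rw [map_sum]
    apply Finset.sum_pos'
    · intro w hw
      rw [mem_erase] at hw
      by_cases h1 : w = i
      · rw [h1, e1]
      by_cases h2 : w = k
      · rw [h2, e2]
      by_cases h3 : w = j
      · rw [h3, e3]
      exact (hp w hw.2 hw.1 h1 h2 h3).le
    · exact ⟨u, mem_erase.2 ⟨huv, hu⟩, hlu⟩
  constructor
  · intro i k j h
    exact mem_erase.2 ⟨h.2.2.2.1, hsub h⟩
  · exact hs12
  · exact hs23
  · exact fun h => h.1
  · intro i k j h
    obtain ⟨l, κ, σ, hκ, hσ, -, -, e⟩ := hDs h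
    rw [e]
    exact mul_ne_zero hκ hσ.ne'
  · intro i k j h u hu h1 h2 h3
    obtain ⟨l, κ, σ, hκ, hσ, e1, e2, e⟩ := hDs h
    rw [mem_erase] at hu
    rw [e, e1]
    have := e2 u hu.2 hu.1 h1 h2 h3
    have h2 : 0 < κ * κ := mul_self_pos.2 hκ
    calc 0 < (κ * κ) * (σ * l (u - v)) := by positivity
      _ = _ := by ring
  · intro i k j h
    obtain ⟨hik, hij, hkj, hi, hk, hj, hF⟩ := h
    have hτ : BFace P {v, i, k} := hF.mono (by intro x; simp only [mem_insert, mem_singleton]; tauto)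
    have hjF : BFace P (insert j {v, i, k}) := hF.mono (by intro x; simp only [mem_insert, mem_singleton]; tauto)
    have hjn : j ∉ ({v, i, k} : Finset Pt) := by simp [hj, hij.symm, hkj.symm]
    obtain ⟨j', hne, hj'n, hj'F⟩ : ∃ j', j' ≠ j ∧ j' ∉ ({v, i, k} : Finset Pt) ∧ BFace P (insert j' {v, i, k}) := by
      obtain ⟨j1, j2, hn, m1, m2, f1, f2⟩ := wall_ge P _ hτ (c3 hi hk hik)
      by_cases hh : j1 = j
      · exact ⟨j2, fun h => hn (hh.trans h.symm), m2, f2⟩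
      · exact ⟨j1, hh, m1, f1⟩
    refine ⟨j', hne, mk hi hk hik hj'n hj'F, ?_⟩
    intro j'' hj''
    by_contra hcon
    push Not at hcon
    obtain ⟨a1, a2, a3, a4, a5, a6, hF''⟩ := hj''
    exact wall_le P _ (c3 hi hk hik) j j' j'' hjn hj'n (by simp [a6, a2.symm, a3.symm]) hjF hj'F
      (hF''.mono (by intro x; simp only [mem_insert, mem_singleton]; tauto)) hne.symm hcon.1.symm hcon.2.symm
  · intro i k j h
    obtain ⟨hik, hij, hkj, hi, hk, hj, hF⟩ := h
    have hτ : BFace P {v, i, k} := hF.mono (by intro x; simp only [mem_insert, mem_singleton]; tauto)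
    obtain ⟨hs, hne, L, h0, h1⟩ := hτ.exf
    have hl : ∀ u, L (u - v, 0) = L (hat u) := by
      intro u
      rw [L_diff L u v, h0 v (by simp), sub_zero]
    refine ⟨L ∘ₗ LinearMap.inl ℝ Pt ℝ, ?_, ?_, ?_⟩
    · exact (hl i).trans (h0 i (by simp))
    · exact (hl k).trans (h0 k (by simp))
    · intro u hu u1 u2
      rw [mem_erase] at hu
      exact (h1 u hu.2 (by simp [u1, u2, hu.1])).trans_eq (hl u).symm
  · have hf := vertex_face P v hv
    obtain ⟨hs, hne, L, h0, h1⟩ := hf.exf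
    have hl : ∀ u, L (u - v, 0) = L (hat u) := by
      intro u
      rw [L_diff L u v, h0 v (by simp), sub_zero]
    refine ⟨L ∘ₗ LinearMap.inl ℝ Pt ℝ, ?_⟩
    intro u hu
    rw [mem_erase] at hu
    exact (h1 u hu.2 (by simp [hu.1])).trans_eq (hl u).symm
  · intro i k j h u hu
    obtain ⟨hik, hij, hkj, hi, hk, hj, hF⟩ := h
    have hτ : BFace P {v, i} := hF.mono (by intro x; simp only [mem_insert, mem_singleton]; tauto)
    obtain ⟨α, μ, hμ, hμ2, e⟩ := cone_lemma P {v, i} hτ (by rw [card_pair hi.symm]; norm_num) u (mem_of_mem_erase hu)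
    rw [Finset.sum_pair hi.symm] at e
    have e1 := congrArg Prod.fst e
    have e2 := congrArg Prod.snd e
    simp only [hat, Prod.smul_mk, Prod.fst_add, Prod.snd_add, Prod.fst_sum, Prod.snd_sum, smul_eq_mul, mul_one] at e1 e2
    refine ⟨α i, μ, hμ, ?_, ?_⟩
    · intro s hs
      obtain ⟨s1, s2, s3⟩ := hμ2 s hs
      simp only [mem_insert, mem_singleton, not_or] at s2
      exact ext3 hi s2.1 (fun h => s2.2 h.symm) (s3.mono (by intro x; simp only [mem_insert, mem_singleton]; tauto))
    · have hv0 : μ v = 0 := by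
        by_contra h
        exact (hμ2 v h).2.1 (by simp)
      have : ∑ s ∈ P.V.erase v, μ s • (s - v) = ∑ s ∈ P.V, μ s • (s - v) := by
        rw [← Finset.add_sum_erase _ _ hv, hv0, zero_smul, zero_add]
      rw [this]
      simp only [smul_sub, Finset.sum_sub_distrib, ← Finset.sum_smul]
      have e3 : ∑ s ∈ P.V, μ s = 1 - α v - α i := by linarith
      rw [e3, e1]
      module
  · intro i k j k' j' h h'
    obtain ⟨hik, hij, hkj, hi, hk, hj, hF⟩ := h
    obtain ⟨hik', hij', hkj', hi', hk', hj', hF'⟩ := h'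
    have := link_conn P {v, i} (by rw [card_pair hi.symm]) k k'
      (hF.mono (by intro x; simp only [mem_insert, mem_singleton]; tauto))
      (hF'.mono (by intro x; simp only [mem_insert, mem_singleton]; tauto))
      (by simp [hk, hik.symm]) (by simp [hk', hik'.symm])
    refine Relation.ReflTransGen.mono ?_ _ _ this
    rintro x y ⟨h1, h2, h3, h4⟩
    simp only [mem_insert, mem_singleton, not_or] at h1 h2
    exact ⟨fun h => h1.2 h.symm, fun h => h2.2 h.symm, h3, hi, h1.1, h2.1,
      h4.mono (by intro x; simp only [mem_insert, mem_singleton]; tauto)⟩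
  · intro i k j i' k' j' h h'
    obtain ⟨hik, hij, hkj, hi, hk, hj, hF⟩ := h
    obtain ⟨hik', hij', hkj', hi', hk', hj', hF'⟩ := h'
    have := link_conn P {v} (by simp) i i'
      (hF.mono (by intro x; simp only [mem_insert, mem_singleton]; tauto))
      (hF'.mono (by intro x; simp only [mem_insert, mem_singleton]; tauto))
      (by simp [hi]) (by simp [hi'])
    refine Relation.ReflTransGen.mono ?_ _ _ this
    rintro x y ⟨h1, h2, h3, h4⟩
    simp only [mem_singleton] at h1 h2
    exact ext3 h1 h2 h3 (h4.mono (by intro x; simp only [mem_insert, mem_singleton]; tauto))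

lemma star_trivial (P : SPolytope 4) (v : Pt) (hv : v ∈ P.V) (m : Pt → Pt)
    (hm : ∀ x y, BFace P {v, x, y} → (m x - m y) ⬝ᵥ (x - y) = 0) :
    ∃ c, ∀ u, BFace P {v, u} → m u = m v + sk c (u - v) := by
  have S := vstar P v hv
  obtain ⟨c, hc⟩ := S.star_rigid (fun u => m u - m v) (by
    intro i k j h
    exact hm i v (h.2.2.2.2.2.2.mono (by intro x; simp only [mem_insert, mem_singleton]; tauto))) (by
    intro i k j h
    have hF := h.2.2.2.2.2.2
    have h1 := hm i v (hF.mono (by intro x; simp only [mem_insert, mem_singleton]; tauto))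
    have h2 := hm k v (hF.mono (by intro x; simp only [mem_insert, mem_singleton]; tauto))
    have h3 := hm i k (hF.mono (by intro x; simp only [mem_insert, mem_singleton]; tauto))
    simp only [sub_dotProduct, dotProduct_sub] at *
    linarith)
  refine ⟨c, fun u hu => ?_⟩
  by_cases huv : u = v
  · rw [huv, sub_self, sk_zero, add_zero]
  obtain ⟨k, hk, hF⟩ := face_extend P _ hu (by rw [card_pair (Ne.symm huv)]; norm_num)
  simp only [mem_insert, mem_singleton, not_or] at hk
  obtain ⟨j, hj, hF2⟩ := face_extend P _ hF (by
    rw [card_insert_of_notMem (by simp [hk.1, hk.2]), card_pair (Ne.symm huv)])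
  simp only [mem_insert, mem_singleton, not_or] at hj
  have := hc u k j ⟨fun h => hk.2 h.symm, fun h => hj.2.2 h.symm, fun h => hj.1 h.symm, huv, hk.1, hj.2.1,
    hF2.mono (by intro x; simp only [mem_insert, mem_singleton]; tauto)⟩
  rw [← this]; abel

/-- rigidity form -/
def RR (m : Pt → Pt) (e : Finset Pt) : ℝ := (1/2) * ∑ u ∈ e, ∑ w ∈ e, (m u - m w) ⬝ᵥ (u - w)

lemma RR_pair (m : Pt → Pt) (x y : Pt) : RR m {x, y} = (m x - m y) ⬝ᵥ (x - y) := by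
  by_cases h : x = y
  · subst h; simp [RR]
  · unfold RR
    rw [Finset.sum_pair h, Finset.sum_pair h, Finset.sum_pair h]
    simp only [sub_self, dotProduct_zero]
    simp only [sub_dotProduct, dotProduct_sub]; ring

lemma RR_add (m m' : Pt → Pt) (e : Finset Pt) : RR (m + m') e = RR m e + RR m' e := by
  unfold RR
  rw [← mul_add, ← Finset.sum_add_distrib]
  congr 1
  apply Finset.sum_congr rfl; intro u _
  rw [← Finset.sum_add_distrib]
  apply Finset.sum_congr rfl; intro w _
  simp only [Pi.add_apply, sub_dotProduct, add_dotProduct]; ring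

lemma RR_smul (r : ℝ) (m : Pt → Pt) (e : Finset Pt) : RR (r • m) e = r * RR m e := by
  unfold RR
  rw [mul_left_comm, Finset.mul_sum (a := r)]
  congr 1
  apply Finset.sum_congr rfl; intro u _
  rw [Finset.mul_sum]
  apply Finset.sum_congr rfl; intro w _
  simp only [Pi.smul_apply, sub_dotProduct, smul_dotProduct, smul_eq_mul]; ring

lemma RR_congr {m m' : Pt → Pt} {e : Finset Pt} (h : ∀ u ∈ e, m u = m' u) : RR m e = RR m' e := by
  unfold RR
  congr 1
  apply Finset.sum_congr rfl; intro u hu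
  apply Finset.sum_congr rfl; intro w hw
  rw [h u hu, h w hw]

def RL (Γ : Finset (Finset Pt)) : (Pt → Pt) →ₗ[ℝ] (Γ → ℝ) where
  toFun m e := RR m e.1
  map_add' m m' := by ext e; exact RR_add m m' e.1
  map_smul' r m := by ext e; exact RR_smul r m e.1

lemma RR_sub (m m' : Pt → Pt) (e : Finset Pt) : RR (m - m') e = RR m e - RR m' e := by
  have := RR_add m ((-1 : ℝ) • m') e
  rw [RR_smul] at this
  have h : m - m' = m + (-1 : ℝ) • m' := by rw [neg_one_smul, sub_eq_add_neg]
  rw [h, this]; ring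

def ext0 (U : Finset Pt) : (U → Pt) →ₗ[ℝ] (Pt → Pt) where
  toFun m u := if h : u ∈ U then m ⟨u, h⟩ else 0
  map_add' m m' := by ext1 u; by_cases h : u ∈ U <;> simp [h]
  map_smul' r m := by ext1 u; by_cases h : u ∈ U <;> simp [h]

lemma ext0_mem {U : Finset Pt} (m : U → Pt) {u : Pt} (h : u ∈ U) : ext0 U m u = m ⟨u, h⟩ := by
  simp [ext0, h]

def restr (U : Finset Pt) : (Pt → Pt) →ₗ[ℝ] (U → Pt) where
  toFun m u := m u.1
  map_add' m m' := rfl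
  map_smul' r m := rfl

def FF (U : Finset Pt) (Γ : Finset (Finset Pt)) : (U → Pt) →ₗ[ℝ] (Γ → ℝ) := RL Γ ∘ₗ ext0 U

def triv : ((Fin 6 → ℝ) × Pt) →ₗ[ℝ] (Pt → Pt) where
  toFun p u := sk p.1 u + p.2
  map_add' p q := by
    ext1 u
    have : sk (p.1 + q.1) u = sk p.1 u + sk q.1 u := by
      rw [← skL_apply, map_add]; rfl
    simp only [Prod.fst_add, Prod.snd_add, Pi.add_apply, this]; abel
  map_smul' r p := by
    ext1 u
    have : sk (r • p.1) u = r • sk p.1 u := by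
      rw [← skL_apply, map_smul]; rfl
    simp only [Prod.smul_fst, Prod.smul_snd, Pi.smul_apply, this, smul_add, RingHom.id_apply]

lemma triv_apply (p) (u : Pt) : triv p u = sk p.1 u + p.2 := rfl

def IsEdgeLike (U : Finset Pt) (Γ : Finset (Finset Pt)) : Prop := ∀ e ∈ Γ, ∃ x ∈ U, ∃ y ∈ U, x ≠ y ∧ e = {x, y}

lemma RR_triv (p) (x y : Pt) : RR (triv p) {x, y} = 0 := by
  rw [RR_pair, triv_apply, triv_apply]
  have : sk p.1 x + p.2 - (sk p.1 y + p.2) = sk p.1 (x - y) := by rw [sk_sub]; abel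
  rw [this, sk_self]

def Big (U : Finset Pt) : Prop := ∃ v ∈ U, ∃ i ∈ U, ∃ k ∈ U, ∃ j ∈ U, ∃ q, DD (i - v) (k - v) (j - v) q ≠ 0

lemma sk_eq_zero (c : Fin 6 → ℝ) (h : ∀ z w, sk c z ⬝ᵥ w = 0) : c = 0 := by
  have e : ∀ i j : Fin 4, sk c (Pi.single i 1) j = 0 := by
    intro i j
    have := h (Pi.single i 1) (Pi.single j 1)
    rwa [dotProduct_single, mul_one] at this
  have h1 := e 1 0
  have h2 := e 2 0
  have h3 := e 3 0
  have h4 := e 2 1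
  have h5 := e 3 1
  have h6 := e 3 2
  simp [sk, Pi.single_apply] at h1 h2 h3 h4 h5 h6
  ext t
  fin_cases t <;> assumption

lemma triv_inj {U : Finset Pt} (hU : Big U) {p q} (h : ∀ u ∈ U, triv p u = triv q u) : p = q := by
  obtain ⟨v, hv, i, hi, k, hk, j, hj, w, hD⟩ := hU
  have hdiff : ∀ u ∈ U, sk (p.1 - q.1) (u - v) = 0 := by
    intro u hu
    have h1 := h u hu
    have h2 := h v hv
    rw [triv_apply, triv_apply] at h1 h2
    rw [sk_csub, sk_sub, sk_sub]
    have : (sk p.1 u + p.2) - (sk p.1 v + p.2) - ((sk q.1 u + q.2) - (sk q.1 v + q.2)) = 0 := by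
      rw [h1, h2]; abel
    rw [← this]; abel
  have hk2 := sk_kill2 _ _ _ _ hD (p.1 - q.1) (hdiff i hi) (hdiff k hk)
  rw [hdiff j hj] at hk2
  simp only [zero_dotProduct, zero_div, zero_mul] at hk2
  have hc := sub_eq_zero.1 (sk_eq_zero _ hk2)
  have h2 := h v hv
  rw [triv_apply, triv_apply, hc] at h2
  exact Prod.ext hc (add_left_cancel h2)

lemma finrank_triv : Module.finrank ℝ ((Fin 6 → ℝ) × Pt) = 10 := by
  rw [Module.finrank_prod, Module.finrank_fin_fun, Module.finrank_fin_fun]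

lemma finrank_UPt (U : Finset Pt) : Module.finrank ℝ (U → Pt) = 4 * U.card := by
  rw [Module.finrank_pi_fintype]
  simp [mul_comm]

lemma finrank_G (Γ : Finset (Finset Pt)) : Module.finrank ℝ (Γ → ℝ) = Γ.card := by
  rw [Module.finrank_fintype_fun_eq_card]; simp

/-- A trivial kernel gives many edges. -/
lemma count_lower (U : Finset Pt) (Γ : Finset (Finset Pt))
    (h : ∀ m : Pt → Pt, (∀ e ∈ Γ, RR m e = 0) → ∃ p, ∀ u ∈ U, m u = triv p u) :
    4 * U.card ≤ Γ.card + 10 := by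
  have hk : LinearMap.ker (FF U Γ) ≤ LinearMap.range (restr U ∘ₗ triv) := by
    intro m hm
    obtain ⟨p, hp⟩ := h (ext0 U m) (fun e he => congrFun hm ⟨e, he⟩)
    refine ⟨p, ?_⟩
    ext1 u
    have := hp u.1 u.2
    rw [ext0_mem m u.2] at this
    exact this.symm
  have h1 := Submodule.finrank_mono hk
  have h2 := LinearMap.finrank_range_le (restr U ∘ₗ triv)
  have h3 := LinearMap.finrank_range_add_finrank_ker (FF U Γ)
  have h4 := Submodule.finrank_le (LinearMap.range (FF U Γ))
  rw [finrank_triv] at h2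
  rw [finrank_UPt] at h3
  rw [finrank_G] at h4
  omega

lemma FF_triv {U : Finset Pt} {Γ : Finset (Finset Pt)} (hΓ : IsEdgeLike U Γ) (p) : FF U Γ (restr U (triv p)) = 0 := by
  ext e
  obtain ⟨x, hx, y, hy, hxy, he⟩ := hΓ e.1 e.2
  show RR (ext0 U (restr U (triv p))) e.1 = 0
  rw [RR_congr (m' := triv p), he, RR_triv]
  intro u hu
  have : u ∈ U := by
    rw [he] at hu
    simp only [mem_insert, mem_singleton] at hu
    rcases hu with rfl | rfl <;> assumption
  rw [ext0_mem _ this]; rfl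

lemma rank_upper (U : Finset Pt) (Γ : Finset (Finset Pt)) (hU : Big U) (hΓ : IsEdgeLike U Γ) :
    Module.finrank ℝ (LinearMap.range (FF U Γ)) + 10 ≤ 4 * U.card := by
  have hk : LinearMap.range (restr U ∘ₗ triv) ≤ LinearMap.ker (FF U Γ) := by
    rintro _ ⟨p, rfl⟩
    exact FF_triv hΓ p
  have h1 := Submodule.finrank_mono hk
  have h2 : Module.finrank ℝ (LinearMap.range (restr U ∘ₗ triv)) = 10 := by
    rw [LinearMap.finrank_range_of_inj, finrank_triv]
    intro p q hpq
    apply triv_inj hU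
    intro u hu
    exact congrFun hpq ⟨u, hu⟩
  have h3 := LinearMap.finrank_range_add_finrank_ker (FF U Γ)
  rw [finrank_UPt] at h3
  omega

def Strs (Γ : Finset (Finset Pt)) (s : Finset Pt → ℝ) : Prop :=
  (∀ e, e ∉ Γ → s e = 0) ∧ ∀ m : Pt → Pt, ∑ e ∈ Γ, s e * RR m e = 0

lemma exists_stress {A : Type} [AddCommGroup A] [Module ℝ A] (Γ : Finset (Finset Pt)) (F : A →ₗ[ℝ] (Γ → ℝ))
    (h : LinearMap.range F ≠ ⊤) : ∃ s : Finset Pt → ℝ, (∀ e, e ∉ Γ → s e = 0) ∧ (∃ e ∈ Γ, s e ≠ 0) ∧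
      ∀ x, ∑ e : Γ, s e.1 * F x e = 0 := by
  obtain ⟨f, hf, hle⟩ := Submodule.exists_le_ker_of_lt_top _ (lt_top_iff_ne_top.2 h)
  let s : Finset Pt → ℝ := fun e => if h : e ∈ Γ then f (Pi.single ⟨e, h⟩ 1) else 0
  have hs : ∀ y : Γ → ℝ, f y = ∑ e : Γ, s e.1 * y e := by
    intro y
    conv_lhs => rw [pi_eq_sum_univ' y]
    rw [map_sum]
    apply Finset.sum_congr rfl
    intro e _
    rw [map_smul, smul_eq_mul, mul_comm]
    simp only [s, e.2, dif_pos]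
  refine ⟨s, ?_, ?_, ?_⟩
  · intro e he; simp [s, he]
  · by_contra hcon
    push Not at hcon
    apply hf
    apply LinearMap.ext
    intro y
    rw [hs y, LinearMap.zero_apply]
    apply Finset.sum_eq_zero
    intro e _
    rw [hcon e.1 e.2, zero_mul]
  · intro x
    rw [← hs]
    exact hle ⟨x, rfl⟩

/-- No stress implies sparsity. -/
lemma count_upper (U : Finset Pt) (Γ : Finset (Finset Pt)) (hU : Big U) (hΓ : IsEdgeLike U Γ)
    (hs : ∀ s, Strs Γ s → ∀ e ∈ Γ, s e = 0) : Γ.card + 10 ≤ 4 * U.card := by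
  have hr := rank_upper U Γ hU hΓ
  have : LinearMap.range (FF U Γ) = ⊤ := by
    by_contra hcon
    obtain ⟨s, h1, ⟨e, he, hne⟩, h3⟩ := exists_stress Γ _ hcon
    refine hne (hs s ⟨h1, ?_⟩ e he)
    intro m
    rw [← Finset.sum_coe_sort]
    rw [← h3 (restr U m)]
    apply Finset.sum_congr rfl
    intro e _
    congr 1
    apply RR_congr
    intro u hu
    obtain ⟨x, hx, y, hy, hxy, he⟩ := hΓ e.1 e.2
    have : u ∈ U := by
      rw [he] at hu
      simp only [mem_insert, mem_singleton] at hu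
      rcases hu with rfl | rfl <;> assumption
    rw [ext0_mem _ this]; rfl
  rw [this, finrank_top, finrank_G] at hr
  exact hr

def Ed (P : SPolytope 4) (x y : Pt) : Prop := x ≠ y ∧ BFace P {x, y}

lemma Ed.symm {P : SPolytope 4} {x y : Pt} (h : Ed P x y) : Ed P y x :=
  ⟨h.1.symm, by rw [pair_comm]; exact h.2⟩
lemma Ed.mem1 {P : SPolytope 4} {x y : Pt} (h : Ed P x y) : x ∈ P.V := h.2.1 (by simp)
lemma Ed.mem2 {P : SPolytope 4} {x y : Pt} (h : Ed P x y) : y ∈ P.V := h.2.1 (by simp)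

lemma mem_E {P : SPolytope 4} {e : Finset Pt} : e ∈ edgeFinset P ↔ ∃ x y, Ed P x y ∧ e = {x, y} := by
  simp only [edgeFinset, Finset.mem_filter, mem_powerset]
  constructor
  · rintro ⟨h1, h2, h3⟩
    obtain ⟨x, y, hxy, rfl⟩ := card_eq_two.1 h2
    exact ⟨x, y, ⟨hxy, h3⟩, rfl⟩
  · rintro ⟨x, y, h, rfl⟩
    exact ⟨h.2.1, card_pair h.1, h.2⟩

lemma pair_E {P : SPolytope 4} {x y : Pt} : {x, y} ∈ edgeFinset P ↔ Ed P x y := by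
  constructor
  · intro h
    simp only [edgeFinset, Finset.mem_filter, mem_powerset] at h
    refine ⟨?_, h.2.2⟩
    rintro rfl
    simp at h
  · intro h
    exact mem_E.2 ⟨x, y, h, rfl⟩

/-- edges of the star of `v` -/
def Ev (P : SPolytope 4) (v : Pt) : Finset (Finset Pt) := (edgeFinset P).filter fun e => BFace P (insert v e)

lemma pair_Ev {P : SPolytope 4} {v x y : Pt} : {x, y} ∈ Ev P v ↔ x ≠ y ∧ BFace P {v, x, y} := by
  simp only [Ev, mem_filter, pair_E]
  constructor
  · intro h; exact ⟨h.1.1, h.2⟩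
  · intro h; exact ⟨⟨h.1, h.2.mono (by simp)⟩, h.2⟩

lemma big_facet {P : SPolytope 4} {s : Finset Pt} (h : BFace P s) (hc : s.card = 4) : Big s := by
  obtain ⟨v, i, k, j, h1, h2, h3, h4, h5, h6, rfl⟩ := card_eq_four.1 hc
  obtain ⟨l, κ, hκ, e, hp, e1, e2, e3, u, hu, huv, hlu⟩ :=
    facV_det P v i k j ⟨h4, h5, h6, h1.symm, h2.symm, h3.symm, h⟩
  refine ⟨v, by simp, i, by simp, k, by simp, j, by simp, u - v, ?_⟩
  rw [e]
  exact mul_ne_zero hκ hlu.ne'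

lemma Big.mono {U W : Finset Pt} (h : Big U) (hUW : U ⊆ W) : Big W := by
  obtain ⟨v, hv, i, hi, k, hk, j, hj, q, hD⟩ := h
  exact ⟨v, hUW hv, i, hUW hi, k, hUW hk, j, hUW hj, q, hD⟩

lemma star_triv (P : SPolytope 4) (v : Pt) (hv : v ∈ P.V) (m : Pt → Pt)
    (hm : ∀ e ∈ Ev P v, RR m e = 0) : ∃ p, ∀ u, BFace P {v, u} → m u = triv p u := by
  obtain ⟨c, hc⟩ := star_trivial P v hv m (by
    intro x y h
    by_cases hxy : x = y
    · simp [hxy]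
    · rw [← RR_pair]; exact hm _ (pair_Ev.2 ⟨hxy, h⟩))
  refine ⟨(c, m v - sk c v), fun u hu => ?_⟩
  rw [hc u hu, triv_apply, sk_sub]; simp only; abel

/-- every face extends to a facet -/
lemma face_to_facet (P : SPolytope 4) (s : Finset Pt) (hs : BFace P s) : ∃ t, s ⊆ t ∧ BFace P t ∧ t.card = 4 := by
  have : ∀ n, ∀ s : Finset Pt, BFace P s → 4 - s.card = n → ∃ t, s ⊆ t ∧ BFace P t ∧ t.card = 4 := by
    intro n
    induction n with
    | zero =>
      intro s hs hn
      exact ⟨s, Subset.refl _, hs, by have := hs.card_le; omega⟩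
    | succ n ih =>
      intro s hs hn
      obtain ⟨x, hx, hf⟩ := face_extend P s hs (by omega)
      obtain ⟨t, h1, h2, h3⟩ := ih _ hf (by rw [card_insert_of_notMem hx]; omega)
      exact ⟨t, (subset_insert _ _).trans h1, h2, h3⟩
  exact this _ s hs rfl

lemma Ev_sub (P : SPolytope 4) (v : Pt) : Ev P v ⊆ edgeFinset P := filter_subset _ _

lemma global_rigid (P : SPolytope 4) (m : Pt → Pt) (hm : ∀ e ∈ edgeFinset P, RR m e = 0) :
    ∃ p, ∀ u ∈ P.V, m u = triv p u := by
  have hst : ∀ v ∈ P.V, ∃ p, ∀ u, BFace P {v, u} → m u = triv p u :=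
    fun v hv => star_triv P v hv m (fun e he => hm e (Ev_sub P v he))
  obtain ⟨v0, hv0⟩ : P.V.Nonempty := by
    rw [← card_pos]; have := V_card P; omega
  obtain ⟨p, hp⟩ := hst v0 hv0
  refine ⟨p, ?_⟩
  intro u hu
  have hpath := link_conn P ∅ (by simp) v0 u (vertex_face P v0 hv0) (vertex_face P u hu) (by simp) (by simp)
  have : ∀ w, BFace P {u, w} → m w = triv p w := by
    clear hu
    induction hpath with
    | refl => exact hp
    | @tail x y _ hxy ih =>
      obtain ⟨-, -, hne, hf⟩ := hxy
      have hxyf : BFace P {x, y} := hf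
      obtain ⟨q, hq⟩ := hst y (hxyf.1 (by simp))
      obtain ⟨t, ht, htf, htc⟩ := face_to_facet P _ hxyf
      have : p = q := by
        apply triv_inj (big_facet htf htc)
        intro w hw
        rw [← ih w (htf.mono (by
          intro a ha; simp only [mem_insert, mem_singleton] at ha
          rcases ha with rfl | rfl
          · exact ht (by simp)
          · exact hw)), ← hq w (htf.mono (by
          intro a ha; simp only [mem_insert, mem_singleton] at ha
          rcases ha with rfl | rfl
          · exact ht (by simp)
          · exact hw))]
      rw [this]; exact hq
  exact this u (by simpa using vertex_face P u hu)

/-- negation of a finset -/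
def ng (e : Finset Pt) : Finset Pt := e.image (fun x => -x)

lemma mem_ng {e : Finset Pt} {x : Pt} : x ∈ ng e ↔ -x ∈ e := by
  simp only [ng, mem_image]
  constructor
  · rintro ⟨a, ha, rfl⟩; simpa using ha
  · intro h; exact ⟨-x, h, by simp⟩
lemma ng_ng (e : Finset Pt) : ng (ng e) = e := by ext x; simp [mem_ng]
lemma ng_pair (x y : Pt) : ng {x, y} = {-x, -y} := by simp [ng, image_insert]
lemma ng_insert (x : Pt) (s : Finset Pt) : ng (insert x s) = insert (-x) (ng s) := by simp [ng, image_insert]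
lemma ng_inj {e e' : Finset Pt} (h : ng e = ng e') : e = e' := by rw [← ng_ng e, h, ng_ng]

lemma ng_face {P : SPolytope 4} (hcs : IsCS P) {s : Finset Pt} (h : BFace P s) : BFace P (ng s) := by
  obtain ⟨hs, hne, L, h0, h1⟩ := h.exf
  have hV : ng P.V = P.V := by
    ext x; rw [mem_ng]
    exact ⟨fun h => by simpa using hcs _ h, fun h => hcs _ h⟩
  apply Exf.bface
  refine ⟨?_, ?_, L ∘ₗ LinearMap.prodMap (-LinearMap.id) LinearMap.id, ?_, ?_⟩
  · intro x hx
    rw [mem_ng] at hx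
    simpa using hcs _ (hs hx)
  · intro h
    apply hne
    rw [← hV] at h
    exact ng_inj h
  · intro u hu
    exact h0 (-u) (mem_ng.1 hu)
  · intro u hu hus
    exact h1 (-u) (hcs u hu) (fun h => hus (mem_ng.2 h))

lemma no_antip {P : SPolytope 4} (hcs : IsCS P) {s : Finset Pt} (h : BFace P s) {u : Pt} (hu : u ∈ s) : -u ∉ s := by
  intro hu'
  obtain ⟨hs, hne, L, h0, h1⟩ := h.exf
  obtain ⟨w, hw, hws⟩ := Finset.exists_of_ssubset (lt_of_le_of_ne hs hne)
  have e : ∀ x : Pt, L (hat x) + L (hat (-x)) = 2 * L (0, 1) := by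
    intro x
    rw [L_hat, L_hat]
    have : L (-x, 0) = - L (x, 0) := by rw [← map_neg]; simp
    rw [this]; ring
  have e1 := e u
  rw [h0 u hu, h0 _ hu'] at e1
  have e2 := e w
  have h2 := h1 w hw hws
  have h3 : 0 ≤ L (hat (-w)) := by
    by_cases hh : -w ∈ s
    · rw [h0 _ hh]
    · exact (h1 _ (hcs w hw) hh).le
  linarith

lemma zero_notMem {P : SPolytope 4} (hcs : IsCS P) {u : Pt} (hu : u ∈ P.V) : u ≠ 0 := by
  rintro rfl
  exact no_antip hcs (vertex_face P 0 hu) (u := 0) (by simp) (by simp)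

lemma ne_neg {P : SPolytope 4} (hcs : IsCS P) {u : Pt} (hu : u ∈ P.V) : -u ≠ u := by
  intro h
  exact no_antip hcs (vertex_face P u hu) (u := u) (by simp) (by simp [h])

lemma Ed.ng {P : SPolytope 4} (hcs : IsCS P) {x y : Pt} (h : Ed P x y) : Ed P (-x) (-y) :=
  ⟨fun e => h.1 (neg_injective e), by rw [← ng_pair]; exact ng_face hcs h.2⟩

lemma Ed.nn {P : SPolytope 4} (hcs : IsCS P) {x y : Pt} (h : Ed P x y) : y ≠ -x := by
  rintro rfl
  exact no_antip hcs h.2 (u := x) (by simp) (by simp)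

lemma ng_E {P : SPolytope 4} (hcs : IsCS P) {e : Finset Pt} (h : e ∈ edgeFinset P) : ng e ∈ edgeFinset P := by
  obtain ⟨x, y, hxy, rfl⟩ := mem_E.1 h
  rw [ng_pair]; exact pair_E.2 (hxy.ng hcs)

lemma ng_ne {P : SPolytope 4} (hcs : IsCS P) {e : Finset Pt} (h : e ∈ edgeFinset P) : ng e ≠ e := by
  obtain ⟨x, y, hxy, rfl⟩ := mem_E.1 h
  intro he
  have : x ∈ ng {x, y} := by rw [he]; simp
  rw [mem_ng] at this
  exact no_antip hcs hxy.2 (u := x) (by simp) this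

lemma cardE {P : SPolytope 4} (hg2 : g2 P = 2) : (edgeFinset P).card + 8 = 4 * P.V.card := by
  have := V_card P
  unfold g2 f1 f0 at hg2
  norm_num [Nat.choose] at hg2
  omega

/-- a half of a set with respect to an involution -/
def half {α : Type} (σ : α → α) (S : Finset α) : Finset α := S.filter fun x => WellOrderingRel x (σ x)

lemma half_sbt {α : Type} (σ : α → α) (S : Finset α) : half σ S ⊆ S := filter_subset _ _

lemma half_not {α : Type} {σ : α → α} (h2 : ∀ x, σ (σ x) = x) {S T : Finset α} {x : α} (hx : x ∈ half σ S) : σ x ∉ half σ T := by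
  simp only [half, mem_filter] at *
  intro h
  rw [h2] at h
  exact asymm (r := WellOrderingRel) hx.2 h.2

lemma half_or {α : Type} {σ : α → α} (h2 : ∀ x, σ (σ x) = x) {S : Finset α} (hS : ∀ x ∈ S, σ x ∈ S)
    {x : α} (hne : σ x ≠ x) (hx : x ∈ S) : x ∈ half σ S ∨ σ x ∈ half σ S := by
  simp only [half, mem_filter]
  rcases trichotomous_of WellOrderingRel x (σ x) with h | h | h
  · exact Or.inl ⟨hx, h⟩
  · exact absurd h.symm hne
  · right; rw [h2]; exact ⟨hS x hx, h⟩

lemma half_card {α : Type} {σ : α → α} (h2 : ∀ x, σ (σ x) = x) {S : Finset α} (hS : ∀ x ∈ S, σ x ∈ S)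
    (hne : ∀ x ∈ S, σ x ≠ x) : S.card = 2 * (half σ S).card := by
  have hinj : Function.Injective σ := fun x y h => by rw [← h2 x, h, h2]
  have : S = half σ S ∪ (half σ S).image σ := by
    ext x
    simp only [mem_union, mem_image]
    constructor
    · intro hx
      rcases half_or h2 hS (hne x hx) hx with h | h
      · exact Or.inl h
      · exact Or.inr ⟨σ x, h, h2 x⟩
    · rintro (h | ⟨y, hy, rfl⟩)
      · exact half_sbt _ _ h
      · exact hS _ (half_sbt _ _ hy)
  have hd : Disjoint (half σ S) ((half σ S).image σ) := by
    rw [Finset.disjoint_left]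
    intro x hx hx2
    obtain ⟨y, hy, rfl⟩ := mem_image.1 hx2
    exact half_not h2 hy hx
  conv_lhs => rw [this]
  rw [card_union_of_disjoint hd, card_image_of_injective _ hinj]; ring

def EvenM (m : Pt → Pt) : Prop := ∀ u, m (-u) = m u

lemma RR_even {m : Pt → Pt} (h : EvenM m) (x y : Pt) : RR m {-x, -y} = - RR m {x, y} := by
  rw [RR_pair, RR_pair, h, h, ← dotProduct_neg]; congr 1; abel

lemma RR_evenE {P : SPolytope 4} {m : Pt → Pt} (h : EvenM m) {e : Finset Pt} (he : e ∈ edgeFinset P) :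
    RR m (ng e) = - RR m e := by
  obtain ⟨x, y, hxy, rfl⟩ := mem_E.1 he
  rw [ng_pair, RR_even h]

def nP : Pt → Pt := fun x => -x
lemma nP_nP (x : Pt) : nP (nP x) = x := neg_neg x

def evext (H : Finset Pt) : (H → Pt) →ₗ[ℝ] (Pt → Pt) where
  toFun m u := if h : u ∈ H then m ⟨u, h⟩ else if h : -u ∈ H then m ⟨-u, h⟩ else 0
  map_add' m m' := by ext1 u; by_cases h : u ∈ H <;> by_cases h' : -u ∈ H <;> simp [h, h']
  map_smul' r m := by ext1 u; by_cases h : u ∈ H <;> by_cases h' : -u ∈ H <;> simp [h, h']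

lemma evext_mem {H : Finset Pt} (m : H → Pt) {u : Pt} (h : u ∈ H) : evext H m u = m ⟨u, h⟩ := by
  simp [evext, h]

lemma evext_even (S : Finset Pt) (m : half nP S → Pt) : EvenM (evext (half nP S) m) := by
  intro u
  by_cases h : u ∈ half nP S
  · have h' : -u ∉ half nP S := half_not nP_nP h
    simp [evext, h, h']
  · by_cases h' : -u ∈ half nP S
    · simp [evext, h, h']
    · simp [evext, h, h']

/-- even functions with given values -/
lemma evext_eq {S : Finset Pt} (hS : ∀ x ∈ S, -x ∈ S) (hS0 : ∀ x ∈ S, -x ≠ x) {m : Pt → Pt} (hm : EvenM m) {u : Pt}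
    (hu : u ∈ S) : evext (half nP S) (restr _ m) u = m u := by
  rcases half_or (σ := nP) nP_nP hS (hS0 u hu) hu with h | h
  · rw [evext_mem _ h]; rfl
  · have : evext (half nP S) (restr _ m) (-u) = m (-u) := by
      have h' : -u ∈ half nP S := h
      rw [evext_mem _ h']; rfl
    rw [evext_even, hm] at this
    exact this

theorem even_surj {P : SPolytope 4} (hcs : IsCS P) (hg2 : g2 P = 2) (r : Finset Pt → ℝ)
    (hr : ∀ e ∈ edgeFinset P, r (ng e) = - r e) :
    ∃ m, EvenM m ∧ ∀ e ∈ edgeFinset P, RR m e = r e := by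
  set H := half nP P.V with hH
  set Γ := half ng (edgeFinset P) with hΓ
  have cH : P.V.card = 2 * H.card := half_card nP_nP (fun x hx => hcs x hx) (fun x hx => ne_neg hcs hx)
  have cΓ : (edgeFinset P).card = 2 * Γ.card := half_card ng_ng (fun x hx => ng_E hcs hx) (fun x hx => ng_ne hcs hx)
  have cE := cardE hg2
  let F : (H → Pt) →ₗ[ℝ] (Γ → ℝ) := RL Γ ∘ₗ evext H
  let cst : Pt →ₗ[ℝ] (H → Pt) := { toFun := fun b _ => b, map_add' := fun _ _ => rfl, map_smul' := fun _ _ => rfl }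
  have hext : ∀ m : H → Pt, ∀ e ∈ edgeFinset P, e ∈ Γ ∨ (ng e ∈ Γ) := by
    intro m e he
    exact half_or ng_ng (fun x hx => ng_E hcs hx) (ng_ne hcs he) he
  have hker : LinearMap.ker F ≤ LinearMap.range cst := by
    intro m hm
    have hE : ∀ e ∈ edgeFinset P, RR (evext H m) e = 0 := by
      intro e he
      rcases hext m e he with h | h
      · exact congrFun hm ⟨e, h⟩
      · have h1 : RR (evext H m) (ng e) = 0 := congrFun hm ⟨_, h⟩
        rw [RR_evenE (evext_even _ m) he] at h1
        linarith
    obtain ⟨p, hp⟩ := global_rigid P _ hE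
    refine ⟨p.2, ?_⟩
    ext1 u
    have hu : u.1 ∈ P.V := half_sbt _ _ u.2
    have e1 := hp u.1 hu
    have e2 := hp _ (hcs u.1 hu)
    rw [evext_even, e1, triv_apply, triv_apply, sk_neg] at e2
    have : sk p.1 u.1 = 0 := by
      have h2 : sk p.1 u.1 = - sk p.1 u.1 := add_right_cancel e2
      exact self_eq_neg.1 h2
    rw [evext_mem _ u.2, triv_apply, this, zero_add] at e1
    exact e1.symm
  have h1 := Submodule.finrank_mono hker
  have h2 := LinearMap.finrank_range_le cst
  rw [Module.finrank_fin_fun] at h2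
  have h3 := LinearMap.finrank_range_add_finrank_ker F
  rw [finrank_UPt] at h3
  have h4 := Submodule.finrank_le (LinearMap.range F)
  rw [finrank_G] at h4
  have htop : LinearMap.range F = ⊤ := by
    apply Submodule.eq_top_of_finrank_eq
    rw [finrank_G]; omega
  obtain ⟨m, hm⟩ := LinearMap.range_eq_top.1 htop (fun e => r e.1)
  refine ⟨evext H m, evext_even _ m, ?_⟩
  intro e he
  rcases hext m e he with h | h
  · exact congrFun hm ⟨e, h⟩
  · have h1 : RR (evext H m) (ng e) = r (ng e) := congrFun hm ⟨_, h⟩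
    rw [RR_evenE (evext_even _ m) he, hr e he] at h1
    linarith

theorem stress_symm {P : SPolytope 4} (hcs : IsCS P) (hg2 : g2 P = 2) {s : Finset Pt → ℝ}
    (hs : Strs (edgeFinset P) s) (e : Finset Pt) : s (ng e) = s e := by
  obtain ⟨m, -, hm⟩ := even_surj hcs hg2 (fun e => s e - s (ng e)) (by
    intro e _
    simp only [ng_ng]; ring)
  have h1 := hs.2 m
  rw [Finset.sum_congr rfl (fun e he => by rw [hm e he])] at h1
  have h2 : ∑ e ∈ edgeFinset P, s (ng e) * (s (ng e) - s e) = 0 := by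
    rw [← h1]
    refine Finset.sum_nbij' ng ng (fun e he => ng_E hcs he) (fun e he => ng_E hcs he) (fun e _ => ng_ng e)
      (fun e _ => ng_ng e) ?_
    intro e _
    rw [ng_ng]
  have h3 : ∑ e ∈ edgeFinset P, (s e - s (ng e)) ^ 2 = 0 := by
    have h4 : ∑ e ∈ edgeFinset P, (s e - s (ng e)) ^ 2 = ∑ e ∈ edgeFinset P, s e * (s e - s (ng e))
        + ∑ e ∈ edgeFinset P, s (ng e) * (s (ng e) - s e) := by
      rw [← Finset.sum_add_distrib]
      apply Finset.sum_congr rfl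
      intro e _
      ring
    rw [h4, h1, h2, add_zero]
  by_cases he : e ∈ edgeFinset P
  · rw [Finset.sum_eq_zero_iff_of_nonneg (fun _ _ => sq_nonneg _)] at h3
    have := h3 e he
    have := pow_eq_zero_iff (two_ne_zero) |>.1 this
    linarith
  · rw [hs.1 e he, hs.1]
    intro h
    apply he
    rw [← ng_ng e]; exact ng_E hcs h

theorem even_sparse {P : SPolytope 4} (hcs : IsCS P) (hg2 : g2 P = 2) {Γ : Finset (Finset Pt)} {U : Finset Pt}
    (hΓ : Γ ⊆ edgeFinset P) (hn : ∀ e ∈ Γ, ng e ∈ Γ) (hU : U ⊆ P.V) (hUn : ∀ x ∈ U, -x ∈ U) (hU0 : U.Nonempty)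
    (hE : IsEdgeLike U Γ) : Γ.card + 8 ≤ 4 * U.card := by
  set H := half nP U with hH
  set G := half ng Γ with hG
  have cH : U.card = 2 * H.card := half_card nP_nP (fun x hx => hUn x hx) (fun x hx => ne_neg hcs (hU hx))
  have cΓ : Γ.card = 2 * G.card := half_card ng_ng (fun x hx => hn x hx) (fun x hx => ng_ne hcs (hΓ hx))
  let F : (H → Pt) →ₗ[ℝ] (G → ℝ) := RL G ∘ₗ evext H
  let cst : Pt →ₗ[ℝ] (H → Pt) := { toFun := fun b _ => b, map_add' := fun _ _ => rfl, map_smul' := fun _ _ => rfl }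
  have hHne : H.card ≠ 0 := by
    have := card_pos.2 hU0
    omega
  obtain ⟨u0, hu0⟩ := card_pos.1 (Nat.pos_of_ne_zero hHne)
  have hval : ∀ m : Pt → Pt, EvenM m → ∀ e ∈ Γ, RR (evext H (restr _ m)) e = RR m e := by
    intro m hm e he
    apply RR_congr
    intro u hu
    obtain ⟨x, hx, y, hy, hxy, rfl⟩ := hE e he
    have : u ∈ U := by
      simp only [mem_insert, mem_singleton] at hu
      rcases hu with rfl | rfl <;> assumption
    exact evext_eq hUn (fun x hx => ne_neg hcs (hU hx)) hm this
  have hker : LinearMap.range cst ≤ LinearMap.ker F := by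
    rintro _ ⟨b, rfl⟩
    ext e
    have heG := half_sbt _ _ e.2
    obtain ⟨x, hx, y, hy, hxy, he⟩ := hE e.1 heG
    have := hval (fun _ => b) (fun _ => rfl) e.1 heG
    show RR (evext H (cst b)) e.1 = 0
    have h2 : RR (fun _ => b) e.1 = 0 := by rw [he, RR_pair]; simp
    rw [← h2, ← this]; rfl
  have h1 := Submodule.finrank_mono hker
  have h2 : Module.finrank ℝ (LinearMap.range cst) = 4 := by
    rw [LinearMap.finrank_range_of_inj, Module.finrank_fin_fun]
    intro p q hpq
    exact congrFun hpq ⟨u0, hu0⟩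
  have h3 := LinearMap.finrank_range_add_finrank_ker F
  rw [finrank_UPt] at h3
  have htop : LinearMap.range F = ⊤ := by
    rw [LinearMap.range_eq_top]
    intro y
    obtain ⟨m, hme, hm⟩ := even_surj hcs hg2
      (fun e => if h : e ∈ G then y ⟨e, h⟩ else if h : ng e ∈ G then - y ⟨ng e, h⟩ else 0) (by
        intro e _
        by_cases h : e ∈ G
        · have h' : ng e ∉ G := half_not ng_ng h
          simp [h, h', ng_ng]
        · by_cases h' : ng e ∈ G
          · simp [h, h', ng_ng]
          · simp [h, h', ng_ng])
    refine ⟨restr _ m, ?_⟩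
    ext e
    have heG := half_sbt _ _ e.2
    show RR (evext H (restr H m)) e.1 = y e
    rw [hval m hme e.1 heG, hm e.1 (hΓ heG)]
    simp [e.2]
  rw [htop, finrank_top, finrank_G] at h3
  omega

/-- a nonzero stress exists -/
theorem exists_stress_G {P : SPolytope 4} (hg2 : g2 P = 2) : ∃ s, Strs (edgeFinset P) s ∧ ∃ e ∈ edgeFinset P, s e ≠ 0 := by
  by_contra hcon
  push Not at hcon
  have cE := cardE hg2
  obtain ⟨v0, hv0⟩ : P.V.Nonempty := by
    rw [← card_pos]; have := V_card P; omega
  obtain ⟨t, -, ht, htc⟩ := face_to_facet P _ (vertex_face P v0 hv0)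
  have := count_upper P.V (edgeFinset P) ((big_facet ht htc).mono ht.1) (by
    intro e he
    obtain ⟨x, y, hxy, rfl⟩ := mem_E.1 he
    exact ⟨x, hxy.mem1, y, hxy.mem2, hxy.1, rfl⟩) hcon
  omega

lemma face_Ed {P : SPolytope 4} {s : Finset Pt} (h : BFace P s) {x y : Pt} (hx : x ∈ s) (hy : y ∈ s) (hne : x ≠ y) :
    Ed P x y := ⟨hne, h.mono (by
      intro a ha; simp only [mem_insert, mem_singleton] at ha
      rcases ha with rfl | rfl <;> assumption)⟩

theorem step3 {P : SPolytope 4} (hcs : IsCS P) (hg2 : g2 P = 2) {v w x : Pt} (hvw : Ed P v w)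
    (hnw : ¬ Ed P v (-w)) (hvx : Ed P v x) (hwx : Ed P w x) : BFace P {v, w, x} := by
  by_contra hnf
  have hE : {w, x} ∈ edgeFinset P := pair_E.2 hwx
  have hne := ng_ne hcs hE
  obtain ⟨m, -, hm⟩ := even_surj hcs hg2 (fun e => if e = {w, x} then 1 else if ng e = {w, x} then -1 else 0) (by
    intro e _
    by_cases h1 : e = {w, x}
    · subst h1
      simp [ng_ng, hne]
    · by_cases h2 : ng e = {w, x}
      · simp [h1, h2]
      · simp [h1, h2, ng_ng])
  obtain ⟨p, hp⟩ := star_triv P v hvw.mem1 m (by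
    intro e he
    rw [hm e (Ev_sub P v he)]
    have h1 : e ≠ {w, x} := by
      rintro rfl
      exact hnf (pair_Ev.1 he).2
    have h2 : ng e ≠ {w, x} := by
      intro h
      have : e = {-w, -x} := by rw [← ng_ng e, h, ng_pair]
      subst this
      have hf := (pair_Ev.1 he).2
      refine hnw (face_Ed hf (by simp) (by simp) ?_)
      intro h
      exact hvw.symm.nn hcs h
    simp [h1, h2])
  have h1 := hm _ hE
  rw [RR_congr (m' := triv p), RR_triv] at h1
  · simp at h1
  · intro u hu
    simp only [mem_insert, mem_singleton] at hu
    rcases hu with rfl | rfl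
    · exact hp _ hvw.2
    · exact hp _ hvx.2

def Av (P : SPolytope 4) (v : Pt) : Finset Pt := P.V.filter fun u => Ed P v u ∧ Ed P v (-u)
def Lv (P : SPolytope 4) (v : Pt) : Finset (Finset Pt) := (Ev P v).filter fun e => ng e ∈ Ev P v

lemma mem_Av {P : SPolytope 4} {v u : Pt} : u ∈ Av P v ↔ Ed P v u ∧ Ed P v (-u) := by
  simp only [Av, mem_filter]
  exact ⟨fun h => h.2, fun h => ⟨h.1.mem2, h⟩⟩

lemma Av_neg {P : SPolytope 4} {v u : Pt} (h : u ∈ Av P v) : -u ∈ Av P v := by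
  rw [mem_Av] at *
  rw [neg_neg]; exact ⟨h.2, h.1⟩

lemma Av_V {P : SPolytope 4} {v u : Pt} (h : u ∈ Av P v) : u ∈ P.V := (mem_Av.1 h).1.mem2

lemma Lv_neg {P : SPolytope 4} {v : Pt} {e} (h : e ∈ Lv P v) : ng e ∈ Lv P v := by
  simp only [Lv, mem_filter] at *
  rw [ng_ng]; exact ⟨h.2, h.1⟩

lemma Lv_E {P : SPolytope 4} {v : Pt} {e} (h : e ∈ Lv P v) : e ∈ edgeFinset P :=
  Ev_sub P v (mem_filter.1 h).1

lemma Lv_pair {P : SPolytope 4} (hcs : IsCS P) {v x y : Pt} (h : {x, y} ∈ Lv P v) : x ∈ Av P v := by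
  have h1 := (pair_Ev.1 (mem_filter.1 h).1).2
  have h2 := (mem_filter.1 h).2
  rw [ng_pair] at h2
  have h2 := (pair_Ev.1 h2).2
  rw [mem_Av]
  constructor
  · refine face_Ed h1 (by simp) (by simp) ?_
    rintro rfl
    exact no_antip hcs h2 (u := v) (by simp) (by simp)
  · refine face_Ed h2 (by simp) (by simp) ?_
    rintro rfl
    exact no_antip hcs h1 (u := -x) (by simp) (by simp)

lemma Lv_edge {P : SPolytope 4} (hcs : IsCS P) {v : Pt} {e} (h : e ∈ Lv P v) :
    ∃ x ∈ Av P v, ∃ y ∈ Av P v, x ≠ y ∧ y ≠ -x ∧ e = {x, y} := by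
  obtain ⟨x, y, hxy, rfl⟩ := mem_E.1 (Lv_E h)
  refine ⟨x, Lv_pair hcs h, y, Lv_pair hcs (y := x) (by rw [pair_comm]; exact h), hxy.1, hxy.nn hcs, rfl⟩

theorem lemmaT {P : SPolytope 4} (hcs : IsCS P) (hg2 : g2 P = 2) {v : Pt} (hv : v ∈ P.V) (d : Pt → Pt)
    (hodd : ∀ x ∈ Av P v, d (-x) = - d x) (hd : ∀ e ∈ Lv P v, RR d e = 0) :
    ∃ c, ∀ x ∈ Av P v, d x = sk c x := by
  let m0 : Pt → Pt := fun u => if u ∈ Av P v then d u else 0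
  have hm0 : ∀ e ∈ Lv P v, RR m0 e = 0 := by
    intro e he
    rw [← hd e he]
    apply RR_congr
    intro u hu
    obtain ⟨x, hx, y, hy, -, -, rfl⟩ := Lv_edge hcs he
    simp only [mem_insert, mem_singleton] at hu
    rcases hu with rfl | rfl
    · simp [m0, hx]
    · simp [m0, hy]
  obtain ⟨m, hme, hm⟩ := even_surj hcs hg2 (fun e => if e ∈ Ev P v then RR m0 e else if ng e ∈ Ev P v then - RR m0 (ng e) else 0) (by
    intro e _
    by_cases h1 : e ∈ Ev P v
    · by_cases h2 : ng e ∈ Ev P v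
      · have hL : e ∈ Lv P v := mem_filter.2 ⟨h1, h2⟩
        simp [h1, h2, hm0 _ hL, hm0 _ (Lv_neg hL)]
      · simp [h1, h2, ng_ng]
    · by_cases h2 : ng e ∈ Ev P v
      · simp [h1, h2]
      · simp [h1, h2, ng_ng])
  obtain ⟨p, hp⟩ := star_triv P v hv (m0 - m) (by
    intro e he
    rw [RR_sub, hm e (Ev_sub P v he)]
    simp [he])
  refine ⟨p.1, ?_⟩
  intro x hx
  have h1 := hp x (mem_Av.1 hx).1.2
  have h2 := hp (-x) (mem_Av.1 hx).2.2
  have hx' := Av_neg hx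
  simp only [Pi.sub_apply, m0, hx, hx', if_true, triv_apply, hme x, hodd x hx, sk_neg] at h1 h2
  have h3 : (2 : ℝ) • d x = (2 : ℝ) • sk p.1 x := by
    rw [two_smul, two_smul]
    calc d x + d x = (d x - m x) - (- d x - m x) := by abel
      _ = _ := by rw [h1, h2]; abel
  exact smul_right_injective _ (two_ne_zero' ℝ) h3

/-- the suspension of the antipodal part of the link -/
def Xv (P : SPolytope 4) (v : Pt) : Finset Pt := Av P v ∪ {v, -v}
def GX (P : SPolytope 4) (v : Pt) : Finset (Finset Pt) :=
  Lv P v ∪ ((Av P v).image (fun a => {v, a}) ∪ (Av P v).image (fun a => {-v, a}))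

lemma Av_ne {P : SPolytope 4} (hcs : IsCS P) {v u : Pt} (h : u ∈ Av P v) : u ≠ v ∧ u ≠ -v := by
  rw [mem_Av] at h
  exact ⟨h.1.1.symm, h.1.nn hcs⟩

lemma GX_card {P : SPolytope 4} (hcs : IsCS P) {v : Pt} (hv : v ∈ P.V) : (GX P v).card = (Lv P v).card + 2 * (Av P v).card := by
  unfold GX
  have hvv := ne_neg hcs hv
  rw [card_union_of_disjoint, card_union_of_disjoint, card_image_of_injOn, card_image_of_injOn]
  · ring
  · intro a ha b hb hab
    have : a ∈ ({-v, b} : Finset Pt) := by rw [← (show ({-v, a} : Finset Pt) = {-v, b} from hab)]; simp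
    simp only [mem_insert, mem_singleton] at this
    exact this.resolve_left (Av_ne hcs ha).2
  · intro a ha b hb hab
    have : a ∈ ({v, b} : Finset Pt) := by rw [← (show ({v, a} : Finset Pt) = {v, b} from hab)]; simp
    simp only [mem_insert, mem_singleton] at this
    exact this.resolve_left (Av_ne hcs ha).1
  · rw [Finset.disjoint_left]
    intro e h1 h2
    obtain ⟨a, ha, rfl⟩ := mem_image.1 h1
    obtain ⟨b, hb, hab⟩ := mem_image.1 h2
    have : v ∈ ({-v, b} : Finset Pt) := by rw [hab]; simp
    simp only [mem_insert, mem_singleton] at this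
    rcases this with h | h
    · exact hvv h.symm
    · exact (Av_ne hcs hb).1 h.symm
  · rw [Finset.disjoint_left]
    intro e h1 h2
    obtain ⟨x, hx, y, hy, -, -, rfl⟩ := Lv_edge hcs h1
    rcases mem_union.1 h2 with h | h
    · obtain ⟨b, hb, hab⟩ := mem_image.1 h
      have : v ∈ ({x, y} : Finset Pt) := by rw [← hab]; simp
      simp only [mem_insert, mem_singleton] at this
      rcases this with h | h
      · exact (Av_ne hcs hx).1 h.symm
      · exact (Av_ne hcs hy).1 h.symm
    · obtain ⟨b, hb, hab⟩ := mem_image.1 h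
      have : -v ∈ ({x, y} : Finset Pt) := by rw [← hab]; simp
      simp only [mem_insert, mem_singleton] at this
      rcases this with h | h
      · exact (Av_ne hcs hx).2 h.symm
      · exact (Av_ne hcs hy).2 h.symm

lemma Xv_card {P : SPolytope 4} (hcs : IsCS P) {v : Pt} (hv : v ∈ P.V) : (Xv P v).card = (Av P v).card + 2 := by
  unfold Xv
  rw [card_union_of_disjoint, card_pair (ne_neg hcs hv).symm]
  rw [Finset.disjoint_left]
  intro x hx hx2
  simp only [mem_insert, mem_singleton] at hx2
  rcases hx2 with h | h
  · exact (Av_ne hcs hx).1 h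
  · exact (Av_ne hcs hx).2 h

lemma Xv_V {P : SPolytope 4} (hcs : IsCS P) {v : Pt} (hv : v ∈ P.V) : Xv P v ⊆ P.V := by
  intro x hx
  simp only [Xv, mem_union, mem_insert, mem_singleton] at hx
  rcases hx with h | rfl | rfl
  · exact Av_V h
  · exact hv
  · exact hcs _ hv

lemma Xv_neg {P : SPolytope 4} {v x : Pt} (hx : x ∈ Xv P v) : -x ∈ Xv P v := by
  simp only [Xv, mem_union, mem_insert, mem_singleton] at *
  rcases hx with h | rfl | rfl
  · exact Or.inl (Av_neg h)
  · simp
  · simp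

lemma GX_E {P : SPolytope 4} (hcs : IsCS P) {v : Pt} : GX P v ⊆ edgeFinset P := by
  intro e he
  simp only [GX, mem_union, mem_image] at he
  rcases he with h | ⟨a, ha, rfl⟩ | ⟨a, ha, rfl⟩
  · exact Lv_E h
  · exact pair_E.2 (mem_Av.1 ha).1
  · have := (mem_Av.1 ha).2.ng hcs
    rw [neg_neg] at this
    exact pair_E.2 this

lemma GX_neg {P : SPolytope 4} {v : Pt} {e} (he : e ∈ GX P v) : ng e ∈ GX P v := by
  simp only [GX, mem_union, mem_image] at *
  rcases he with h | ⟨a, ha, rfl⟩ | ⟨a, ha, rfl⟩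
  · exact Or.inl (Lv_neg h)
  · exact Or.inr (Or.inr ⟨-a, Av_neg ha, by rw [ng_pair]⟩)
  · exact Or.inr (Or.inl ⟨-a, Av_neg ha, by rw [ng_pair, neg_neg]⟩)

lemma GX_edge {P : SPolytope 4} (hcs : IsCS P) {v : Pt} : IsEdgeLike (Xv P v) (GX P v) := by
  intro e he
  simp only [GX, mem_union, mem_image] at he
  rcases he with h | ⟨a, ha, rfl⟩ | ⟨a, ha, rfl⟩
  · obtain ⟨x, hx, y, hy, hxy, -, rfl⟩ := Lv_edge hcs h
    exact ⟨x, mem_union_left _ hx, y, mem_union_left _ hy, hxy, rfl⟩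
  · exact ⟨v, by simp [Xv], a, mem_union_left _ ha, (Av_ne hcs ha).1.symm, rfl⟩
  · exact ⟨-v, by simp [Xv], a, mem_union_left _ ha, (Av_ne hcs ha).2.symm, rfl⟩

lemma Lv_card_le {P : SPolytope 4} (hcs : IsCS P) (hg2 : g2 P = 2) {v : Pt} (hv : v ∈ P.V) :
    (Lv P v).card ≤ 2 * (Av P v).card := by
  have := even_sparse hcs hg2 (GX_E hcs) (fun e he => GX_neg he) (Xv_V hcs hv) (fun x hx => Xv_neg hx)
    ⟨v, by simp [Xv]⟩ (GX_edge hcs)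
  rw [GX_card hcs hv, Xv_card hcs hv] at this
  omega

/-- odd extension -/
def oddext (H : Finset Pt) : (H → Pt) →ₗ[ℝ] (Pt → Pt) where
  toFun m u := if h : u ∈ H then m ⟨u, h⟩ else if h : -u ∈ H then - m ⟨-u, h⟩ else 0
  map_add' m m' := by ext1 u; by_cases h : u ∈ H <;> by_cases h' : -u ∈ H <;> simp [h, h', add_comm]
  map_smul' r m := by ext1 u; by_cases h : u ∈ H <;> by_cases h' : -u ∈ H <;> simp [h, h']

lemma oddext_mem {H : Finset Pt} (m : H → Pt) {u : Pt} (h : u ∈ H) : oddext H m u = m ⟨u, h⟩ := by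
  simp [oddext, h]

lemma oddext_odd (S : Finset Pt) (m : half nP S → Pt) (u : Pt) : oddext (half nP S) m (-u) = - oddext (half nP S) m u := by
  by_cases h : u ∈ half nP S
  · have h' : -u ∉ half nP S := half_not nP_nP h
    simp [oddext, h, h']
  · by_cases h' : -u ∈ half nP S
    · simp [oddext, h, h']
    · simp [oddext, h, h']

lemma RR_odd {m : Pt → Pt} (h : ∀ u, m (-u) = - m u) (x y : Pt) : RR m {-x, -y} = RR m {x, y} := by
  rw [RR_pair, RR_pair, h, h, ← neg_sub', ← neg_sub', neg_dotProduct, dotProduct_neg, neg_neg]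

lemma Av_card {P : SPolytope 4} (hcs : IsCS P) {v : Pt} : (Av P v).card = 2 * (half nP (Av P v)).card :=
  half_card nP_nP (fun x hx => Av_neg hx) (fun x hx => ne_neg hcs (Av_V hx))

lemma Lv_card_ge {P : SPolytope 4} (hcs : IsCS P) (hg2 : g2 P = 2) {v : Pt} (hv : v ∈ P.V) :
    4 * (Av P v).card ≤ 12 + (Lv P v).card := by
  set H := half nP (Av P v) with hH
  set G := half ng (Lv P v) with hG
  have cH : (Av P v).card = 2 * H.card := Av_card hcs
  have cΓ : (Lv P v).card = 2 * G.card := half_card ng_ng (fun x hx => Lv_neg hx) (fun x hx => ng_ne hcs (Lv_E hx))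
  let F : (H → Pt) →ₗ[ℝ] (G → ℝ) := RL G ∘ₗ oddext H
  let sL : (Fin 6 → ℝ) →ₗ[ℝ] (H → Pt) := LinearMap.pi fun u => skL.flip u.1
  have hker : LinearMap.ker F ≤ LinearMap.range sL := by
    intro m hm
    obtain ⟨c, hc⟩ := lemmaT hcs hg2 hv (oddext H m) (fun x _ => oddext_odd _ m x) (by
      intro e he
      rcases half_or ng_ng (fun x hx => Lv_neg hx) (ng_ne hcs (Lv_E he)) he with h | h
      · exact congrFun hm ⟨e, h⟩
      · have h1 : RR (oddext H m) (ng e) = 0 := congrFun hm ⟨_, h⟩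
        obtain ⟨x, hx, y, hy, hxy, -, rfl⟩ := Lv_edge hcs he
        rwa [ng_pair, RR_odd (fun u => oddext_odd _ m u)] at h1)
    refine ⟨c, ?_⟩
    ext1 u
    have := hc u.1 (half_sbt _ _ u.2)
    rw [oddext_mem m u.2] at this
    exact this.symm
  have h1 := Submodule.finrank_mono hker
  have h2 := LinearMap.finrank_range_le sL
  rw [Module.finrank_fin_fun] at h2
  have h3 := LinearMap.finrank_range_add_finrank_ker F
  rw [finrank_UPt] at h3
  have h4 := Submodule.finrank_le (LinearMap.range F)
  rw [finrank_G] at h4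
  omega

lemma face_fun {P : SPolytope 4} (hcs : IsCS P) {s : Finset Pt} (h : BFace P s) (hne : s.Nonempty) :
    ∃ f : Pt →ₗ[ℝ] ℝ, (∀ u ∈ s, f u = 1) ∧ ∀ u ∈ P.V, u ∉ s → f u < 1 := by
  obtain ⟨hsV, -, L, h0, h1⟩ := h.exf
  obtain ⟨u, hu⟩ := hne
  have hc : 0 < L (0, 1) := by
    have e1 := h0 u hu
    have e2 := h1 (-u) (hcs u (hsV hu)) (no_antip hcs h hu)
    rw [L_hat] at e1 e2
    have e3 : L (-u, 0) = - L (u, 0) := by rw [← map_neg]; simp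
    linarith
  refine ⟨(-(L (0, 1))⁻¹) • (L ∘ₗ LinearMap.inl ℝ Pt ℝ), ?_, ?_⟩
  · intro w hw
    have e1 := h0 w hw
    rw [L_hat] at e1
    simp only [LinearMap.smul_apply, LinearMap.comp_apply, LinearMap.inl_apply, smul_eq_mul]
    have : L (w, 0) = - L (0, 1) := by linarith
    rw [this]; field_simp
  · intro w hw hws
    have e1 := h1 w hw hws
    rw [L_hat] at e1
    simp only [LinearMap.smul_apply, LinearMap.comp_apply, LinearMap.inl_apply, smul_eq_mul]
    rw [neg_mul, inv_mul_eq_div, neg_lt, lt_div_iff₀ hc]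
    linarith

lemma abs_lt_one {P : SPolytope 4} (hcs : IsCS P) {s : Finset Pt} {f : Pt →ₗ[ℝ] ℝ}
    (h1 : ∀ u ∈ P.V, u ∉ s → f u < 1) {z : Pt} (hz : z ∈ P.V) (hzs : z ∉ s) (hzs' : -z ∉ s) : |f z| < 1 := by
  have e1 := h1 z hz hzs
  have e2 := h1 (-z) (hcs z hz) hzs'
  rw [map_neg] at e2
  rw [abs_lt]; constructor <;> linarith

lemma coll {P : SPolytope 4} (hcs : IsCS P) {u w : Pt} (hu : u ∈ P.V) (hw : w ∈ P.V) {t : ℝ} (h : w = t • u) :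
    w = u ∨ w = -u := by
  by_contra hcon
  push Not at hcon
  obtain ⟨f, f1, f2⟩ := face_fun hcs (vertex_face P u hu) (by simp)
  obtain ⟨g, g1, g2⟩ := face_fun hcs (vertex_face P w hw) (by simp)
  have a1 := abs_lt_one hcs f2 hw (by simpa using hcon.1) (by rw [mem_singleton, neg_eq_iff_eq_neg]; exact hcon.2)
  have a2 := abs_lt_one hcs g2 hu (by simpa using hcon.1.symm) (by rw [mem_singleton]; exact hcon.2 ∘ Eq.symm)
  have b1 := f1 u (by simp)
  have b2 := g1 w (by simp)
  rw [h, map_smul, b1] at a1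
  rw [h, map_smul] at b2
  simp only [smul_eq_mul, mul_one] at a1 b2
  have : |t| * |g u| < 1 := by nlinarith [abs_nonneg t, abs_nonneg (g u)]
  rw [← abs_mul, b2] at this
  simp at this

lemma notcoll {P : SPolytope 4} (hcs : IsCS P) {x y z : Pt} (hz : z ∈ P.V) (h1 : Ed P x y) (h2 : Ed P x (-y))
    (hzx : z ≠ x) (hzx' : z ≠ -x) (hzy : z ≠ y) (hzy' : z ≠ -y) {α β : ℝ} (h : z = α • x + β • y) : False := by
  have k (a b : Pt) : -a = b ↔ a = -b := neg_eq_iff_eq_neg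
  obtain ⟨f, f1, f2⟩ := face_fun hcs h1.2 (by simp)
  obtain ⟨g, g1, g2⟩ := face_fun hcs h2.2 (by simp)
  obtain ⟨l, l1, l2⟩ := face_fun hcs (vertex_face P z hz) (by simp)
  have a1 := abs_lt_one hcs f2 hz (by simp; tauto) (by simp [k]; tauto)
  have a2 := abs_lt_one hcs g2 hz (by simp; tauto) (by simp [k]; tauto)
  have a3 := abs_lt_one hcs l2 h1.mem1 (by simp; tauto) (by simp only [mem_singleton]; tauto)
  have a4 := abs_lt_one hcs l2 h1.mem2 (by simp; tauto) (by simp only [mem_singleton]; tauto)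
  have b := l1 z (by simp)
  rw [h] at a1 a2 b
  have c1 := f1 x (by simp)
  have c2 := f1 y (by simp)
  have c3 := g1 x (by simp)
  have c4 := g1 (-y) (by simp)
  rw [map_neg] at c4
  have c5 : g y = -1 := by linarith
  simp only [map_add, map_smul, smul_eq_mul, c1, c2, c3, c5] at a1 a2 b
  have e1 : |α * l x| ≤ |α| := by rw [abs_mul]; nlinarith [abs_nonneg α]
  have e2 : |β * l y| ≤ |β| := by rw [abs_mul]; nlinarith [abs_nonneg β]
  have e3 := le_abs_self (α * l x)
  have e4 := le_abs_self (β * l y)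
  rw [abs_lt] at a1 a2
  rcases abs_cases α with h | h <;> rcases abs_cases β with h' | h' <;> linarith

lemma Av_k_ne1 {P : SPolytope 4} (hcs : IsCS P) (hg2 : g2 P = 2) {v : Pt} (hv : v ∈ P.V) :
    (half nP (Av P v)).card ≠ 1 := by
  intro h
  obtain ⟨x, hx⟩ := Finset.card_eq_one.1 h
  have hA : ∀ a ∈ Av P v, a = x ∨ a = -x := by
    intro a ha
    have := half_or (σ := nP) nP_nP (S := Av P v) (fun x hx => Av_neg hx) (x := a) (ne_neg hcs (Av_V ha)) ha
    rw [hx] at this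
    simp only [mem_singleton, nP] at this
    rcases this with h | h
    · exact Or.inl h
    · right; rw [← h, neg_neg]
  have hxA : x ∈ Av P v := half_sbt nP _ (by rw [hx]; simp)
  obtain ⟨c, hc⟩ := lemmaT hcs hg2 hv id (fun _ _ => rfl) (by
    intro e he
    obtain ⟨a, ha, b, hb, h1, h2, -⟩ := Lv_edge hcs he
    exfalso
    rcases hA a ha with rfl | rfl <;> rcases hA b hb with rfl | rfl <;> simp_all)
  have := sk_self c x
  rw [← hc x hxA, id] at this
  exact zero_notMem hcs (Av_V hxA) (dotProduct_self_eq_zero.1 this)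

lemma Av_k_ne2 {P : SPolytope 4} (hcs : IsCS P) (hg2 : g2 P = 2) {v : Pt} (hv : v ∈ P.V) :
    (half nP (Av P v)).card ≠ 2 := by
  intro h
  obtain ⟨x, y, hxy, hx⟩ := Finset.card_eq_two.1 h
  have hA : ∀ a ∈ Av P v, (a = x ∨ a = -x) ∨ (a = y ∨ a = -y) := by
    intro a ha
    have := half_or (σ := nP) nP_nP (S := Av P v) (fun x hx => Av_neg hx) (x := a) (ne_neg hcs (Av_V ha)) ha
    rw [hx] at this
    simp only [mem_singleton, mem_insert, nP, neg_eq_iff_eq_neg] at this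
    tauto
  have hxh : x ∈ half nP (Av P v) := by rw [hx]; simp
  have hyh : y ∈ half nP (Av P v) := by rw [hx]; simp
  have hxA : x ∈ Av P v := half_sbt nP _ hxh
  have hyA : y ∈ Av P v := half_sbt nP _ hyh
  have hxy' : x ≠ -y := by
    intro e
    have := half_not (σ := nP) nP_nP (T := Av P v) hyh
    rw [nP, ← e] at this
    exact this hxh
  set p := x ⬝ᵥ x with hp
  set q := y ⬝ᵥ y with hq
  set r := x ⬝ᵥ y with hr
  have hr' : y ⬝ᵥ x = r := dotProduct_comm _ _
  set F : Pt := q • x - r • y with hF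
  set G : Pt := p • y - r • x with hG
  have Fx : F ⬝ᵥ x = p * q - r * r := by
    rw [hF]; simp only [sub_dotProduct, smul_dotProduct, smul_eq_mul, hr', ← hp]; ring
  have Fy : F ⬝ᵥ y = 0 := by
    rw [hF]; simp only [sub_dotProduct, smul_dotProduct, smul_eq_mul, ← hq, ← hr]; ring
  have Gx : G ⬝ᵥ x = 0 := by
    rw [hG]; simp only [sub_dotProduct, smul_dotProduct, smul_eq_mul, hr', ← hp]; ring
  have Gy : G ⬝ᵥ y = p * q - r * r := by
    rw [hG]; simp only [sub_dotProduct, smul_dotProduct, smul_eq_mul, ← hq, ← hr] <;> ring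
  let d : Pt → Pt := fun u => (F ⬝ᵥ u) • F - (G ⬝ᵥ u) • G
  have key : ∀ a b, RR d {a, b} = (F ⬝ᵥ (a - b))^2 - (G ⬝ᵥ (a-b))^2 := by
    intro a b
    rw [RR_pair]
    simp only [d, sub_dotProduct, smul_dotProduct, smul_eq_mul, dotProduct_sub]; ring
  obtain ⟨c, hc⟩ := lemmaT hcs hg2 hv d (fun u _ => by simp only [d, dotProduct_neg, neg_smul]; abel) (by
    intro e he
    obtain ⟨a, ha, b, hb, h1, h2, rfl⟩ := Lv_edge hcs he
    rw [key]
    rcases hA a ha with (h | h) | (h | h) <;> rcases hA b hb with (h' | h') | (h' | h') <;> subst h <;> subst h' <;>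
      first
      | (exfalso; simp at h1 h2; done)
      | (simp only [dotProduct_sub, dotProduct_neg, Fx, Fy, Gx, Gy]; ring))
  have h1 := sk_self c x
  rw [← hc x hxA] at h1
  simp only [d, sub_dotProduct, smul_dotProduct, smul_eq_mul, Fx, Gx] at h1
  have hD : p * q - r * r = 0 := by nlinarith
  have hFF : F = 0 := by
    apply dotProduct_self_eq_zero.1
    nth_rewrite 2 [hF]
    rw [dotProduct_sub, dotProduct_smul, dotProduct_smul, Fx, Fy, hD]; simp
  have hq0 : q ≠ 0 := fun h => zero_notMem hcs (Av_V hyA) (dotProduct_self_eq_zero.1 h)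
  have : x = (r / q) • y := by
    have e : q • x = r • y := sub_eq_zero.1 hFF
    rw [div_eq_inv_mul, mul_smul, ← e, smul_smul, inv_mul_cancel₀ hq0, one_smul]
  rcases coll hcs (Av_V hyA) (Av_V hxA) this with h | h
  · exact hxy h
  · exact hxy' h

theorem Av_dich {P : SPolytope 4} (hcs : IsCS P) (hg2 : g2 P = 2) {v : Pt} (hv : v ∈ P.V) :
    Av P v = ∅ ∨ ((Av P v).card = 6 ∧ (Lv P v).card = 12) := by
  have h1 := Lv_card_le hcs hg2 hv
  have h2 := Lv_card_ge hcs hg2 hv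
  have h3 := Av_card hcs (v := v)
  have h4 := Av_k_ne1 hcs hg2 hv
  have h5 := Av_k_ne2 hcs hg2 hv
  by_cases h : (Av P v).card = 0
  · left; exact Finset.card_eq_zero.1 h
  · right; omega

structure Oct (P : SPolytope 4) (v x y z : Pt) : Prop where
  mem : ∀ a, a ∈ Av P v ↔ a = x ∨ a = -x ∨ a = y ∨ a = -y ∨ a = z ∨ a = -z
  xy : x ≠ y
  xy' : x ≠ -y
  xz : x ≠ z
  xz' : x ≠ -z
  yz : y ≠ z
  yz' : y ≠ -z
  lv : ∀ a ∈ Av P v, ∀ b ∈ Av P v, a ≠ b → a ≠ -b → {a, b} ∈ Lv P v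

theorem exists_oct {P : SPolytope 4} (hcs : IsCS P) {v : Pt} (h6 : (Av P v).card = 6)
    (h12 : (Lv P v).card = 12) : ∃ x y z, Oct P v x y z := by
  have h3 : (half nP (Av P v)).card = 3 := by have := Av_card hcs (v := v); omega
  obtain ⟨x, y, z, hxy, hxz, hyz, hx⟩ := Finset.card_eq_three.1 h3
  have hxh : x ∈ half nP (Av P v) := by rw [hx]; simp
  have hyh : y ∈ half nP (Av P v) := by rw [hx]; simp
  have hzh : z ∈ half nP (Av P v) := by rw [hx]; simp
  have hxA : x ∈ Av P v := half_sbt nP _ hxh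
  have hyA : y ∈ Av P v := half_sbt nP _ hyh
  have hzA : z ∈ Av P v := half_sbt nP _ hzh
  have hn : ∀ {a b : Pt}, a ∈ half nP (Av P v) → b ∈ half nP (Av P v) → a ≠ -b := by
    intro a b ha hb e
    have := half_not (σ := nP) nP_nP (T := Av P v) hb
    rw [nP, ← e] at this
    exact this ha
  refine ⟨x, y, z, ?_, hxy, hn hxh hyh, hxz, hn hxh hzh, hyz, hn hyh hzh, ?_⟩
  · intro a
    constructor
    · intro ha
      have := half_or (σ := nP) nP_nP (S := Av P v) (fun x hx => Av_neg hx) (x := a) (ne_neg hcs (Av_V ha)) ha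
      rw [hx] at this
      simp only [mem_singleton, mem_insert, nP, neg_eq_iff_eq_neg] at this
      tauto
    · rintro (rfl | rfl | rfl | rfl | rfl | rfl)
      all_goals first | assumption | exact Av_neg (by assumption)
  · have hT : ((half nP (Av P v)).image fun a => ({a, -a} : Finset Pt)).card = 3 := by
      rw [Finset.card_image_of_injOn, h3]
      intro a ha b hb hab
      simp only at hab
      have : a ∈ ({b, -b} : Finset Pt) := by rw [← hab]; simp
      simp only [mem_insert, mem_singleton] at this
      rcases this with h | h
      · exact h
      · exact absurd h (hn ha hb)
    set T := (half nP (Av P v)).image fun a => ({a, -a} : Finset Pt)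
    have hdis : Disjoint (Lv P v) T := by
      rw [Finset.disjoint_left]
      intro e he heT
      obtain ⟨a, ha, rfl⟩ := Finset.mem_image.1 heT
      exact (pair_E.1 (Lv_E he)).nn hcs rfl
    have hsub : Lv P v ∪ T ⊆ (Av P v).powersetCard 2 := by
      intro e he
      rw [mem_union] at he
      rw [mem_powersetCard]
      rcases he with he | he
      · obtain ⟨a, ha, b, hb, h1, h2, rfl⟩ := Lv_edge hcs he
        exact ⟨by intro t; simp only [mem_insert, mem_singleton]; rintro (rfl | rfl) <;> assumption, Finset.card_pair h1⟩
      · obtain ⟨a, ha, rfl⟩ := Finset.mem_image.1 he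
        have ha := half_sbt nP _ ha
        exact ⟨by intro t; simp only [mem_insert, mem_singleton]; rintro (rfl | rfl); exact ha; exact Av_neg ha,
          Finset.card_pair (ne_neg hcs (Av_V ha)).symm⟩
    have heq := Finset.eq_of_subset_of_card_le hsub (by
      rw [Finset.card_powersetCard, h6, Finset.card_union_of_disjoint hdis, h12, hT]; decide)
    intro a ha b hb h1 h2
    have : ({a, b} : Finset Pt) ∈ (Av P v).powersetCard 2 := by
      rw [mem_powersetCard]
      exact ⟨by intro t; simp only [mem_insert, mem_singleton]; rintro (rfl | rfl) <;> assumption, Finset.card_pair h1⟩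
    rw [← heq, mem_union] at this
    rcases this with h | h
    · exact h
    · exfalso
      obtain ⟨c, hc, e⟩ := Finset.mem_image.1 h
      have ha' : a ∈ ({c, -c} : Finset Pt) := by rw [e]; simp
      have hb' : b ∈ ({c, -c} : Finset Pt) := by rw [e]; simp
      simp only [mem_insert, mem_singleton] at ha' hb'
      rcases ha' with rfl | rfl <;> rcases hb' with rfl | rfl <;> simp_all

section
variable {P : SPolytope 4} {v x y z : Pt}

lemma Oct.s (h : Oct P v x y z) : Oct P v y x z :=
  ⟨fun a => by rw [h.mem]; tauto, h.xy.symm, fun e => h.xy' (by rw [e, neg_neg]), h.yz, h.yz', h.xz, h.xz', h.lv⟩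

lemma Oct.r (h : Oct P v x y z) : Oct P v x z y :=
  ⟨fun a => by rw [h.mem]; tauto, h.xz, h.xz', h.xy, h.xy', h.yz.symm, fun e => h.yz' (by rw [e, neg_neg]), h.lv⟩

lemma Oct.n (h : Oct P v x y z) : Oct P v (-x) y z :=
  ⟨fun a => by rw [h.mem, neg_neg]; tauto, fun e => h.xy' (by rw [← e, neg_neg]), fun e => h.xy (neg_inj.1 e),
    fun e => h.xz' (by rw [← e, neg_neg]), fun e => h.xz (neg_inj.1 e), h.yz, h.yz', h.lv⟩

lemma Oct.n2 (h : Oct P v x y z) : Oct P v x (-y) z := h.s.n.s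

lemma Oct.mx (h : Oct P v x y z) : x ∈ Av P v := (h.mem x).2 (by simp)
lemma Oct.my (h : Oct P v x y z) : y ∈ Av P v := (h.mem y).2 (by simp)
lemma Oct.mz (h : Oct P v x y z) : z ∈ Av P v := (h.mem z).2 (by simp)

lemma Oct.third (h : Oct P v x y z) {a b : Pt} (ha : a ∈ Av P v) (hb : b ∈ Av P v) (h1 : a ≠ b) (h2 : b ≠ -a) :
    ∃ c, Oct P v a b c := by
  rw [h.mem] at ha hb
  have hh := h.r
  have h3 := h.s.r
  rcases ha with rfl | rfl | rfl | rfl | rfl | rfl <;> rcases hb with rfl | rfl | rfl | rfl | rfl | rfl <;>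
    first
    | (exfalso; simp at h1 h2; done)
    | exact ⟨_, h⟩
    | exact ⟨_, h.n⟩
    | exact ⟨_, h.n2⟩
    | exact ⟨_, h.n.n2⟩
    | exact ⟨_, h.s⟩
    | exact ⟨_, h.s.n⟩
    | exact ⟨_, h.s.n2⟩
    | exact ⟨_, h.s.n.n2⟩
    | exact ⟨_, hh⟩
    | exact ⟨_, hh.n⟩
    | exact ⟨_, hh.n2⟩
    | exact ⟨_, hh.n.n2⟩
    | exact ⟨_, hh.s⟩
    | exact ⟨_, hh.s.n⟩
    | exact ⟨_, hh.s.n2⟩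
    | exact ⟨_, hh.s.n.n2⟩
    | exact ⟨_, h3⟩
    | exact ⟨_, h3.n⟩
    | exact ⟨_, h3.n2⟩
    | exact ⟨_, h3.n.n2⟩
    | exact ⟨_, h3.s⟩
    | exact ⟨_, h3.s.n⟩
    | exact ⟨_, h3.s.n2⟩
    | exact ⟨_, h3.s.n.n2⟩

lemma Oct.ed (h : Oct P v x y z) : Ed P x y :=
  pair_E.1 (Lv_E (h.lv x h.mx y h.my h.xy h.xy'))

lemma Oct.nospan (hcs : IsCS P) (h : Oct P v x y z) {α β : ℝ} (e : z = α • x + β • y) : False :=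
  notcoll hcs (Av_V h.mz) h.ed h.n2.ed h.xz.symm (fun e => h.xz' (by rw [e, neg_neg])) h.yz.symm
    (fun e => h.yz' (by rw [e, neg_neg])) e

lemma Oct.coef (hcs : IsCS P) (h : Oct P v x y z) {a b c : ℝ} (e : a • x + b • y + c • z = 0) : c = 0 := by
  by_contra hc
  refine h.nospan hcs (α := -(c⁻¹ * a)) (β := -(c⁻¹ * b)) ?_
  have e1 : c⁻¹ • (a • x + b • y + c • z) = 0 := by rw [e, smul_zero]
  rw [smul_add, smul_add, smul_smul, smul_smul, smul_smul, inv_mul_cancel₀ hc, one_smul] at e1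
  rw [neg_smul, neg_smul, ← sub_eq_zero, ← e1]; abel

lemma Oct.li (hcs : IsCS P) (h : Oct P v x y z) : LinearIndependent ℝ ![x, y, z] := by
  rw [Fintype.linearIndependent_iff]
  intro g hg
  rw [Fin.sum_univ_three] at hg
  simp only [Matrix.cons_val_zero, Matrix.cons_val_one, Matrix.cons_val] at hg
  have h0 : g 2 = 0 := h.coef hcs hg
  have h1 : g 1 = 0 := h.r.coef hcs (a := g 0) (b := g 2) (by rw [← hg]; abel)
  have h2 : g 0 = 0 := h.s.r.coef hcs (a := g 1) (b := g 2) (by rw [← hg]; abel)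
  intro i; fin_cases i <;> assumption

lemma Oct.det (hcs : IsCS P) (h : Oct P v x y z) : ∃ q, DD x y z q ≠ 0 := by
  obtain ⟨q, hq⟩ := exists_linearIndependent_snoc_of_lt_finrank (h.li hcs) (by simp)
  refine ⟨q, ?_⟩
  rw [← DD_det]
  have e : (Fin.snoc ![x, y, z] q : Fin 4 → Pt) = ![x, y, z, q] := by
    ext i; fin_cases i <;> rfl
  rw [e] at hq
  have := (Matrix.linearIndependent_rows_iff_isUnit (A := Matrix.of ![x, y, z, q])).1 hq
  exact ((Matrix.isUnit_iff_isUnit_det _).1 this).ne_zero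

lemma Oct.dual (hcs : IsCS P) (h : Oct P v x y z) (a b c : ℝ) : ∃ p : Pt, p ⬝ᵥ x = a ∧ p ⬝ᵥ y = b ∧ p ⬝ᵥ z = c := by
  obtain ⟨q, hq⟩ := h.det hcs
  set M := Matrix.of ![x, y, z, q] with hM
  have hdet : IsUnit M.det := by rw [hM, DD_det]; exact hq.isUnit
  have : M.mulVec (M⁻¹.mulVec ![a, b, c, 0]) = ![a, b, c, 0] := by
    rw [Matrix.mulVec_mulVec, Matrix.mul_nonsing_inv _ hdet, Matrix.one_mulVec]
  refine ⟨M⁻¹.mulVec ![a, b, c, 0], ?_, ?_, ?_⟩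
  · rw [dotProduct_comm]; exact congrFun this 0
  · rw [dotProduct_comm]; exact congrFun this 1
  · rw [dotProduct_comm]; exact congrFun this 2

lemma Oct.big (hcs : IsCS P) (h : Oct P v x y z) : Big (Xv P v) := by
  obtain ⟨q, hq⟩ := h.det hcs
  have k : ∀ a ∈ Av P v, a ∈ Xv P v := fun a ha => mem_union_left _ ha
  refine ⟨-x, k _ (Av_neg h.mx), x, k _ h.mx, y, k _ h.my, z, k _ h.mz, q, ?_⟩
  have : DD (x - -x) (y - -x) (z - -x) q = 2 * DD x y z q := by
    unfold DD; simp only [Pi.sub_apply, Pi.neg_apply]; ring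
  rw [this]; positivity

lemma Oct.edge0 (hcs : IsCS P) (hg2 : g2 P = 2) (h : Oct P v x y z) {s : Finset Pt → ℝ}
    (hs : Strs (edgeFinset P) s) (hsup : ∀ e, e ∉ Lv P v → s e = 0) : s {x, y} = 0 := by
  obtain ⟨p, px, py, pz⟩ := h.dual hcs 1 (-1) 0
  obtain ⟨C, Cx, Cy, Cz⟩ := h.dual hcs 0 0 1
  let m : Pt → Pt := fun u => (p ⬝ᵥ u) • p - (C ⬝ᵥ u) • C
  have key : ∀ a b, RR m {a, b} = (p ⬝ᵥ (a - b))^2 - (C ⬝ᵥ (a-b))^2 := by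
    intro a b
    rw [RR_pair]
    simp only [m, sub_dotProduct, smul_dotProduct, smul_eq_mul, dotProduct_sub]; ring
  have hxyE : {x, y} ∈ edgeFinset P := pair_E.2 h.ed
  have hne := ng_ne hcs hxyE
  have hsym := stress_symm hcs hg2 hs {x, y}
  have h0 := hs.2 m
  rw [← Finset.sum_subset (s₁ := {({x, y} : Finset Pt), ng {x, y}})] at h0
  · rw [Finset.sum_pair hne.symm, hsym, ng_pair, key, key] at h0
    simp only [dotProduct_sub, dotProduct_neg, px, py, Cx, Cy] at h0
    norm_num at h0
    linarith
  · intro e he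
    rw [mem_insert, mem_singleton] at he
    rcases he with rfl | rfl
    · exact hxyE
    · exact ng_E hcs hxyE
  · intro e _ hne
    by_cases he : e ∈ Lv P v
    · obtain ⟨a, ha, b, hb, h1, h2, rfl⟩ := Lv_edge hcs he
      rw [ng_pair] at hne
      rw [key]
      rw [h.mem] at ha hb
      have sw1 : ({y, x} : Finset Pt) = {x, y} := Finset.pair_comm _ _
      have sw2 : ({-y, -x} : Finset Pt) = {-x, -y} := Finset.pair_comm _ _
      rcases ha with rfl | rfl | rfl | rfl | rfl | rfl <;> rcases hb with rfl | rfl | rfl | rfl | rfl | rfl <;>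
        first
        | (exfalso; simp at h1 h2; done)
        | (exfalso; rw [mem_insert, mem_singleton] at hne; first | exact hne (Or.inl rfl) | exact hne (Or.inr rfl) | exact hne (Or.inl sw1) | exact hne (Or.inr sw2))
        | (simp only [dotProduct_sub, dotProduct_neg, px, py, pz, Cx, Cy, Cz]; ring)
    · rw [hsup e he, zero_mul]

end

section
variable {P : SPolytope 4}

lemma Oct.zero (hcs : IsCS P) (hg2 : g2 P = 2) {v x y z : Pt} (h : Oct P v x y z) {s : Finset Pt → ℝ}
    (hs : Strs (edgeFinset P) s) (hsup : ∀ e, e ∉ Lv P v → s e = 0) (e : Finset Pt) : s e = 0 := by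
  by_cases he : e ∈ Lv P v
  · obtain ⟨a, ha, b, hb, h1, h2, rfl⟩ := Lv_edge hcs he
    obtain ⟨c, hc⟩ := h.third ha hb h1 h2
    exact hc.edge0 hcs hg2 hs hsup
  · exact hsup e he

theorem stress_GX (hcs : IsCS P) (hg2 : g2 P = 2) {v : Pt} (hv : v ∈ P.V) (h6 : (Av P v).card = 6)
    (h12 : (Lv P v).card = 12) {s : Finset Pt → ℝ} (hs : Strs (edgeFinset P) s) :
    ∀ e, e ∉ GX P v → s e = 0 := by
  obtain ⟨x, y, z, ho⟩ := exists_oct hcs h6 h12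
  have hcX := Xv_card hcs hv
  have hcG := GX_card hcs hv
  have hcE := cardE hg2
  have hr := rank_upper _ _ (ho.big hcs) (GX_edge hcs)
  set X := Xv P v with hX
  set Γ := GX P v with hΓ
  set Δ := edgeFinset P \ Γ with hΔ
  have hΔc : Δ.card + 24 = (edgeFinset P).card := by
    rw [hΔ, Finset.card_sdiff_of_subset (GX_E hcs), ← hΓ]
    have := Finset.card_le_card (GX_E hcs (v := v))
    rw [← hΓ] at this
    omega
  have hXm : ∀ e ∈ Γ, ∀ u ∈ e, u ∈ X := by
    intro e he u hu
    obtain ⟨a, ha, b, hb, -, rfl⟩ := GX_edge hcs e he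
    simp only [mem_insert, mem_singleton] at hu
    rcases hu with rfl | rfl <;> assumption
  have hfac : FF P.V Γ = FF X Γ ∘ₗ (restr X ∘ₗ ext0 P.V) := by
    refine LinearMap.ext fun m => ?_
    ext e
    show RR (ext0 P.V m) e.1 = RR (ext0 X (restr X (ext0 P.V m))) e.1
    apply RR_congr
    intro u hu
    rw [ext0_mem _ (hXm e.1 e.2 u hu)]
    rfl
  have hr1 : Module.finrank ℝ (LinearMap.range (FF P.V Γ)) ≤ 22 := by
    have : LinearMap.range (FF P.V Γ) ≤ LinearMap.range (FF X Γ) := by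
      rw [hfac]; exact LinearMap.range_comp_le_range _ _
    have := Submodule.finrank_mono this
    omega
  set K := LinearMap.ker (FF P.V Γ) with hK
  have hKf := LinearMap.finrank_range_add_finrank_ker (FF P.V Γ)
  rw [finrank_UPt, ← hK] at hKf
  let T := (FF P.V Δ).domRestrict K
  have hTf := LinearMap.finrank_range_add_finrank_ker T
  have hker : Module.finrank ℝ (LinearMap.ker T) ≤ 10 := by
    have e1 : (LinearMap.ker T).map K.subtype ≤ LinearMap.range (restr P.V ∘ₗ triv) := by
      rintro _ ⟨m, hm, rfl⟩
      obtain ⟨p, hp⟩ := global_rigid P (ext0 P.V m.1) (by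
        intro e he
        by_cases heΓ : e ∈ Γ
        · exact congrFun (LinearMap.mem_ker.1 m.2) ⟨e, heΓ⟩
        · have : e ∈ Δ := mem_sdiff.2 ⟨he, heΓ⟩
          exact congrFun (LinearMap.mem_ker.1 hm) ⟨e, this⟩)
      refine ⟨p, ?_⟩
      ext1 u
      have := hp u.1 u.2
      rw [ext0_mem _ u.2] at this
      exact this.symm
    have e2 := Submodule.finrank_mono e1
    rw [Submodule.finrank_map_subtype_eq] at e2
    have e3 := LinearMap.finrank_range_le (restr P.V ∘ₗ triv)
    rw [finrank_triv] at e3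
    omega
  have hsurj : LinearMap.range T = ⊤ := by
    apply Submodule.eq_top_of_finrank_eq
    have := Submodule.finrank_le (LinearMap.range T)
    rw [finrank_G] at this ⊢
    omega
  obtain ⟨m, hm⟩ := LinearMap.range_eq_top.1 hsurj (fun e => s e.1)
  have h0 := hs.2 (ext0 P.V m.1)
  have h1 : ∀ e ∈ Γ, RR (ext0 P.V m.1) e = 0 := fun e he => congrFun (LinearMap.mem_ker.1 m.2) ⟨e, he⟩
  have h2 : ∀ e ∈ Δ, RR (ext0 P.V m.1) e = s e := fun e he => congrFun hm ⟨e, he⟩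
  rw [← Finset.sum_sdiff (GX_E hcs (v := v)), ← hΓ, ← hΔ, Finset.sum_eq_zero (s := Γ) (fun e he => by rw [h1 e he, mul_zero]),
    add_zero, Finset.sum_congr rfl (fun e he => by rw [h2 e he])] at h0
  rw [Finset.sum_eq_zero_iff_of_nonneg (fun e _ => mul_self_nonneg _)] at h0
  intro e he
  by_cases heE : e ∈ edgeFinset P
  · have := h0 e (mem_sdiff.2 ⟨heE, he⟩)
    exact mul_self_eq_zero.1 this
  · exact hs.1 e heE

/-- a stress vanishing on edges at v and -v is zero, if Av has 6 elements -/
lemma stress_zero_of (hcs : IsCS P) (hg2 : g2 P = 2) {v : Pt} (hv : v ∈ P.V) (h6 : (Av P v).card = 6)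
    (h12 : (Lv P v).card = 12) {s : Finset Pt → ℝ} (hs : Strs (edgeFinset P) s)
    (h0 : ∀ e, v ∈ e ∨ -v ∈ e → s e = 0) (e : Finset Pt) : s e = 0 := by
  obtain ⟨x, y, z, ho⟩ := exists_oct hcs h6 h12
  refine ho.zero hcs hg2 hs ?_ e
  intro e he
  by_cases heG : e ∈ GX P v
  · apply h0
    unfold GX at heG
    simp only [mem_union, mem_image] at heG
    rcases heG with h | ⟨a, -, rfl⟩ | ⟨a, -, rfl⟩
    · exact absurd h he
    · simp
    · simp
  · exact stress_GX hcs hg2 hv h6 h12 hs e heG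

theorem cross_of_all (hcs : IsCS P) (hg2 : g2 P = 2)
    (hall : ∀ v ∈ P.V, (Av P v).card = 6 ∧ (Lv P v).card = 12) : IsCrossPolytope P := by
  obtain ⟨v, hv⟩ : P.V.Nonempty := Finset.card_pos.1 (by have := V_card P; omega)
  obtain ⟨x, y, z, ho⟩ := exists_oct hcs (hall v hv).1 (hall v hv).2
  have hVX : P.V ⊆ Xv P v := by
    intro u hu
    by_contra huX
    obtain ⟨s, hs, e, he, hne⟩ := exists_stress_G hg2
    apply hne
    apply stress_zero_of hcs hg2 hu (hall u hu).1 (hall u hu).2 hs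
    intro e' h
    apply stress_GX hcs hg2 hv (hall v hv).1 (hall v hv).2 hs
    intro heG
    obtain ⟨a, ha, b, hb, -, rfl⟩ := GX_edge hcs e' heG
    have k : ∀ t ∈ ({a, b} : Finset Pt), t ∈ Xv P v := by
      intro t ht
      simp only [mem_insert, mem_singleton] at ht
      rcases ht with rfl | rfl <;> assumption
    rcases h with h | h
    · exact huX (k _ h)
    · have := Xv_neg (k _ h)
      rw [neg_neg] at this
      exact huX this
  have hV : ∀ u, u ∈ P.V ↔ (u = v ∨ u = x ∨ u = y ∨ u = z) ∨ (u = -v ∨ u = -x ∨ u = -y ∨ u = -z) := by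
    intro u
    constructor
    · intro hu
      have := hVX hu
      simp only [Xv, mem_union, ho.mem, mem_insert, mem_singleton] at this
      tauto
    · intro h
      apply Xv_V hcs hv
      simp only [Xv, mem_union, ho.mem, mem_insert, mem_singleton]
      tauto
  have hVr : (P.V : Set Pt) = Set.range ![v, x, y, z] ∪ Set.range (fun i => -(![v, x, y, z] i)) := by
    ext u
    simp only [Finset.mem_coe, hV, Set.mem_union, Set.mem_range, Fin.exists_fin_succ, Matrix.cons_val_zero, Matrix.cons_val_succ, IsEmpty.exists_iff, or_false, eq_comm (b := u)]
  refine ⟨![v, x, y, z], ?_, hVr⟩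
  apply linearIndependent_of_top_le_span_of_card_eq_finrank
  · rw [top_le_iff]
    by_contra hne
    obtain ⟨f, hf, hf2⟩ := Submodule.exists_le_ker_of_lt_top _ (lt_top_iff_ne_top.2 hne)
    apply hf
    have hfr : ∀ i, f (![v, x, y, z] i) = 0 := fun i => hf2 (Submodule.subset_span ⟨i, rfl⟩)
    have := L_zero P (f ∘ₗ LinearMap.fst ℝ Pt ℝ) (by
      intro u hu
      show f u = 0
      have : u ∈ (P.V : Set Pt) := hu
      rw [hVr] at this
      rcases this with ⟨i, rfl⟩ | ⟨i, rfl⟩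
      · exact hfr i
      · simp only [map_neg, hfr i, neg_zero])
    refine LinearMap.ext fun w => ?_
    simpa using LinearMap.congr_fun this (w, 0)
  · simp

end

section
variable {P : SPolytope 4}

lemma prime4 (hp : IsPrimePoly P) {a b c d : Pt} (hab : a ≠ b) (hac : a ≠ c) (had : a ≠ d) (hbc : b ≠ c)
    (hbd : b ≠ d) (hcd : c ≠ d) (h1 : BFace P {a, b, c}) (h2 : BFace P {a, b, d}) (h3 : BFace P {a, c, d})
    (h4 : BFace P {b, c, d}) : BFace P {a, b, c, d} := by
  by_contra hcon
  apply hp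
  refine ⟨{a, b, c, d}, ⟨?_, hcon, ?_⟩, ?_⟩
  · intro t ht
    simp only [mem_insert, mem_singleton] at ht
    rcases ht with rfl | rfl | rfl | rfl
    · exact h1.1 (by simp)
    · exact h1.1 (by simp)
    · exact h1.1 (by simp)
    · exact h2.1 (by simp)
  · intro τ hτ
    obtain ⟨e, he, heτ⟩ := Finset.exists_of_ssubset hτ
    have hs : ∀ t ∈ τ, t ≠ e ∧ (t = a ∨ t = b ∨ t = c ∨ t = d) := by
      intro t ht
      refine ⟨fun h => heτ (h ▸ ht), ?_⟩
      simpa using hτ.1 ht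
    simp only [mem_insert, mem_singleton] at he
    rcases he with rfl | rfl | rfl | rfl
    · exact h4.mono (by intro t ht; rcases (hs t ht).2 with h | h | h | h <;> first | exact absurd h (hs t ht).1 | simp [h])
    · exact h3.mono (by intro t ht; rcases (hs t ht).2 with h | h | h | h <;> first | exact absurd h (hs t ht).1 | simp [h])
    · exact h2.mono (by intro t ht; rcases (hs t ht).2 with h | h | h | h <;> first | exact absurd h (hs t ht).1 | simp [h])
    · exact h1.mono (by intro t ht; rcases (hs t ht).2 with h | h | h | h <;> first | exact absurd h (hs t ht).1 | simp [h])
  · rw [card_insert_of_notMem, card_insert_of_notMem, card_pair hcd] <;> simp [*]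

lemma simplex_all (S : Finset Pt) (hc : S.card = 5) (h : ∀ a ∈ S, BFace P (S.erase a)) : P.V ⊆ S := by
  intro u hu
  by_contra huS
  obtain ⟨a, ha⟩ : S.Nonempty := Finset.card_pos.1 (by omega)
  have hca : (S.erase a).card = 4 := by rw [card_erase_of_mem ha, hc]
  obtain ⟨b, hb⟩ : (S.erase a).Nonempty := Finset.card_pos.1 (by omega)
  have hcb : ((S.erase a).erase b).card = 3 := by rw [card_erase_of_mem hb, hca]
  have hba : b ≠ a := (mem_erase.1 hb).1
  have hbS : b ∈ S := (mem_erase.1 hb).2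
  set τ := (S.erase a).erase b with hτ
  have hτf : BFace P τ := (h a ha).mono (erase_subset _ _)
  have fb : BFace P (insert b τ) := by rw [hτ, insert_erase hb]; exact h a ha
  have fa : BFace P (insert a τ) := by
    rw [hτ, erase_right_comm, insert_erase (mem_erase.2 ⟨hba.symm, ha⟩)]; exact h b hbS
  have hτS : τ ⊆ S := (erase_subset _ _).trans (erase_subset _ _)
  obtain ⟨α, μ, -, hμ1, hμ⟩ := cone_lemma P τ hτf hcb.le u hu
  have hμS : ∀ s, μ s ≠ 0 → s ∈ S := by
    intro s hs
    by_contra hsS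
    obtain ⟨-, h1, h2⟩ := hμ1 s hs
    exact wall_le P τ hcb a b s (by simp [hτ]) (by simp [hτ]) h1 fa fb h2 hba.symm
      (fun e => hsS (e ▸ ha)) (fun e => hsS (e ▸ hbS))
  obtain ⟨g, hg⟩ : ∃ g : Pt → ℝ, hat u = ∑ s ∈ S, g s • hat s := by
    refine ⟨fun s => (if s ∈ τ then α s else 0) + μ s, ?_⟩
    have hSV : S ⊆ P.V := by
      intro t ht
      by_cases hta : t = a
      · subst hta; exact (h b hbS).1 (mem_erase.2 ⟨hba.symm, ht⟩)
      · exact (h a ha).1 (mem_erase.2 ⟨hta, ht⟩)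
    rw [hμ]
    simp only [add_smul, sum_add_distrib]
    congr 1
    · rw [← Finset.sum_subset hτS]
      · exact Finset.sum_congr rfl (fun t ht => by rw [if_pos ht])
      · intro t _ ht; rw [if_neg ht, zero_smul]
    · symm
      apply Finset.sum_subset hSV
      intro t _ ht
      have : μ t = 0 := by by_contra hne; exact ht (hμS t hne)
      rw [this, zero_smul]
  have hpos : ∀ s ∈ S, 0 < g s := by
    intro s hs
    obtain ⟨-, -, L, h0, h1⟩ := (h s hs).exf
    have e1 := h1 u hu (fun hh => huS (mem_erase.1 hh).2)
    rw [hg, map_sum, Finset.sum_eq_single s] at e1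
    · rw [map_smul, smul_eq_mul] at e1
      have hsV : s ∈ P.V := by
        by_cases hsa : s = a
        · subst hsa; exact fa.1 (by simp)
        · exact (h a ha).1 (mem_erase.2 ⟨hsa, hs⟩)
      exact pos_of_mul_pos_left e1 (h1 s hsV (by simp)).le
    · intro t ht hts
      rw [map_smul, h0 t (mem_erase.2 ⟨hts, ht⟩), smul_zero]
    · intro hh; exact absurd hs hh
  obtain ⟨-, -, L, h0, h1⟩ := (vertex_face P u hu).exf
  have e := h0 u (by simp)
  rw [hg, map_sum] at e
  have hp : 0 < ∑ s ∈ S, L (g s • hat s) := by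
    apply Finset.sum_pos _ ⟨a, ha⟩
    intro s hs
    rw [map_smul, smul_eq_mul]
    have hsV : s ∈ P.V := by
      by_cases hsa : s = a
      · subst hsa; exact fa.1 (by simp)
      · exact (h a ha).1 (mem_erase.2 ⟨hsa, hs⟩)
    exact mul_pos (hpos s hs) (h1 s hsV (by rw [mem_singleton]; rintro rfl; exact huS hs))
  linarith

lemma Ev_mem {v : Pt} {e : Finset Pt} (he : e ∈ Ev P v) {u : Pt} (hu : u ∈ e) : u = v ∨ Ed P v u := by
  by_cases h : u = v
  · exact Or.inl h
  · right
    exact face_Ed (mem_filter.1 he).2 (mem_insert_self _ _) (mem_insert_of_mem hu) (Ne.symm h)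

lemma Strs.up {Γ Δ : Finset (Finset Pt)} (h : Γ ⊆ Δ) {s : Finset Pt → ℝ} (hs : Strs Γ s) : Strs Δ s := by
  refine ⟨fun e he => hs.1 e (fun h' => he (h h')), fun m => ?_⟩
  rw [← hs.2 m]
  symm
  apply Finset.sum_subset h
  intro e _ he
  rw [hs.1 e he, zero_mul]

lemma notEd_neg {v w : Pt} (h : Av P v = ∅) (hw : Ed P v w) : ¬ Ed P v (-w) := by
  intro h'
  have : w ∈ Av P v := mem_Av.2 ⟨hw, h'⟩
  rw [h] at this
  simp at this

lemma half_stress (hcs : IsCS P) (hg2 : g2 P = 2) {v w : Pt} (hvw : Ed P v w) (hv : Av P v = ∅) (hw : Av P w = ∅)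
    {s : Finset Pt → ℝ} (hs : Strs (Ev P v ∪ Ev P w) s) {e : Finset Pt} (he : e ∈ Ev P v) : s e = 0 := by
  have hsE : Strs (edgeFinset P) s := hs.up (union_subset (Ev_sub P v) (Ev_sub P w))
  have hsym := stress_symm hcs hg2 hsE
  have hmem : ∀ e, s e ≠ 0 → e ∈ Ev P v ∨ e ∈ Ev P w := by
    intro e hne
    by_contra hcon
    exact hne (hs.1 e (by rw [mem_union]; exact hcon))
  have hvx : ∀ e, s e ≠ 0 → ∀ u ∈ e, u = v ∨ u = w ∨ Ed P v u ∨ Ed P w u := by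
    intro e hne u hu
    rcases hmem e hne with h | h
    · rcases Ev_mem h hu with h | h <;> tauto
    · rcases Ev_mem h hu with h | h <;> tauto
  have nv : ¬ Ed P v (-w) := notEd_neg hv hvw
  have nw : ¬ Ed P w (-v) := notEd_neg hw hvw.symm
  have hnn : ∀ e, s e ≠ 0 → ∀ u ∈ e, u ≠ -v ∧ u ≠ -w := by
    intro e hne u hu
    constructor
    · rintro rfl
      rcases hvx e hne _ hu with h | h | h | h
      · exact ne_neg hcs hvw.mem1 h
      · exact hvw.nn hcs h.symm
      · exact h.nn hcs rfl
      · exact nw h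
    · rintro rfl
      rcases hvx e hne _ hu with h | h | h | h
      · exact hvw.nn hcs (by rw [← h, neg_neg])
      · exact ne_neg hcs hvw.mem2 h
      · exact nv h
      · exact h.nn hcs rfl
  have hngne : ∀ e, s e ≠ 0 → s (ng e) ≠ 0 := fun e h => by rw [hsym]; exact h
  have hor : ∀ e, s e ≠ 0 → ∀ u ∈ e, Ed P v u ∨ Ed P w u := by
    intro e hne u hu
    have h1 := hvx e hne u hu
    have h2 := hnn (ng e) (hngne e hne) (-u) (mem_ng.2 (by rwa [neg_neg]))
    rw [ne_eq, neg_inj, ne_eq, neg_inj] at h2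
    tauto
  have hnot : ∀ e, s e ≠ 0 → ∀ u ∈ e, Ed P w u → ¬ Ed P v u := by
    intro e hne u hu h1 h2
    rcases hor (ng e) (hngne e hne) (-u) (mem_ng.2 (by rwa [neg_neg])) with h | h
    · exact notEd_neg hv h2 h
    · exact notEd_neg hw h1 h
  have hall : ∀ e, s e ≠ 0 → (∀ u ∈ e, Ed P v u) ∨ (∀ u ∈ e, ¬ Ed P v u) := by
    intro e hne
    rcases hmem e hne with h | h
    · left
      intro u hu
      rcases Ev_mem h hu with rfl | h'
      · have := hnn (ng e) (hngne e hne) (-u) (mem_ng.2 (by rwa [neg_neg]))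
        exact absurd rfl this.1
      · exact h'
    · right
      intro u hu
      rcases Ev_mem h hu with rfl | h'
      · have := hnn (ng e) (hngne e hne) (-u) (mem_ng.2 (by rwa [neg_neg]))
        exact absurd rfl this.2
      · exact hnot e hne u hu h'
  let s' : Finset Pt → ℝ := fun e => if ∀ u ∈ e, Ed P v u then s e else 0
  have hs' : Strs (edgeFinset P) s' := by
    refine ⟨fun e he => by simp only [s']; rw [hsE.1 e he]; simp, fun m => ?_⟩
    rw [← hsE.2 (fun u => if Ed P v u then m u else 0)]
    apply Finset.sum_congr rfl
    intro e heE
    by_cases hne : s e = 0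
    · simp [s', hne]
    · rcases hall e hne with h | h
      · simp only [s', if_pos h]
        congr 1
        exact RR_congr (fun u hu => by rw [if_pos (h u hu)])
      · obtain ⟨x, y, -, rfl⟩ := mem_E.1 heE
        have hx := h x (by simp)
        have hy := h y (by simp)
        have : ¬ ∀ u ∈ ({x, y} : Finset Pt), Ed P v u := fun hh => hx (hh x (by simp))
        simp only [s', if_neg this, RR_pair, if_neg hx, if_neg hy]
        simp
  have hsym' := stress_symm hcs hg2 hs'
  by_contra hne
  have heA : ∀ u ∈ e, Ed P v u := by
    rcases hall e hne with h | h
    · exact h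
    · exfalso
      obtain ⟨x, y, -, rfl⟩ := mem_E.1 (Ev_sub P v he)
      have hx := h x (by simp)
      rcases Ev_mem he (u := x) (by simp) with rfl | h'
      · exact (hnn _ (hngne _ hne) (-x) (mem_ng.2 (by simp))).1 rfl
      · exact hx h'
  have h1 := hsym' e
  simp only [s', if_pos heA] at h1
  split_ifs at h1 with h2
  · obtain ⟨x, y, -, rfl⟩ := mem_E.1 (Ev_sub P v he)
    exact notEd_neg hv (heA x (by simp)) (h2 (-x) (mem_ng.2 (by simp)))
  · exact hne h1.symm

theorem no_stress (hcs : IsCS P) (hg2 : g2 P = 2) {v w : Pt} (hvw : Ed P v w) (hv : Av P v = ∅)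
    {s : Finset Pt → ℝ} (hs : Strs (Ev P v ∪ Ev P w) s) : ∀ e ∈ Ev P v ∪ Ev P w, s e = 0 := by
  have hsE : Strs (edgeFinset P) s := hs.up (union_subset (Ev_sub P v) (Ev_sub P w))
  rcases Av_dich hcs hg2 hvw.mem2 with hw | ⟨h6, h12⟩
  · intro e he
    rcases mem_union.1 he with h | h
    · exact half_stress hcs hg2 hvw hv hw hs h
    · rw [union_comm] at hs
      exact half_stress hcs hg2 hvw.symm hw hv hs h
  · intro e _
    have k : ∀ e, -w ∈ e → s e = 0 := by
      intro e hwe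
      apply hs.1
      intro he
      rcases mem_union.1 he with h | h
      · rcases Ev_mem h hwe with h | h
        · exact hvw.nn hcs (by rw [← h, neg_neg])
        · exact notEd_neg hv hvw h
      · rcases Ev_mem h hwe with h | h
        · exact ne_neg hcs hvw.mem2 h
        · exact h.nn hcs rfl
    apply stress_zero_of hcs hg2 hvw.mem2 h6 h12 hsE
    intro e h
    rcases h with h | h
    · rw [← stress_symm hcs hg2 hsE]
      exact k _ (mem_ng.2 (by rwa [neg_neg]))
    · exact k _ h

end

section
variable {P : SPolytope 4}

def Wn (P : SPolytope 4) (v : Pt) : Finset Pt := P.V.filter fun u => u = v ∨ Ed P v u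
def lk2 (P : SPolytope 4) (v w : Pt) : Finset Pt := P.V.filter fun x => x ≠ v ∧ x ≠ w ∧ BFace P {v, w, x}

lemma mem_Wn {v u : Pt} (hv : v ∈ P.V) : u ∈ Wn P v ↔ u = v ∨ Ed P v u := by
  simp only [Wn, mem_filter, and_iff_right_iff_imp]
  rintro (rfl | h)
  · exact hv
  · exact h.mem2

lemma mem_lk2 {v w x : Pt} : x ∈ lk2 P v w ↔ x ≠ v ∧ x ≠ w ∧ BFace P {v, w, x} := by
  simp only [lk2, mem_filter, and_iff_right_iff_imp]
  intro h; exact h.2.2.1 (by simp)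

lemma Wn_lower {v : Pt} (hv : v ∈ P.V) : 4 * (Wn P v).card ≤ (Ev P v).card + 10 := by
  apply count_lower
  intro m hm
  obtain ⟨p, h⟩ := star_triv P v hv m hm
  refine ⟨p, fun u hu => h u ?_⟩
  rcases (mem_Wn hv).1 hu with rfl | h
  · simpa using vertex_face P u hv
  · exact h.2

lemma Wn_big {v : Pt} (hv : v ∈ P.V) : Big (Wn P v) := by
  obtain ⟨t, ht, hf, hc⟩ := face_to_facet P {v} (vertex_face P v hv)
  refine (big_facet hf hc).mono ?_
  intro u hu
  rw [mem_Wn hv]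
  by_cases h : u = v
  · exact Or.inl h
  · exact Or.inr (face_Ed hf (ht (by simp)) hu (Ne.symm h))

lemma Wn_inter (hcs : IsCS P) (hg2 : g2 P = 2) {v w : Pt} (hvw : Ed P v w) (hv : Av P v = ∅) :
    (lk2 P v w).card + 2 ≤ (Wn P v ∩ Wn P w).card ∧ (∀ x ∈ Wn P v ∩ Wn P w, x = v ∨ x = w ∨ x ∈ lk2 P v w) := by
  constructor
  · have : (insert v (insert w (lk2 P v w))).card = (lk2 P v w).card + 2 := by
      rw [card_insert_of_notMem, card_insert_of_notMem]
      · simp [mem_lk2]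
      · simp only [mem_insert, mem_lk2]
        have := hvw.1
        tauto
    rw [← this]
    apply card_le_card
    intro x hx
    rw [mem_inter, mem_Wn hvw.mem1, mem_Wn hvw.mem2]
    simp only [mem_insert, mem_lk2] at hx
    rcases hx with rfl | rfl | ⟨h1, h2, h3⟩
    · exact ⟨Or.inl rfl, Or.inr hvw.symm⟩
    · exact ⟨Or.inr hvw, Or.inl rfl⟩
    · exact ⟨Or.inr (face_Ed h3 (by simp) (by simp) h1.symm), Or.inr (face_Ed h3 (by simp) (by simp) h2.symm)⟩
  · intro x hx
    rw [mem_inter, mem_Wn hvw.mem1, mem_Wn hvw.mem2] at hx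
    by_cases h1 : x = v
    · exact Or.inl h1
    by_cases h2 : x = w
    · exact Or.inr (Or.inl h2)
    right; right
    rw [mem_lk2]
    exact ⟨h1, h2, step3 hcs hg2 hvw (notEd_neg hv hvw) (hx.1.resolve_left h1) (hx.2.resolve_left h2)⟩

/-- pairs in the link cycle -/
def Qp (P : SPolytope 4) (v w : Pt) : Finset (Finset Pt) :=
  ((lk2 P v w).powersetCard 2).filter fun e => BFace P (insert v (insert w e))

lemma Qp_card {v w : Pt} (hvw : Ed P v w) : (Qp P v w).card ≤ (lk2 P v w).card := by
  have h1 := Finset.sum_card_bipartiteAbove_eq_sum_card_bipartiteBelow (s := lk2 P v w) (t := Qp P v w)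
    (fun (x : Pt) (e : Finset Pt) => x ∈ e)
  have h2 : ∀ e ∈ Qp P v w, ((lk2 P v w).bipartiteBelow (fun (x : Pt) (e : Finset Pt) => x ∈ e) e).card = 2 := by
    intro e he
    have := mem_powersetCard.1 (mem_filter.1 he).1
    rw [← this.2]
    congr 1
    ext x
    simp only [bipartiteBelow, mem_filter]
    exact ⟨fun h => h.2, fun h => ⟨this.1 h, h⟩⟩
  rw [Finset.sum_congr rfl h2, Finset.sum_const, smul_eq_mul] at h1
  have h3 : ∀ x ∈ lk2 P v w, ((Qp P v w).bipartiteAbove (fun (x : Pt) (e : Finset Pt) => x ∈ e) x).card ≤ 2 := by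
    intro x hx
    rw [mem_lk2] at hx
    by_contra hcon
    push Not at hcon
    obtain ⟨e1, m1, e2, m2, e3, m3, n12, n13, n23⟩ := Finset.two_lt_card.1 hcon
    have key : ∀ e ∈ (Qp P v w).bipartiteAbove (fun (x : Pt) (e : Finset Pt) => x ∈ e) x,
        ∃ j, e = {x, j} ∧ j ∉ ({v, w, x} : Finset Pt) ∧ BFace P (insert j {v, w, x}) := by
      intro e he
      simp only [bipartiteAbove, Qp, mem_filter, mem_powersetCard] at he
      obtain ⟨⟨⟨hs, hc⟩, hf⟩, hxe⟩ := he
      obtain ⟨a, b, hab, rfl⟩ := card_eq_two.1 hc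
      obtain ⟨j, hj⟩ : ∃ j, ({a, b} : Finset Pt) = {x, j} ∧ x ≠ j := by
        simp only [mem_insert, mem_singleton] at hxe
        rcases hxe with rfl | rfl
        · exact ⟨b, rfl, hab⟩
        · exact ⟨a, pair_comm _ _, hab.symm⟩
      rw [hj.1] at hs hf
      have hjl := mem_lk2.1 (hs (show j ∈ ({x, j} : Finset Pt) by simp))
      refine ⟨j, hj.1, ?_, hf.mono ?_⟩
      · simp only [mem_insert, mem_singleton]
        rintro (h | h | h)
        · exact hjl.1 h
        · exact hjl.2.1 h
        · exact hj.2 h.symm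
      · intro t; simp only [mem_insert, mem_singleton]; tauto
    obtain ⟨j1, rfl, a1, b1⟩ := key e1 m1
    obtain ⟨j2, rfl, a2, b2⟩ := key e2 m2
    obtain ⟨j3, rfl, a3, b3⟩ := key e3 m3
    refine wall_le P {v, w, x} ?_ j1 j2 j3 a1 a2 a3 b1 b2 b3 ?_ ?_ ?_
    · exact card_eq_three.2 ⟨v, w, x, hvw.1, hx.1.symm, hx.2.1.symm, rfl⟩
    · rintro rfl; exact n12 rfl
    · rintro rfl; exact n13 rfl
    · rintro rfl; exact n23 rfl
  have h4 := Finset.sum_le_card_nsmul _ _ _ h3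
  rw [smul_eq_mul] at h4
  omega

lemma EvEv_card (hp : IsPrimePoly P) (hcs : IsCS P) (hg2 : g2 P = 2) {v w : Pt} (hvw : Ed P v w) (hv : Av P v = ∅) :
    (Ev P v ∩ Ev P w).card ≤ 1 + 3 * (lk2 P v w).card := by
  have hsub : Ev P v ∩ Ev P w ⊆ {({v, w} : Finset Pt)} ∪ (((lk2 P v w).image fun x => ({v, x} : Finset Pt)) ∪
      (((lk2 P v w).image fun x => ({w, x} : Finset Pt)) ∪ Qp P v w)) := by
    intro e he
    have hin : ∀ u ∈ e, u = v ∨ u = w ∨ u ∈ lk2 P v w := by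
      intro u hu
      apply (Wn_inter hcs hg2 hvw hv).2
      rw [mem_inter] at he ⊢
      rw [mem_Wn hvw.mem1, mem_Wn hvw.mem2]
      exact ⟨Ev_mem he.1 hu, Ev_mem he.2 hu⟩
    rw [mem_inter] at he
    obtain ⟨x, y, hxy, rfl⟩ := mem_E.1 (Ev_sub P v he.1)
    simp only [mem_union, mem_singleton, mem_image]
    have hx := hin x (by simp)
    have hy := hin y (by simp)
    have hne := hxy.1
    rcases hx with rfl | rfl | hx
    · rcases hy with rfl | rfl | hy
      · exact absurd rfl hne
      · exact Or.inl rfl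
      · exact Or.inr (Or.inl ⟨y, hy, rfl⟩)
    · rcases hy with rfl | rfl | hy
      · exact Or.inl (pair_comm _ _)
      · exact absurd rfl hne
      · exact Or.inr (Or.inr (Or.inl ⟨y, hy, rfl⟩))
    · rcases hy with rfl | rfl | hy
      · exact Or.inr (Or.inl ⟨x, hx, pair_comm _ _⟩)
      · exact Or.inr (Or.inr (Or.inl ⟨x, hx, pair_comm _ _⟩))
      · right; right; right
        simp only [Qp, mem_filter, mem_powersetCard]
        refine ⟨⟨?_, card_pair hne⟩, ?_⟩
        · intro t ht
          simp only [mem_insert, mem_singleton] at ht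
          rcases ht with rfl | rfl <;> assumption
        · have hx' := mem_lk2.1 hx
          have hy' := mem_lk2.1 hy
          exact prime4 hp hvw.1 hx'.1.symm hy'.1.symm hx'.2.1.symm hy'.2.1.symm hne hx'.2.2 hy'.2.2
            (mem_filter.1 he.1).2 (mem_filter.1 he.2).2
  have h1 := card_le_card hsub
  have h2 := card_union_le {({v, w} : Finset Pt)} (((lk2 P v w).image fun x => ({v, x} : Finset Pt)) ∪
      (((lk2 P v w).image fun x => ({w, x} : Finset Pt)) ∪ Qp P v w))
  have h3 := card_union_le ((lk2 P v w).image fun x => ({v, x} : Finset Pt))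
      (((lk2 P v w).image fun x => ({w, x} : Finset Pt)) ∪ Qp P v w)
  have h4 := card_union_le ((lk2 P v w).image fun x => ({w, x} : Finset Pt)) (Qp P v w)
  have h5 := card_image_le (s := lk2 P v w) (f := fun x => ({v, x} : Finset Pt))
  have h6 := card_image_le (s := lk2 P v w) (f := fun x => ({w, x} : Finset Pt))
  have h7 := Qp_card hvw
  rw [card_singleton] at h2
  omega

theorem lk2_le (hp : IsPrimePoly P) (hcs : IsCS P) (hg2 : g2 P = 2) {v w : Pt} (hvw : Ed P v w) (hv : Av P v = ∅) :
    (lk2 P v w).card ≤ 3 := by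
  have h1 := Wn_lower hvw.mem1
  have h2 := Wn_lower hvw.mem2
  have h3 := EvEv_card hp hcs hg2 hvw hv
  have h4 := (Wn_inter hcs hg2 hvw hv).1
  have h5 := count_upper (Wn P v ∪ Wn P w) (Ev P v ∪ Ev P w) ((Wn_big hvw.mem1).mono subset_union_left) (by
    intro e he
    have hW : ∀ u ∈ e, u ∈ Wn P v ∪ Wn P w := by
      intro u hu
      rw [mem_union, mem_Wn hvw.mem1, mem_Wn hvw.mem2]
      rcases mem_union.1 he with h | h
      · exact Or.inl (Ev_mem h hu)
      · exact Or.inr (Ev_mem h hu)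
    obtain ⟨x, y, hxy, rfl⟩ := mem_E.1 (union_subset (Ev_sub P v) (Ev_sub P w) he)
    exact ⟨x, hW x (by simp), y, hW y (by simp), hxy.1, rfl⟩)
    (fun s hs => no_stress hcs hg2 hvw hv hs)
  have h6 := card_union_add_card_inter (Wn P v) (Wn P w)
  have h7 := card_union_add_card_inter (Ev P v) (Ev P w)
  omega

/-- in a vertex whose edge links have at most 3 vertices, walls through an edge force all faces -/
lemma lk_all {v a b c d : Pt} (hle : (lk2 P v a).card ≤ 3) (hva : v ≠ a)
    (hvb : v ≠ b) (hvc : v ≠ c) (hvd : v ≠ d) (hab : a ≠ b) (hac : a ≠ c) (had : a ≠ d)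
    (hbc : b ≠ c) (hbd : b ≠ d) (hcd : c ≠ d)
    (h1 : BFace P {v, a, b, c}) (h2 : BFace P {v, a, b, d}) : BFace P {v, a, c, d} := by
  have hL : {b, c, d} ⊆ lk2 P v a := by
    intro t ht
    simp only [mem_insert, mem_singleton] at ht
    rw [mem_lk2]
    rcases ht with rfl | rfl | rfl
    · exact ⟨hvb.symm, hab.symm, h1.mono (by intro x; simp only [mem_insert, mem_singleton]; tauto)⟩
    · exact ⟨hvc.symm, hac.symm, h1.mono (by intro x; simp only [mem_insert, mem_singleton]; tauto)⟩
    · exact ⟨hvd.symm, had.symm, h2.mono (by intro x; simp only [mem_insert, mem_singleton]; tauto)⟩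
  have hc3 : ({b, c, d} : Finset Pt).card = 3 := card_eq_three.2 ⟨b, c, d, hbc, hbd, hcd, rfl⟩
  have heq : {b, c, d} = lk2 P v a := Finset.eq_of_subset_of_card_le hL (by rw [hc3]; exact hle)
  have hτ : BFace P {v, a, c} := h1.mono (by intro x; simp only [mem_insert, mem_singleton]; tauto)
  have hτc : ({v, a, c} : Finset Pt).card = 3 := card_eq_three.2 ⟨v, a, c, hva, hvc, hac, rfl⟩
  obtain ⟨j1, j2, hj, n1, n2, f1, f2⟩ := wall_ge P _ hτ hτc
  have key : ∀ j, j ∉ ({v, a, c} : Finset Pt) → BFace P (insert j {v, a, c}) → j = b ∨ j = d := by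
    intro j n f
    simp only [mem_insert, mem_singleton, not_or] at n
    have : j ∈ lk2 P v a := mem_lk2.2 ⟨n.1, n.2.1, f.mono (by intro x; simp only [mem_insert, mem_singleton]; tauto)⟩
    rw [← heq] at this
    simp only [mem_insert, mem_singleton] at this
    rcases this with h | h | h
    · exact Or.inl h
    · exact absurd h n.2.2
    · exact Or.inr h
  have hd : BFace P (insert d {v, a, c}) := by
    rcases key j1 n1 f1 with rfl | rfl
    · rcases key j2 n2 f2 with rfl | rfl
      · exact absurd rfl hj
      · exact f2
    · exact f1
  exact hd.mono (by intro x; simp only [mem_insert, mem_singleton]; tauto)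

theorem Av_nonempty (hp : IsPrimePoly P) (hcs : IsCS P) (hg2 : g2 P = 2) {v : Pt} (hvV : v ∈ P.V) : Av P v ≠ ∅ := by
  intro hv
  obtain ⟨w, hw, hf1⟩ := face_extend P {v} (vertex_face P v hvV) (by simp)
  have hvw : v ≠ w := by rw [mem_singleton] at hw; exact fun h => hw h.symm
  obtain ⟨x, hx, hf2⟩ := face_extend P _ hf1 (by rw [card_pair hvw.symm]; norm_num)
  have hxw : x ≠ w := by rintro rfl; simp at hx
  have hxv : x ≠ v := by rintro rfl; simp at hx
  obtain ⟨y, z, hyz, hy, hz, hf3, hf4⟩ := wall_ge P _ hf2 (card_eq_three.2 ⟨x, w, v, hxw, hxv, hvw.symm, rfl⟩)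
  simp only [mem_insert, mem_singleton, not_or] at hy hz
  obtain ⟨hyx, hyw, hyv⟩ := hy
  obtain ⟨hzx, hzw, hzv⟩ := hz
  have ed : ∀ {s : Finset Pt} {t : Pt}, BFace P s → v ∈ s → t ∈ s → t ≠ v → (lk2 P v t).card ≤ 3 :=
    fun h h1 h2 h3 => lk2_le hp hcs hg2 (face_Ed h h1 h2 h3.symm) hv
  have lw := ed (t := w) hf3 (by simp) (by simp) hvw.symm
  have lx := ed (t := x) hf3 (by simp) (by simp) hxv
  have A : BFace P {v, w, x, y} := hf3.mono (by intro x; simp only [mem_insert, mem_singleton]; tauto)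
  have B : BFace P {v, w, x, z} := hf4.mono (by intro x; simp only [mem_insert, mem_singleton]; tauto)
  have C : BFace P {v, w, y, z} := lk_all lw hvw hxv.symm (Ne.symm hyv) (Ne.symm hzv) hxw.symm (Ne.symm hyw) (Ne.symm hzw)
    (Ne.symm hyx) (Ne.symm hzx) hyz A B
  have D : BFace P {v, x, y, z} := lk_all lx hxv.symm hvw (Ne.symm hyv) (Ne.symm hzv) hxw (Ne.symm hyx) (Ne.symm hzx)
    (Ne.symm hyw) (Ne.symm hzw) hyz (A.mono (by intro x; simp only [mem_insert, mem_singleton]; tauto))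
    (B.mono (by intro x; simp only [mem_insert, mem_singleton]; tauto))
  have E : BFace P {w, x, y, z} := by
    apply prime4 hp hxw.symm (Ne.symm hyw) (Ne.symm hzw) (Ne.symm hyx) (Ne.symm hzx) hyz
    · exact A.mono (by intro x; simp only [mem_insert, mem_singleton]; tauto)
    · exact B.mono (by intro x; simp only [mem_insert, mem_singleton]; tauto)
    · exact C.mono (by intro x; simp only [mem_insert, mem_singleton]; tauto)
    · exact D.mono (by intro x; simp only [mem_insert, mem_singleton]; tauto)
  have hc5 : ({v, w, x, y, z} : Finset Pt).card = 5 := by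
    rw [card_insert_of_notMem, card_insert_of_notMem, card_insert_of_notMem, card_pair hyz] <;>
      simp [hvw, hxv.symm, Ne.symm hyv, Ne.symm hzv, hxw.symm, Ne.symm hyw, Ne.symm hzw, Ne.symm hyx, Ne.symm hzx]
  have hsub := simplex_all (P := P) {v, w, x, y, z} hc5 (by
    intro a ha
    simp only [mem_insert, mem_singleton] at ha
    rcases ha with h | h | h | h | h
    · exact E.mono (by intro t; simp only [mem_erase, mem_insert, mem_singleton, h]; rintro ⟨h1, h2⟩; exact h2.resolve_left h1)
    · exact D.mono (by intro t; simp only [mem_erase, mem_insert, mem_singleton, h]; rintro ⟨h1, h2 | h2 | h2⟩; exacts [Or.inl h2, absurd h2 h1, Or.inr h2])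
    · exact C.mono (by intro t; simp only [mem_erase, mem_insert, mem_singleton, h]; rintro ⟨h1, h2 | h2 | h2 | h2⟩; exacts [Or.inl h2, Or.inr (Or.inl h2), absurd h2 h1, Or.inr (Or.inr h2)])
    · exact B.mono (by intro t; simp only [mem_erase, mem_insert, mem_singleton, h]; rintro ⟨h1, h2 | h2 | h2 | h2 | h2⟩; exacts [Or.inl h2, Or.inr (Or.inl h2), Or.inr (Or.inr (Or.inl h2)), absurd h2 h1, Or.inr (Or.inr (Or.inr h2))])
    · exact A.mono (by intro t; simp only [mem_erase, mem_insert, mem_singleton, h]; rintro ⟨h1, h2 | h2 | h2 | h2 | h2⟩; exacts [Or.inl h2, Or.inr (Or.inl h2), Or.inr (Or.inr (Or.inl h2)), Or.inr (Or.inr (Or.inr h2)), absurd h2 h1]))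
  have h1 := card_le_card hsub
  have h2 := V_card P
  have h3 := half_card (σ := nP) nP_nP (S := P.V) hcs (fun x hx => ne_neg hcs hx)
  omega

end

/-- A prime centrally symmetric simplicial `4`-polytope with `g₂(P) = 2`
is a `4`-dimensional cross-polytope. -/
theorem stmt9 (P : SPolytope 4) (hp : IsPrimePoly P) (hcs : IsCS P)
    (hg2 : g2 P = 2) :
    IsCrossPolytope P := by
  apply cross_of_all hcs hg2
  intro v hv
  exact (Av_dich hcs hg2 hv).resolve_left (Av_nonempty hp hcs hg2 hv)
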